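/- Let G be a graph of genus g > 0, let (G,X,M) be a matching MEDP instance with terminal set X and demand matching M, and let x be a feasible fractional LP solution with marginals x(v). Suppose X is π-flow-well-linked in G where π(v) = ρ·x(v) for some scalar ρ ≤ 1. Then there is a constant c > 0 (independent of G, g, ρ) such that at least c·ρ·val(x)/g of the demand pairs of M can be routed integrally with congestion 3. -/

import Mathlib

open Finset

/-- Count of occurrences of `e` in a list (classical, no decidability assumptions). -/
noncomputable def ecount {α : Type} (l : List α) (e : α) : ℕ :=
  letI := Classical.decEq α
  l.count e

/-- A fractional solution to the multicommodity-flow LP relaxation of MEDP on the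
graph `G` (with unit edge capacities) for the demand pairs `(s d, t d)`, `d : Fin n`.
It consists of finitely many flow paths (walks), each joining the endpoints of its
demand, with nonnegative values, total value at most `1` per demand, and total value
at most `1` per edge. -/
structure FracSol {V : Type} (G : SimpleGraph V) {n : ℕ} (s t : Fin n → V) where
  m : ℕ
  dem : Fin m → Fin n
  fpath : ∀ i : Fin m, G.Walk (s (dem i)) (t (dem i))
  xval : Fin m → ℝ
  nonneg : ∀ i, 0 ≤ xval i
  perDemand : ∀ d : Fin n,
    (∑ i : Fin m, if dem i = d then xval i else 0) ≤ 1
  capacity : ∀ e : Sym2 V,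
    (∑ i : Fin m, (ecount (fpath i).edges e : ℝ) * xval i) ≤ 1

namespace FracSol

variable {V : Type} {G : SimpleGraph V} {n : ℕ} {s t : Fin n → V}

/-- The value `val(x) = ∑_P x_P` of a fractional solution. -/
noncomputable def value (x : FracSol G s t) : ℝ := ∑ i, x.xval i

/-- The amount of flow `z_d` routed for demand `d`. -/
noncomputable def demVal (x : FracSol G s t) (d : Fin n) : ℝ :=
  ∑ i, if x.dem i = d then x.xval i else 0

/-- The marginal value `x(v)` of a vertex `v`: total flow of demands having `v` as an
endpoint. -/
noncomputable def vertexMarg (x : FracSol G s t) (v : V) : ℝ :=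
  letI := Classical.decEq V
  ∑ d : Fin n, if s d = v ∨ t d = v then x.demVal d else 0

end FracSol

/-- There is an integral routing, with congestion at most `c`, of at least `N` of the
demand pairs `(s d, t d)`: a subset `I` of at least `N` demands and for each a connecting
path, such that every edge lies on at most `c` of the paths (counted with multiplicity). -/
def HasIntegralRouting {V : Type} (G : SimpleGraph V) {n : ℕ}
    (s t : Fin n → V) (c : ℕ) (N : ℝ) : Prop :=
  ∃ (I : Finset (Fin n)) (Q : ∀ d ∈ I, G.Walk (s d) (t d)),
    N ≤ (I.card : ℝ) ∧
    ∀ e : Sym2 V, (∑ d ∈ I.attach, ecount (Q d.1 d.2).edges e) ≤ c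

/-- The demand pairs form a matching on the terminals: all `2n` endpoints are distinct. -/
def IsMatchingInstance {V : Type} {n : ℕ} (s t : Fin n → V) : Prop :=
  Function.Injective (fun p : Fin n × Bool => if p.2 then s p.1 else t p.1)

/-- The set of terminals of a demand family. -/
def terminalSet {V : Type} [DecidableEq V] {n : ℕ} (s t : Fin n → V) : Finset V :=
  Finset.univ.image s ∪ Finset.univ.image t

/-- The reversal permutation on darts of a graph. -/
def dartRev {V : Type} (G : SimpleGraph V) : Equiv.Perm G.Dart :=
  ⟨SimpleGraph.Dart.symm, SimpleGraph.Dart.symm,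
    fun d => SimpleGraph.Dart.symm_symm d, fun d => SimpleGraph.Dart.symm_symm d⟩

/-- The setoid on `α` whose classes are the orbits (cycles) of the permutation `f`. -/
def permOrbitSetoid {α : Type} (f : Equiv.Perm α) : Setoid α :=
  ⟨f.SameCycle, ⟨fun x => Equiv.Perm.SameCycle.refl f x,
    fun h => h.symm, fun h h' => h.trans h'⟩⟩

/-- The number of orbits (cycles, including fixed points) of a permutation. -/
noncomputable def numOrbits {α : Type} (f : Equiv.Perm α) : ℕ :=
  Nat.card (Quotient (permOrbitSetoid f))

/-- A rotation system (combinatorial embedding into an orientable surface) for the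
graph `G`: a permutation of the darts which fixes the tail of each dart and whose
restriction to the darts out of any fixed vertex is a single cycle. -/
structure RotationSystem {V : Type} (G : SimpleGraph V) where
  rot : Equiv.Perm G.Dart
  tail_fixed : ∀ d : G.Dart, (rot d).toProd.1 = d.toProd.1
  vertex_cycle : ∀ d d' : G.Dart, d.toProd.1 = d'.toProd.1 → rot.SameCycle d d'

/-- The number of faces of the embedding described by a rotation system: the number of
orbits of the face permutation (rotation composed with dart reversal). -/
noncomputable def RotationSystem.numFaces {V : Type} {G : SimpleGraph V}
    (rs : RotationSystem G) : ℕ :=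
  numOrbits (rs.rot * dartRev G)

/-- `G` embeds in the orientable surface of genus `g`; combinatorially, `G` has a
rotation system whose Euler characteristic `|V| - |E| + F` is at least
`2·(number of components) - 2g`. -/
def genusLE {V : Type} (G : SimpleGraph V) (g : ℕ) : Prop :=
  ∃ rs : RotationSystem G,
    (2 * Nat.card G.ConnectedComponent : ℤ) - 2 * (g : ℤ) ≤
      (Nat.card V : ℤ) - (G.edgeSet.ncard : ℤ) + (rs.numFaces : ℤ)

/-- `X` is `π`-flow-well-linked in `G`: there is a feasible multicommodity flow in `G`
(respecting unit edge capacities) routing `π(u)·π(v)/π(X)` between every unordered pair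
of distinct `u, v ∈ X`. -/
def FlowWellLinked {V : Type} [DecidableEq V] (G : SimpleGraph V) (X : Finset V)
    (π : V → ℝ) : Prop :=
  ∃ (m : ℕ) (a b : Fin m → V) (P : ∀ i, G.Walk (a i) (b i)) (f : Fin m → ℝ),
    (∀ i, 0 ≤ f i) ∧
    (∀ e : Sym2 V, (∑ i, (ecount (P i).edges e : ℝ) * f i) ≤ 1) ∧
    (∀ u ∈ X, ∀ v ∈ X, u ≠ v →
      (∑ i, if (a i = u ∧ b i = v) ∨ (a i = v ∧ b i = u) then f i else 0)
        = π u * π v / (∑ w ∈ X, π w))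

/-- There is a single-commodity flow in `G` (respecting unit edge capacities) which
simultaneously routes `φ(v)` units from each `v ∈ A`, all flow terminating in `R`. -/
def RoutesToSet {V : Type} [DecidableEq V] (G : SimpleGraph V) (φ : V → ℝ)
    (A R : Finset V) : Prop :=
  ∃ (m : ℕ) (a b : Fin m → V) (P : ∀ i, G.Walk (a i) (b i)) (f : Fin m → ℝ),
    (∀ i, 0 ≤ f i) ∧ (∀ i, a i ∈ A ∧ b i ∈ R) ∧
    (∀ e : Sym2 V, (∑ i, (ecount (P i).edges e : ℝ) * f i) ≤ 1) ∧
    (∀ v ∈ A, φ v ≤ ∑ i, if a i = v then f i else 0)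

set_option linter.unusedSectionVars false
set_option linter.unusedFintypeInType false

/-- A finite multigraph with edge type `E`, each edge being given by its two ends. -/
structure MGraph (V E : Type) where
  src : E → V
  dst : E → V

namespace MGraph

section
open scoped Classical symmDiff

variable {V E F ι : Type} [Fintype V] [Fintype E] [Fintype F]

/-- The edges with exactly one end in `U`. -/
noncomputable def cut (G : MGraph V E) (U : Finset V) : Finset E :=
  univ.filter fun e => ¬ (G.src e ∈ U ↔ G.dst e ∈ U)

/-- `x` is an end of `e`. -/
def Inc (G : MGraph V E) (e : E) (x : V) : Prop := G.src e = x ∨ G.dst e = x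

/-- `K` has even degree at every vertex. -/
def IsEven (G : MGraph V E) (K : Finset E) : Prop :=
  ∀ y : V → ZMod 2, ∑ e ∈ K, (y (G.src e) + y (G.dst e)) = 0

/-- The edges of `K` connect all of `Y`: no vertex set uncrossed by `K` splits `Y`. -/
def Connects (G : MGraph V E) (K : Finset E) (Y : Finset V) : Prop :=
  ∀ U, Disjoint K (G.cut U) → Y ⊆ U ∨ Disjoint Y U

lemma mem_cut {G : MGraph V E} {U : Finset V} {e : E} :
    e ∈ G.cut U ↔ ¬ (G.src e ∈ U ↔ G.dst e ∈ U) := by simp [cut]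

lemma cut_symmDiff (G : MGraph V E) (U W : Finset V) : G.cut (U ∆ W) = G.cut U ∆ G.cut W := by
  ext e; simp only [mem_cut, mem_symmDiff]; tauto

lemma cut_compl (G : MGraph V E) (U : Finset V) : G.cut Uᶜ = G.cut U := by
  ext e; simp only [mem_cut, mem_compl]; tauto

@[simp] lemma cut_empty (G : MGraph V E) : G.cut ∅ = ∅ := by ext; simp [mem_cut]

lemma cut_union_subset (G : MGraph V E) (U W : Finset V) :
    G.cut (U ∪ W) ⊆ G.cut U ∪ G.cut W := by
  intro e; simp only [mem_cut, mem_union]; tauto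

lemma cut_sdiff_subset (G : MGraph V E) (U W : Finset V) :
    G.cut (U \ W) ⊆ G.cut U ∪ G.cut W := by
  intro e; simp only [mem_cut, mem_union, mem_sdiff]; tauto

lemma sum_symmDiff_zmod (K L : Finset E) (y : E → ZMod 2) :
    ∑ e ∈ K ∆ L, y e = ∑ e ∈ K, y e + ∑ e ∈ L, y e := by
  have h1 : K ∆ L = (K \ L) ∪ (L \ K) := by ext; simp [mem_symmDiff]
  have hd : Disjoint (K \ L) (L \ K) := disjoint_sdiff_sdiff
  rw [h1, sum_union hd, ← sum_sdiff (inter_subset_left : K ∩ L ⊆ K),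
    ← sum_sdiff (inter_subset_right : K ∩ L ⊆ L)]
  have e1 : K \ (K ∩ L) = K \ L := by ext; simp
  have e2 : L \ (K ∩ L) = L \ K := by ext; simp
  rw [e1, e2]
  have : ∑ e ∈ K ∩ L, y e + ∑ e ∈ K ∩ L, y e = 0 := CharTwo.add_self_eq_zero _
  linear_combination -this

lemma IsEven.symmDiff {G : MGraph V E} {K L : Finset E} (hK : G.IsEven K) (hL : G.IsEven L) :
    G.IsEven (K ∆ L) := by
  intro y
  rw [sum_symmDiff_zmod, hK y, hL y, add_zero]

lemma isEven_empty (G : MGraph V E) : G.IsEven ∅ := by intro y; simp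

end

section menger
open scoped Classical

variable {V E ι : Type} [Fintype V] [Fintype E]

/-- The arcs of `D` leaving `U`. -/
noncomputable def out {α : Type} (tl hd : α → V) (D : Finset α) (U : Finset V) : Finset α :=
  D.filter fun x => tl x ∈ U ∧ hd x ∉ U

/-- The tokens of `A` sitting in `U`. -/
noncomputable def tokens (pos : ι → V) (A : Finset ι) (U : Finset V) : Finset ι :=
  A.filter fun i => pos i ∈ U

lemma out_submodular {α : Type} (tl hd : α → V) (D : Finset α) (U W : Finset V) :
    (out tl hd D (U ∪ W)).card + (out tl hd D (U ∩ W)).card ≤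
      (out tl hd D U).card + (out tl hd D W).card := by
  simp only [out, card_filter, ← sum_add_distrib]
  refine sum_le_sum fun x _ => ?_
  by_cases h1 : tl x ∈ U <;> by_cases h2 : tl x ∈ W <;> by_cases h3 : hd x ∈ U <;>
    by_cases h4 : hd x ∈ W <;> simp [h1, h2, h3, h4]

lemma tokens_modular (pos : ι → V) (A : Finset ι) (U W : Finset V) :
    (tokens pos A (U ∪ W)).card + (tokens pos A (U ∩ W)).card =
      (tokens pos A U).card + (tokens pos A W).card := by
  simp only [tokens, card_filter, ← sum_add_distrib]
  refine sum_congr rfl fun x _ => ?_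
  by_cases h1 : pos x ∈ U <;> by_cases h2 : pos x ∈ W <;> simp [h1, h2]

/-- The cut condition for routing the tokens of `A` into `R` along arcs of `D`. -/
def CutCond {α : Type} (tl hd : α → V) (R : Finset V) (D : Finset α) (pos : ι → V)
    (A : Finset ι) : Prop :=
  ∀ U, Disjoint U R → (tokens pos A U).card ≤ (out tl hd D U).card

lemma CutCond.tight_union {α : Type} {tl hd : α → V} {R : Finset V} {D : Finset α} {pos : ι → V}
    {A : Finset ι} (h : CutCond tl hd R D pos A) {U W : Finset V} (hU : Disjoint U R)
    (_hW : Disjoint W R) (tU : (out tl hd D U).card ≤ (tokens pos A U).card)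
    (tW : (out tl hd D W).card ≤ (tokens pos A W).card) :
    (out tl hd D (U ∪ W)).card ≤ (tokens pos A (U ∪ W)).card := by
  have h1 := out_submodular tl hd D U W
  have h2 := tokens_modular pos A U W
  have h3 := h (U ∩ W) (hU.mono_left inter_subset_left)
  omega

/-- A largest set among those with a property closed under unions contains all of them. -/
lemma exists_greatest {p : Finset V → Prop} (h0 : p ∅) (hu : ∀ U W, p U → p W → p (U ∪ W)) :
    ∃ T, p T ∧ ∀ U, p U → U ⊆ T := by
  obtain ⟨T, hT, hmax⟩ := (univ.filter p).exists_max_image card ⟨∅, by simpa using h0⟩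
  simp only [mem_filter, mem_univ, true_and] at hT hmax
  refine ⟨T, hT, fun U hU => ?_⟩
  have h1 := hmax _ (hu T U hT hU)
  have h2 : T = T ∪ U := eq_of_subset_of_card_le subset_union_left h1
  rw [h2]; exact subset_union_right

/-- Integral single-commodity routing in a directed graph. -/
lemma CutCond.exists_routing {α : Type} {tl hd : α → V} {R : Finset V} {A : Finset ι} :
    ∀ (n : ℕ) (D : Finset α) (pos : ι → V), D.card = n → CutCond tl hd R D pos A →
      ∃ L : ι → Finset α, (∀ i ∈ A, L i ⊆ D) ∧
        (∀ i ∈ A, ∀ j ∈ A, i ≠ j → Disjoint (L i) (L j)) ∧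
        ∀ i ∈ A, ∀ U : Finset V, pos i ∈ U → (∀ x ∈ L i, tl x ∈ U → hd x ∈ U) →
          ∃ r ∈ R, r ∈ U := by
  intro n
  induction n with
  | zero =>
    intro D pos hD h
    have hD : D = ∅ := card_eq_zero.1 hD
    refine ⟨fun _ => ∅, by simp, by simp, fun i hi U hU _ => ?_⟩
    by_contra hc
    push Not at hc
    have h1 := h U (disjoint_left.2 fun a ha hr => hc a hr ha)
    have : 0 < (tokens pos A U).card := card_pos.2 ⟨i, by simp [tokens, hi, hU]⟩
    have h2 : (out tl hd D U).card = 0 := by simp [out, hD]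
    omega
  | succ n ih =>
    intro D pos hD h
    by_cases hall : ∀ i ∈ A, pos i ∈ R
    · exact ⟨fun _ => ∅, by simp, by simp, fun i hi U hU _ => ⟨pos i, hall i hi, hU⟩⟩
    push Not at hall
    obtain ⟨i₀, hi₀, hv⟩ := hall
    obtain ⟨T, ⟨hTR, hTv, hTt⟩, hTmax⟩ := exists_greatest
      (p := fun U => Disjoint U R ∧ pos i₀ ∉ U ∧
        (out tl hd D U).card ≤ (tokens pos A U).card)
      (by simp [out]) (fun U W hU hW => ⟨by rw [disjoint_union_left]; exact ⟨hU.1, hW.1⟩,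
        by simp [hU.2.1, hW.2.1], h.tight_union hU.1 hW.1 hU.2.2 hW.2.2⟩)
    obtain ⟨x, hx, hxt, hxT⟩ : ∃ x ∈ D, tl x = pos i₀ ∧ hd x ∉ insert (pos i₀) T := by
      by_contra hc
      push Not at hc
      have h1 := h (insert (pos i₀) T) (by rw [disjoint_insert_left]; exact ⟨hv, hTR⟩)
      have h2 : (tokens pos A T).card < (tokens pos A (insert (pos i₀) T)).card := by
        refine card_lt_card ((ssubset_iff_of_subset ?_).2 ⟨i₀, ?_, ?_⟩)
        · intro j; simp only [tokens, mem_filter, mem_insert]; tauto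
        · simp [tokens, hi₀]
        · simp [tokens, hTv]
      have h3 : (out tl hd D (insert (pos i₀) T)).card ≤ (out tl hd D T).card := by
        refine card_le_card fun z => ?_
        simp only [out, mem_filter]
        rintro ⟨hz, hz1, hz2⟩
        refine ⟨hz, ?_, fun hh => hz2 (mem_insert_of_mem hh)⟩
        rcases mem_insert.1 hz1 with hz1 | hz1
        · exact absurd (hc z hz hz1) hz2
        · exact hz1
      omega
    have hxT' : ∀ U, Disjoint U R → hd x ∈ U → pos i₀ ∉ U →
        (tokens pos A U).card < (out tl hd D U).card := by
      intro U hU hxU hvU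
      by_contra hc
      exact hxT (mem_insert_of_mem (hTmax U ⟨hU, hvU, by omega⟩ hxU))
    have hne : hd x ≠ pos i₀ := fun hh => hxT (by simp [hh])
    obtain ⟨L, hL1, hL2, hL3⟩ := ih (D.erase x) (Function.update pos i₀ (hd x))
      (by rw [card_erase_of_mem hx]; omega) (by
        intro U hU
        have hb := h U hU
        have out_eq : out tl hd (D.erase x) U = (out tl hd D U).erase x := by
          ext z; simp only [out, mem_filter, mem_erase]; tauto
        by_cases hvU : pos i₀ ∈ U <;> by_cases hxU : hd x ∈ U
        · have e1 : tokens (Function.update pos i₀ (hd x)) A U = tokens pos A U := by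
            ext j; by_cases hj : j = i₀
            · subst hj; simp [tokens, hvU, hxU]
            · simp [tokens, hj]
          rw [e1, out_eq, erase_eq_of_notMem (by simp [out, hxU])]
          exact hb
        · have e1 : tokens (Function.update pos i₀ (hd x)) A U = (tokens pos A U).erase i₀ := by
            ext j; by_cases hj : j = i₀
            · subst hj; simp [tokens, hxU]
            · simp [tokens, hj]
          have m1 : x ∈ out tl hd D U := by simp [out, hx, hxt, hxU, hvU]
          have m2 : i₀ ∈ tokens pos A U := by simp [tokens, hi₀, hvU]
          rw [e1, out_eq, card_erase_of_mem m1, card_erase_of_mem m2]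
          omega
        · have e1 : tokens (Function.update pos i₀ (hd x)) A U = insert i₀ (tokens pos A U) := by
            ext j; by_cases hj : j = i₀
            · subst hj; simp [tokens, hxU, hi₀]
            · simp [tokens, hj]
          have := hxT' U hU hxU hvU
          rw [e1, out_eq, erase_eq_of_notMem (by simp [out, hxU])]
          exact (card_insert_le _ _).trans this
        · have e1 : tokens (Function.update pos i₀ (hd x)) A U = tokens pos A U := by
            ext j; by_cases hj : j = i₀
            · subst hj; simp [tokens, hxU, hvU]
            · simp [tokens, hj]
          rw [e1, out_eq, erase_eq_of_notMem (by simp [out, hxt, hvU])]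
          exact hb)
    refine ⟨Function.update L i₀ (insert x (L i₀)), ?_, ?_, ?_⟩
    · intro i hi
      by_cases hj : i = i₀
      · subst hj
        simp only [Function.update_self]
        exact insert_subset hx ((hL1 i hi).trans (erase_subset _ _))
      · rw [Function.update_of_ne hj]
        exact (hL1 i hi).trans (erase_subset _ _)
    · have hxL : ∀ j ∈ A, x ∉ L j := fun j hj hh => by simpa using hL1 j hj hh
      intro i hi j hj hij
      by_cases h1 : i = i₀ <;> by_cases h2 : j = i₀
      · exact absurd (h1.trans h2.symm) hij
      · rw [h1, Function.update_self, Function.update_of_ne h2, disjoint_insert_left]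
        exact ⟨hxL j hj, h1 ▸ hL2 i hi j hj hij⟩
      · rw [h2, Function.update_self, Function.update_of_ne h1, disjoint_insert_right]
        exact ⟨hxL i hi, h2 ▸ hL2 i hi j hj hij⟩
      · rw [Function.update_of_ne h1, Function.update_of_ne h2]
        exact hL2 i hi j hj hij
    · intro i hi U hU hclosed
      by_cases h1 : i = i₀
      · rw [h1] at hclosed hU
        simp only [Function.update_self, mem_insert, forall_eq_or_imp] at hclosed
        refine hL3 i₀ hi₀ U ?_ hclosed.2
        rw [Function.update_self]
        exact hclosed.1 (by rw [hxt]; exact hU)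
      · rw [Function.update_of_ne h1] at hclosed
        exact hL3 i hi U (by rw [Function.update_of_ne h1]; exact hU) hclosed

/-- The two orientations of the edges. -/
def tl (G : MGraph V E) (x : E × Bool) : V := if x.2 then G.src x.1 else G.dst x.1

/-- The two orientations of the edges. -/
def hd (G : MGraph V E) (x : E × Bool) : V := if x.2 then G.dst x.1 else G.src x.1

lemma card_out_univ (G : MGraph V E) (U : Finset V) :
    (out G.tl G.hd univ U).card = (G.cut U).card := by
  rw [out, cut, card_filter, card_filter, Fintype.sum_prod_type]
  refine sum_congr rfl fun e _ => ?_
  rw [Fintype.sum_bool]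
  by_cases h1 : G.src e ∈ U <;> by_cases h2 : G.dst e ∈ U <;> simp [tl, hd, h1, h2]

/-- Edge-disjoint Menger: under the cut condition all tokens can be led to `R`
along pairwise disjoint edge sets. -/
lemma exists_disjoint_links_of_cut (G : MGraph V E) (R : Finset V) (A : Finset ι) (pos : ι → V)
    (h : ∀ U, Disjoint U R → (tokens pos A U).card ≤ (G.cut U).card) :
    ∃ L : ι → Finset E, (∀ i ∈ A, ∀ j ∈ A, i ≠ j → Disjoint (L i) (L j)) ∧
      ∀ i ∈ A, ∀ U : Finset V, pos i ∈ U → Disjoint (L i) (G.cut U) → ∃ r ∈ R, r ∈ U := by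
  obtain ⟨D, hD, hmin⟩ := (univ.filter fun D => CutCond G.tl G.hd R D pos A).exists_min_image card
    ⟨univ, by
      simp only [mem_filter, mem_univ, true_and]
      intro U hU; rw [card_out_univ]; exact h U hU⟩
  simp only [mem_filter, mem_univ, true_and] at hD hmin
  have key : ∀ x ∈ D, ∃ U, Disjoint U R ∧ G.tl x ∈ U ∧ G.hd x ∉ U ∧
      (out G.tl G.hd D U).card ≤ (tokens pos A U).card := by
    intro x hx
    by_contra hc
    push Not at hc
    have : CutCond G.tl G.hd R (D.erase x) pos A := by
      intro U hU
      have out_eq : out G.tl G.hd (D.erase x) U = (out G.tl G.hd D U).erase x := by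
        ext z; simp only [out, mem_filter, mem_erase]; tauto
      rw [out_eq]
      by_cases hx' : x ∈ out G.tl G.hd D U
      · have := hc U hU (by simp [out] at hx'; tauto) (by simp [out] at hx'; tauto)
        rw [card_erase_of_mem hx']; omega
      · rw [erase_eq_of_notMem hx']; exact hD U hU
    have h1 := hmin _ this
    rw [card_erase_of_mem hx] at h1
    have := card_pos.2 ⟨x, hx⟩
    omega
  have hopp : ∀ e, ¬ ((e, true) ∈ D ∧ (e, false) ∈ D) := by
    rintro e ⟨h1, h2⟩
    obtain ⟨U, hU, hU1, hU2, hU3⟩ := key _ h1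
    obtain ⟨W, hW, hW1, hW2, hW3⟩ := key _ h2
    simp only [tl, hd, if_true] at hU1 hU2 hW1 hW2
    simp only [Bool.false_eq_true, if_false] at hW1 hW2
    have a1 := hD (U ∪ W) (by rw [disjoint_union_left]; exact ⟨hU, hW⟩)
    have a2 := hD (U ∩ W) (hU.mono_left inter_subset_left)
    have a3 := tokens_modular pos A U W
    have a4 : (out G.tl G.hd D (U ∪ W)).card + (out G.tl G.hd D (U ∩ W)).card <
      (out G.tl G.hd D U).card + (out G.tl G.hd D W).card := by
      simp only [out, card_filter, ← sum_add_distrib]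
      refine sum_lt_sum (fun x _ => ?_) ⟨(e, true), h1, ?_⟩
      · by_cases h1 : G.tl x ∈ U <;> by_cases h2 : G.tl x ∈ W <;> by_cases h3 : G.hd x ∈ U <;>
          by_cases h4 : G.hd x ∈ W <;> simp [h1, h2, h3, h4]
      · simp [tl, hd, hU1, hU2, hW1, hW2]
    omega
  obtain ⟨L, hL1, hL2, hL3⟩ := CutCond.exists_routing D.card D pos rfl hD
  refine ⟨fun i => (L i).image Prod.fst, ?_, ?_⟩
  · intro i hi j hj hij
    rw [disjoint_left]
    intro e h1 h2
    obtain ⟨⟨e1, b1⟩, hx, rfl⟩ := mem_image.1 h1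
    obtain ⟨⟨e2, b2⟩, hy, h3⟩ := mem_image.1 h2
    simp only at h3
    subst h3
    have hxD := hL1 i hi hx
    have hyD := hL1 j hj hy
    have : b1 = b2 := by
      cases b1 <;> cases b2 <;> first | rfl | exact absurd ⟨hxD, hyD⟩ (hopp _) |
        exact absurd ⟨hyD, hxD⟩ (hopp _)
    subst this
    exact disjoint_left.1 (hL2 i hi j hj hij) hx hy
  · intro i hi U hU hdis
    refine hL3 i hi U hU fun x hx hxU => ?_
    have := disjoint_left.1 hdis (mem_image_of_mem Prod.fst hx)
    rw [mem_cut, not_not] at this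
    obtain ⟨e, b⟩ := x
    cases b <;> simp [tl, hd] at * <;> tauto

/-- Edge-disjoint Menger with deficiency `k`. -/
lemma exists_disjoint_links (G : MGraph V E) (R : Finset V) (A : Finset ι) (pos : ι → V) (k : ℕ)
    (h : ∀ U, Disjoint U R → (tokens pos A U).card ≤ (G.cut U).card + k) :
    ∃ A' ⊆ A, A.card ≤ A'.card + k ∧
      ∃ L : ι → Finset E, (∀ i ∈ A', ∀ j ∈ A', i ≠ j → Disjoint (L i) (L j)) ∧
      ∀ i ∈ A', ∀ U : Finset V, pos i ∈ U → Disjoint (L i) (G.cut U) → ∃ r ∈ R, r ∈ U := by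
  obtain ⟨A', hA', hmax⟩ := (A.powerset.filter fun A' => CutCond G.tl G.hd R univ pos A')
    |>.exists_max_image card ⟨∅, mem_filter.2 ⟨by simp, fun U _ => by simp [tokens]⟩⟩
  simp only [mem_filter, mem_powerset] at hA' hmax
  refine ⟨A', hA'.1, ?_, exists_disjoint_links_of_cut G R A' pos fun U hU => by
    rw [← card_out_univ]; exact hA'.2 U hU⟩
  obtain ⟨T, ⟨hTR, hTt⟩, hTmax⟩ := exists_greatest
    (p := fun U => Disjoint U R ∧ (out G.tl G.hd univ U).card ≤ (tokens pos A' U).card)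
    (by simp [out]) (fun U W hU hW => ⟨by rw [disjoint_union_left]; exact ⟨hU.1, hW.1⟩,
        hA'.2.tight_union hU.1 hW.1 hU.2 hW.2⟩)
  have hin : ∀ i ∈ A, i ∉ A' → pos i ∈ T := by
    intro i hi hi'
    by_contra hc
    have hcc : CutCond G.tl G.hd R univ pos (insert i A') := by
      intro U hU
      have hb := hA'.2 U hU
      have e1 : (tokens pos (insert i A') U).card ≤
          (tokens pos A' U).card + if pos i ∈ U then 1 else 0 := by
        simp only [tokens, filter_insert]
        split_ifs
        · exact card_insert_le _ _
        · simp
      split_ifs at e1 with hiU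
      · have : ¬ (out G.tl G.hd univ U).card ≤ (tokens pos A' U).card :=
          fun hh => hc (hTmax U ⟨hU, hh⟩ hiU)
        omega
      · omega
    have := hmax _ ⟨insert_subset hi hA'.1, hcc⟩
    rw [card_insert_of_notMem hi'] at this
    omega
  have h1 := h T hTR
  rw [card_out_univ] at hTt
  have h2 : tokens pos A T = tokens pos A' T ∪ (A \ A') := by
    ext i; simp only [tokens, mem_filter, mem_union, mem_sdiff]
    have := hin i
    have := @hA'.1 i
    tauto
  have h3 : Disjoint (tokens pos A' T) (A \ A') :=
    disjoint_left.2 fun i hi hi' => (mem_sdiff.1 hi').2 (mem_filter.1 hi).1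
  rw [h2, card_union_of_disjoint h3, card_sdiff_of_subset hA'.1] at h1
  have := card_le_card hA'.1
  omega

end menger
end MGraph

namespace MGraph

section dual
open scoped Classical symmDiff

variable {V E F : Type} [Fintype V] [Fintype E] [Fintype F]

/-- `H` is a dual of `G`: cuts of `G` are even in `H`, stars of vertices are connected in `H`,
boundaries of faces are connected in `G`, and every even set of `H` with fewer than `w` edges is
a cut of `G`. -/
structure IsDualPair (G : MGraph V E) (H : MGraph F E) (w : ℕ) : Prop where
  even_cut : ∀ U, H.IsEven (G.cut U)
  star_conn : ∀ (x : V) (Φ : Finset F), (∃ e f, G.Inc e x ∧ H.Inc e f ∧ f ∈ Φ) →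
    (∃ e f, G.Inc e x ∧ H.Inc e f ∧ f ∉ Φ) → ∃ e, G.Inc e x ∧ e ∈ H.cut Φ
  face_conn : ∀ (f : F) (U : Finset V), (∀ e, H.Inc e f → e ∉ G.cut U) →
    ∀ e e', H.Inc e f → H.Inc e' f → (G.src e ∈ U ↔ G.src e' ∈ U)
  short : ∀ K, H.IsEven K → K.card < w → ∃ U, G.cut U = K

/-- A notion of small vertex sets: one side of each cut of size less than `w` is small, and
no three small sets cover everything. -/
structure IsSmallness (G : MGraph V E) (w : ℕ) (Small : Finset V → Prop) : Prop where
  mono : ∀ U W, U ⊆ W → Small W → Small U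
  dich : ∀ U, (G.cut U).card < w → Small U ∨ Small Uᶜ
  cover : ∀ U W Z, Small U → Small W → Small Z → U ∪ W ∪ Z ≠ univ

/-- `G` has no proper nonempty vertex set with empty cut. -/
def Conn (G : MGraph V E) : Prop := ∀ U, G.cut U = ∅ → U = ∅ ∨ U = univ

/-- `Y` is separated by fewer than `t` edges from the large side. -/
def Engulfed (G : MGraph V E) (Small : Finset V → Prop) (t : ℕ) (Y : Finset V) : Prop :=
  ∃ U, Y ⊆ U ∧ Small U ∧ (G.cut U).card < t

/-- The edges with both ends in `Y`. -/
noncomputable def inner (G : MGraph V E) (Y : Finset V) : Finset E :=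
  univ.filter fun e => G.src e ∈ Y ∧ G.dst e ∈ Y

/-- `K` is even and has no proper nonempty even subset. -/
def MinEven (H : MGraph F E) (K : Finset E) : Prop :=
  H.IsEven K ∧ ∀ K' ⊆ K, H.IsEven K' → K' = ∅ ∨ K' = K

variable {G : MGraph V E} {H : MGraph F E} {w t : ℕ} {Small : Finset V → Prop}

lemma mem_inner {Y : Finset V} {e : E} : e ∈ G.inner Y ↔ ∀ x, G.Inc e x → x ∈ Y := by
  simp [inner, Inc, or_imp, forall_and]

lemma IsSmallness.not_univ (hS : G.IsSmallness w Small) {U : Finset V} (hU : Small U) :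
    U ≠ univ := fun h => hS.cover U U U hU hU hU (by simp [h])

lemma IsSmallness.union (hS : G.IsSmallness w Small) {U U1 U2 : Finset V} (h1 : Small U1)
    (h2 : Small U2) (hU : U ⊆ U1 ∪ U2) (hw : (G.cut U).card < w) : Small U := by
  rcases hS.dich U hw with h | h
  · exact h
  · refine absurd ?_ (hS.cover U1 U2 Uᶜ h1 h2 h)
    ext z
    simp only [mem_union, mem_compl, mem_univ, iff_true]
    have := @hU z
    rw [mem_union] at this
    tauto

lemma IsSmallness.eq_empty (hS : G.IsSmallness w Small) (hG : G.Conn) {U : Finset V}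
    (hU : Small U) (h : G.cut U = ∅) : U = ∅ :=
  (hG U h).resolve_right (hS.not_univ hU)

lemma IsSmallness.eq_of_cut_eq (hS : G.IsSmallness w Small) (hG : G.Conn) {U W : Finset V}
    (hU : Small U) (hW : Small W) (h : G.cut U = G.cut W) : U = W := by
  have h1 : G.cut (U ∆ W) = ∅ := by rw [cut_symmDiff, h, symmDiff_self]; rfl
  rcases hG _ h1 with h2 | h2
  · exact symmDiff_eq_bot.1 h2
  · refine absurd ?_ (hS.cover U W W hU hW hW)
    ext z
    have : z ∈ U ∆ W := by rw [h2]; exact mem_univ z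
    rw [mem_symmDiff] at this
    simp only [mem_union, mem_univ, iff_true]
    tauto

lemma IsSmallness.exists_small (hS : G.IsSmallness w Small) (hD : G.IsDualPair H w)
    {K : Finset E} (hK : H.IsEven K) (hw : K.card < w) : ∃ U, Small U ∧ G.cut U = K := by
  obtain ⟨U, rfl⟩ := hD.short K hK hw
  rcases hS.dich U hw with h | h
  · exact ⟨U, h, rfl⟩
  · exact ⟨Uᶜ, h, cut_compl G U⟩

lemma Engulfed.exists_minEven (hS : G.IsSmallness w Small) (hD : G.IsDualPair H w) (htw : t ≤ w)
    {Y : Finset V} (hY : G.Connects (G.inner Y) Y) (h : G.Engulfed Small t Y) :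
    ∃ U, Y ⊆ U ∧ Small U ∧ (G.cut U).card < t ∧ H.MinEven (G.cut U) := by
  obtain ⟨U₀, hU₀⟩ := h
  obtain ⟨U, hU, hmin⟩ := (univ.filter fun U => Y ⊆ U ∧ Small U ∧ (G.cut U).card < t)
    |>.exists_min_image (fun U => (G.cut U).card) ⟨U₀, by simpa using hU₀⟩
  simp only [mem_filter, mem_univ, true_and] at hU hmin
  obtain ⟨hU1, hU2, hU3⟩ := hU
  refine ⟨U, hU1, hU2, hU3, hD.even_cut U, fun K hKU hK => ?_⟩
  by_contra hc
  push Not at hc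
  have hlt : K.card < (G.cut U).card := card_lt_card (hKU.ssubset_of_ne hc.2)
  obtain ⟨S, hS1, rfl⟩ := hS.exists_small hD hK (by omega)
  have hdis : Disjoint (G.inner Y) (G.cut S) := by
    refine disjoint_left.2 fun e he he' => ?_
    have h1 := hKU he'
    rw [mem_cut] at h1
    rw [mem_inner] at he
    exact h1 (iff_of_true (hU1 (he _ (Or.inl rfl))) (hU1 (he _ (Or.inr rfl))))
  rcases hY S hdis with h1 | h1
  · have := hmin S ⟨h1, hS1, by omega⟩
    omega
  · have h2 : G.cut (U ∆ S) = G.cut U \ G.cut S := by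
      rw [cut_symmDiff]
      ext e
      have := @hKU e
      simp only [mem_symmDiff, mem_sdiff]
      tauto
    have h3 : (G.cut (U ∆ S)).card < (G.cut U).card := by
      rw [h2, card_sdiff_of_subset hKU]
      have : 0 < (G.cut S).card := card_pos.2 hc.1
      omega
    have h4 : Small (U ∆ S) := hS.union hU2 hS1
      (fun z hz => by rw [mem_symmDiff] at hz; rw [mem_union]; tauto) (by omega)
    have := hmin (U ∆ S) ⟨fun z hz => mem_symmDiff.2 (Or.inl ⟨hU1 hz, disjoint_left.1 h1 hz⟩),
      h4, by omega⟩
    omega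

/-- The two ends of `e` are `a` and `b`. -/
def Ends (H : MGraph F E) (e : E) (a b : F) : Prop :=
  (H.src e = a ∧ H.dst e = b) ∨ (H.src e = b ∧ H.dst e = a)

lemma Ends.symm {e : E} {a b : F} (h : H.Ends e a b) : H.Ends e b a := h.elim Or.inr Or.inl

lemma Ends.left {e : E} {a b : F} (h : H.Ends e a b) : H.Inc e a :=
  h.elim (fun h => Or.inl h.1) (fun h => Or.inr h.2)

lemma Ends.eq_or {e : E} {a b f : F} (h : H.Ends e a b) (hf : H.Inc e f) : f = a ∨ f = b := by
  rcases h with ⟨h1, h2⟩ | ⟨h1, h2⟩ <;> rcases hf with h | h <;> subst_vars <;> simp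

lemma Inc.exists_ends {e : E} {a : F} (h : H.Inc e a) : ∃ b, H.Ends e a b := by
  rcases h with h | h
  · exact ⟨_, Or.inl ⟨h, rfl⟩⟩
  · exact ⟨_, Or.inr ⟨rfl, h⟩⟩

lemma Ends.sum {e : E} {a b : F} (h : H.Ends e a b) (y : F → ZMod 2) :
    y (H.src e) + y (H.dst e) = y a + y b := by
  rcases h with ⟨h1, h2⟩ | ⟨h1, h2⟩ <;> subst_vars
  · rfl
  · exact add_comm _ _

/-- `L` is the edge set of a trail from `a` to `b`. -/
inductive Trail (H : MGraph F E) : F → F → Finset E → Prop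
  | nil (a : F) : Trail H a a ∅
  | cons {a b c : F} {e : E} {L : Finset E} (he : H.Ends e a b) (hL : e ∉ L)
      (h : Trail H b c L) : Trail H a c (insert e L)

lemma Trail.sum {a b : F} {L : Finset E} (h : H.Trail a b L) (y : F → ZMod 2) :
    ∑ e ∈ L, (y (H.src e) + y (H.dst e)) = y a + y b := by
  induction h with
  | nil a => simp [CharTwo.add_self_eq_zero]
  | @cons a b c e L he hL h ih =>
    rw [sum_insert hL, ih, he.sum]
    linear_combination CharTwo.add_self_eq_zero (y b)

lemma Trail.exists_sub {a b f : F} {L : Finset E} (h : H.Trail a b L) {e : E} (he : e ∈ L)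
    (hf : H.Inc e f) : ∃ L' ⊆ L, H.Trail f b L' := by
  induction h with
  | nil a => simp at he
  | @cons a b c e' L he' hL h ih =>
    rcases mem_insert.1 he with rfl | he
    · rcases he'.eq_or hf with rfl | rfl
      · exact ⟨_, subset_rfl, h.cons he' hL⟩
      · exact ⟨_, subset_insert _ _, h⟩
    · obtain ⟨L', h1, h2⟩ := ih he
      exact ⟨L', h1.trans (subset_insert _ _), h2⟩

/-- A minimal even set is a closed trail from each face it touches. -/
lemma MinEven.trail {K : Finset E} (hK : H.MinEven K) {e : E} (he : e ∈ K) {f : F}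
    (hf : H.Inc e f) : H.Trail f f K := by
  obtain ⟨f', hff⟩ := hf.exists_ends
  let Φ : F → Prop := fun a => ∃ L ⊆ K.erase e, H.Trail a f L
  have step : ∀ e' ∈ K.erase e, ∀ a b, H.Ends e' a b → Φ a → Φ b := by
    rintro e' he' a b hab ⟨L, hL, hT⟩
    by_cases h : e' ∈ L
    · obtain ⟨L', h1, h2⟩ := hT.exists_sub h hab.symm.left
      exact ⟨L', h1.trans hL, h2⟩
    · exact ⟨insert e' L, insert_subset he' hL, hT.cons hab.symm h⟩
  have hΦ : Φ f' := by
    by_contra hc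
    have h1 := hK.1 fun a => if Φ a then 1 else 0
    rw [← add_sum_erase _ _ he, hff.sum (fun a => if Φ a then 1 else 0), if_pos ⟨∅, by simp, Trail.nil f⟩,
      if_neg hc,
      sum_eq_zero] at h1
    · simp at h1
    · intro e' he'
      have hE : H.Ends e' (H.src e') (H.dst e') := Or.inl ⟨rfl, rfl⟩
      have : Φ (H.src e') ↔ Φ (H.dst e') := ⟨step e' he' _ _ hE, step e' he' _ _ hE.symm⟩
      by_cases h : Φ (H.src e')
      · rw [if_pos h, if_pos (this.1 h)]; exact CharTwo.add_self_eq_zero _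
      · rw [if_neg h, if_neg (fun h' => h (this.2 h')), add_zero]
  obtain ⟨L, hL, hT⟩ := hΦ
  have heL : e ∉ L := fun h => by simpa using hL h
  have hT' := hT.cons hff heL
  have hsub : insert e L ⊆ K := insert_subset he (hL.trans (erase_subset _ _))
  rcases hK.2 _ hsub (fun y => by rw [hT'.sum]; exact CharTwo.add_self_eq_zero _) with h | h
  · exact absurd h (insert_ne_empty _ _)
  · rwa [h] at hT'

/-- Balls in the graph `H`. -/
noncomputable def ball (H : MGraph F E) (f₀ : F) : ℕ → Finset F
  | 0 => {f₀}
  | i + 1 => univ.filter fun f => f ∈ ball H f₀ i ∨ ∃ e, ∃ f' ∈ ball H f₀ i, H.Ends e f f'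

lemma mem_ball_succ {f₀ f : F} {i : ℕ} :
    f ∈ H.ball f₀ (i + 1) ↔ f ∈ H.ball f₀ i ∨ ∃ e, ∃ f' ∈ H.ball f₀ i, H.Ends e f f' := by
  simp [ball]

lemma ball_mono {f₀ : F} {i j : ℕ} (h : i ≤ j) : H.ball f₀ i ⊆ H.ball f₀ j := by
  induction h with
  | refl => exact subset_rfl
  | step _ ih => exact fun f hf => mem_ball_succ.2 (Or.inl (ih hf))

lemma ball_trans {f₀ f f' : F} {i j : ℕ} (h : f ∈ H.ball f₀ i) (h' : f' ∈ H.ball f j) :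
    f' ∈ H.ball f₀ (i + j) := by
  induction j generalizing f' with
  | zero => simp only [ball, mem_singleton] at h'; exact h' ▸ h
  | succ j ih =>
    rcases mem_ball_succ.1 h' with h1 | ⟨e, f1, h1, h2⟩
    · exact ball_mono (by omega) (ih h1)
    · exact mem_ball_succ.2 (Or.inr ⟨e, f1, ih h1, h2⟩)

lemma self_mem_ball (f : F) (i : ℕ) : f ∈ H.ball f i :=
  ball_mono (Nat.zero_le i) (by simp [ball])

lemma Trail.mem_ball {a c : F} {L : Finset E} (h : H.Trail a c L) :
    a ∈ H.ball c L.card ∧ ∀ e ∈ L, ∀ f, H.Inc e f → f ∈ H.ball c L.card := by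
  induction h with
  | nil a => simp [ball]
  | @cons a b c e L he hL h ih =>
    rw [card_insert_of_notMem hL]
    have ha : a ∈ H.ball c (L.card + 1) := mem_ball_succ.2 (Or.inr ⟨e, b, ih.1, he⟩)
    refine ⟨ha, fun e' he' f hf => ?_⟩
    rcases mem_insert.1 he' with rfl | he'
    · rcases he.eq_or hf with rfl | rfl
      · exact ha
      · exact ball_mono (Nat.le_succ _) ih.1
    · exact ball_mono (Nat.le_succ _) (ih.2 e' he' f hf)

lemma MinEven.mem_ball {K : Finset E} (hK : H.MinEven K) {e e' : E} (he : e ∈ K) (he' : e' ∈ K)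
    {f f' : F} (hf : H.Inc e f) (hf' : H.Inc e' f') : f' ∈ H.ball f K.card :=
  (hK.trail he hf).mem_ball.2 e' he' f' hf'

/-- The vertex `x` lies on the boundary of the face `f`. -/
def Touch (G : MGraph V E) (H : MGraph F E) (x : V) (f : F) : Prop := ∃ e, G.Inc e x ∧ H.Inc e f

/-- The vertices on the boundaries of the faces in `Φ`. -/
noncomputable def verts (G : MGraph V E) (H : MGraph F E) (Φ : Finset F) : Finset V :=
  univ.filter fun x => ∃ f ∈ Φ, Touch G H x f

lemma mem_verts {Φ : Finset F} {x : V} : x ∈ verts G H Φ ↔ ∃ f ∈ Φ, Touch G H x f := by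
  simp [verts]

lemma verts_mono {Φ Ψ : Finset F} (h : Φ ⊆ Ψ) : verts G H Φ ⊆ verts G H Ψ := by
  intro x; simp only [mem_verts]; rintro ⟨f, hf, hx⟩; exact ⟨f, h hf, hx⟩

/-- No edge having a side in `Φ` crosses `U`. -/
def Avoids (G : MGraph V E) (H : MGraph F E) (Φ : Finset F) (U : Finset V) : Prop :=
  ∀ f ∈ Φ, ∀ e, H.Inc e f → e ∉ G.cut U

lemma Avoids.mono {Φ Ψ : Finset F} {U : Finset V} (h : Avoids G H Ψ U) (hs : Φ ⊆ Ψ) :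
    Avoids G H Φ U := fun f hf => h f (hs hf)

lemma mem_iff_of_not_cut {U : Finset V} {e : E} {x : V} (hx : G.Inc e x) (he : e ∉ G.cut U) :
    x ∈ U ↔ G.src e ∈ U := by
  rw [mem_cut, not_not] at he
  rcases hx with rfl | rfl
  · rfl
  · exact he.symm

lemma IsDualPair.face_verts (hD : G.IsDualPair H w) {f : F} {U : Finset V}
    (h : ∀ e, H.Inc e f → e ∉ G.cut U) {x y : V} (hx : Touch G H x f) (hy : Touch G H y f) :
    x ∈ U ↔ y ∈ U := by
  obtain ⟨e, he, he'⟩ := hx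
  obtain ⟨d, hd, hd'⟩ := hy
  rw [mem_iff_of_not_cut he (h e he'), mem_iff_of_not_cut hd (h d hd')]
  exact hD.face_conn f U h e d he' hd'

lemma touch_src {e : E} {f : F} (h : H.Inc e f) : Touch G H (G.src e) f := ⟨e, Or.inl rfl, h⟩

lemma IsDualPair.ball_verts (hD : G.IsDualPair H w) {f₀ : F} {i : ℕ} {U : Finset V}
    (h : Avoids G H (H.ball f₀ i) U) {x y : V} (hx : x ∈ verts G H (H.ball f₀ i))
    (hy : y ∈ verts G H (H.ball f₀ i)) : x ∈ U ↔ y ∈ U := by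
  have key : ∀ i, Avoids G H (H.ball f₀ i) U → ∀ f ∈ H.ball f₀ i, ∀ x, Touch G H x f →
      ∃ z, Touch G H z f₀ ∧ (x ∈ U ↔ z ∈ U) := by
    intro i
    induction i with
    | zero =>
      intro _ f hf x hx
      simp only [ball, mem_singleton] at hf
      exact ⟨x, hf ▸ hx, Iff.rfl⟩
    | succ i ih =>
      intro h f hf x hx
      rcases mem_ball_succ.1 hf with h1 | ⟨e, f1, h1, h2⟩
      · exact ih (h.mono (ball_mono (Nat.le_succ i))) f h1 x hx
      · obtain ⟨z, hz, hz'⟩ := ih (h.mono (ball_mono (Nat.le_succ i))) f1 h1 (G.src e)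
          (touch_src h2.symm.left)
        exact ⟨z, hz, (hD.face_verts (h f hf) hx (touch_src h2.left)).trans hz'⟩
  obtain ⟨f, hf, hx⟩ := mem_verts.1 hx
  obtain ⟨f', hf', hy⟩ := mem_verts.1 hy
  obtain ⟨z, hz, hxz⟩ := key i h f hf x hx
  obtain ⟨z', hz', hyz⟩ := key i h f' hf' y hy
  rw [hxz, hyz]
  exact hD.face_verts (h f₀ (self_mem_ball f₀ i)) hz hz'

lemma avoids_of_disjoint_inner {Φ : Finset F} {U : Finset V}
    (h : Disjoint (G.inner (verts G H Φ)) (G.cut U)) : Avoids G H Φ U := by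
  intro f hf e he
  refine disjoint_left.1 h (mem_inner.2 fun x hx => mem_verts.2 ⟨f, hf, e, hx, he⟩)

lemma connects_of_iff {K : Finset E} {Y : Finset V}
    (h : ∀ U, Disjoint K (G.cut U) → ∀ x ∈ Y, ∀ y ∈ Y, x ∈ U → y ∈ U) : G.Connects K Y := by
  intro U hU
  by_cases hx : ∃ x ∈ Y, x ∈ U
  · obtain ⟨x, hx, hx'⟩ := hx
    exact Or.inl fun y hy => h U hU x hx y hy hx'
  · exact Or.inr (disjoint_left.2 fun z hz hz' => hx ⟨z, hz, hz'⟩)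

lemma IsDualPair.connects_verts_ball (hD : G.IsDualPair H w) (f₀ : F) (i : ℕ) :
    G.Connects (G.inner (verts G H (H.ball f₀ i))) (verts G H (H.ball f₀ i)) :=
  connects_of_iff fun _ hU _ hx _ hy =>
    (hD.ball_verts (avoids_of_disjoint_inner hU) hx hy).1

end dual
end MGraph

namespace MGraph

section tree
open scoped Classical symmDiff

variable {V E F : Type} [Fintype V] [Fintype E] [Fintype F]
variable {G : MGraph V E} {H : MGraph F E} {w t : ℕ} {Small : Finset V → Prop}

/-- A breadth-first spanning tree of a ball, with its paths to the centre. -/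
structure IsBallTree (H : MGraph F E) (f₀ : F) (R : ℕ) (T : Finset E) (P : F → Finset E) :
    Prop where
  subset : ∀ f ∈ H.ball f₀ R, P f ⊆ T
  card_le : ∀ f ∈ H.ball f₀ R, (P f).card ≤ R
  sum : ∀ f ∈ H.ball f₀ R, ∀ y : F → ZMod 2,
    ∑ e ∈ P f, (y (H.src e) + y (H.dst e)) = y f + y f₀
  inner : T ⊆ H.inner (H.ball f₀ R)
  acyclic : ∀ K ⊆ T, H.IsEven K → K = ∅

lemma exists_ballTree (H : MGraph F E) (f₀ : F) (R : ℕ) : ∃ T P, H.IsBallTree f₀ R T P := by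
  induction R with
  | zero =>
    refine ⟨∅, fun _ => ∅, by simp, by simp, ?_, by simp, by simp⟩
    intro f hf y
    simp only [ball, mem_singleton] at hf
    simp [hf, CharTwo.add_self_eq_zero]
  | succ R ih =>
    obtain ⟨T, P, hT⟩ := ih
    have hex : ∀ f, f ∈ H.ball f₀ (R + 1) ∧ f ∉ H.ball f₀ R →
        ∃ (e : E) (f' : F), f' ∈ H.ball f₀ R ∧ H.Ends e f f' := by
      intro f hf
      rcases mem_ball_succ.1 hf.1 with h | ⟨e, f', h, h'⟩
      · exact absurd h hf.2
      · exact ⟨e, f', h, h'⟩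
    choose pe pf hpf hpe using hex
    let T' := T ∪ univ.filter fun e => ∃ f h, e = pe f h
    let P' : F → Finset E := fun f =>
      if h : f ∈ H.ball f₀ (R + 1) ∧ f ∉ H.ball f₀ R then insert (pe f h) (P (pf f h)) else P f
    have hnew : ∀ f h, P' f = insert (pe f h) (P (pf f h)) := fun f h => dif_pos h
    have hold : ∀ f, f ∈ H.ball f₀ R → P' f = P f := fun f h => dif_neg fun h' => h'.2 h
    have hmem : ∀ f h, pe f h ∈ T' := fun f h =>
      mem_union_right _ (by simpa using ⟨f, h, rfl⟩)
    have hnot : ∀ f h, pe f h ∉ T := fun f h hh =>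
      h.2 (mem_inner.1 (hT.inner hh) f (hpe f h).left)
    refine ⟨T', P', ?_, ?_, ?_, ?_, ?_⟩
    · intro f hf
      by_cases h : f ∈ H.ball f₀ R
      · rw [hold f h]; exact (hT.subset f h).trans subset_union_left
      · rw [hnew f ⟨hf, h⟩]
        exact insert_subset (hmem _ _) ((hT.subset _ (hpf _ _)).trans subset_union_left)
    · intro f hf
      by_cases h : f ∈ H.ball f₀ R
      · rw [hold f h]; exact (hT.card_le f h).trans (Nat.le_succ R)
      · rw [hnew f ⟨hf, h⟩]
        exact (card_insert_le _ _).trans (Nat.succ_le_succ (hT.card_le _ (hpf _ _)))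
    · intro f hf y
      by_cases h : f ∈ H.ball f₀ R
      · rw [hold f h]; exact hT.sum f h y
      · rw [hnew f ⟨hf, h⟩, sum_insert (fun hh => hnot f ⟨hf, h⟩ (hT.subset _ (hpf _ _) hh)),
          hT.sum _ (hpf _ _), (hpe f ⟨hf, h⟩).sum]
        linear_combination CharTwo.add_self_eq_zero (y (pf f ⟨hf, h⟩))
    · intro e he
      rw [mem_inner]
      intro f hf
      rcases mem_union.1 he with h | h
      · exact ball_mono (Nat.le_succ R) (mem_inner.1 (hT.inner h) f hf)
      · obtain ⟨f', h', rfl⟩ := (mem_filter.1 h).2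
        rcases (hpe f' h').eq_or hf with rfl | rfl
        · exact h'.1
        · exact ball_mono (Nat.le_succ R) (hpf _ _)
    · intro K hK hKe
      refine hT.acyclic K (fun e he => ?_) hKe
      rcases mem_union.1 (hK he) with hm | hm
      · exact hm
      exfalso
      obtain ⟨f, h, rfl⟩ := (mem_filter.1 hm).2
      have h1 := hKe fun a => if a = f then 1 else 0
      have hne : pf f h ≠ f := fun hh => h.2 (hh ▸ hpf f h)
      rw [← add_sum_erase _ _ he, (hpe f h).sum (fun a => if a = f then 1 else 0), if_pos rfl,
        if_neg hne, sum_eq_zero] at h1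
      · simp at h1
      · intro e he'
        have h2 : ∀ a, H.Inc e a → a ≠ f := by
          rintro a ha rfl
          rcases mem_union.1 (hK (mem_of_mem_erase he')) with h3 | h3
          · exact h.2 (mem_inner.1 (hT.inner h3) _ ha)
          · obtain ⟨f', h', rfl⟩ := (mem_filter.1 h3).2
            rcases (hpe f' h').eq_or ha with h4 | h4
            · subst h4
              exact (mem_erase.1 he').1 rfl
            · exact h.2 (h4 ▸ hpf _ _)
        rw [if_neg (h2 _ (Or.inl rfl)), if_neg (h2 _ (Or.inr rfl)), add_zero]

lemma Ends.self (H : MGraph F E) (e : E) : H.Ends e (H.src e) (H.dst e) := Or.inl ⟨rfl, rfl⟩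

/-- The fundamental even set of an edge of the ball. -/
lemma IsBallTree.isEven {f₀ : F} {R : ℕ} {T : Finset E} {P : F → Finset E}
    (hT : H.IsBallTree f₀ R T P) {e : E} (he : e ∈ H.inner (H.ball f₀ R)) {a b : F}
    (hab : H.Ends e a b) : H.IsEven (P a ∆ P b ∆ {e}) := by
  intro y
  rw [sum_symmDiff_zmod, sum_symmDiff_zmod, hT.sum a (mem_inner.1 he _ hab.left),
    hT.sum b (mem_inner.1 he _ hab.symm.left), sum_singleton, hab.sum]
  linear_combination CharTwo.add_self_eq_zero (y a) + CharTwo.add_self_eq_zero (y b) +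
    CharTwo.add_self_eq_zero (y f₀)

lemma card_symmDiff_le (K L : Finset E) : (K ∆ L).card ≤ K.card + L.card :=
  (card_le_card (fun e he => by rw [mem_symmDiff] at he; rw [mem_union]; tauto)).trans
    (card_union_le K L)

lemma IsBallTree.card_fund {f₀ : F} {R : ℕ} {T : Finset E} {P : F → Finset E}
    (hT : H.IsBallTree f₀ R T P) {e : E} (he : e ∈ H.inner (H.ball f₀ R)) {a b : F}
    (hab : H.Ends e a b) : (P a ∆ P b ∆ {e}).card ≤ 2 * R + 1 := by
  have h1 := card_symmDiff_le (P a ∆ P b) {e}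
  have h2 := card_symmDiff_le (P a) (P b)
  have h3 := hT.card_le a (mem_inner.1 he _ hab.left)
  have h4 := hT.card_le b (mem_inner.1 he _ hab.symm.left)
  rw [card_singleton] at h1
  omega

lemma IsBallTree.mem_fund {f₀ : F} {R : ℕ} {T : Finset E} {P : F → Finset E}
    (hT : H.IsBallTree f₀ R T P) {e : E} (he : e ∈ H.inner (H.ball f₀ R)) {a b : F}
    (hab : H.Ends e a b) {d : E} (hd : d ∉ T) : d ∈ P a ∆ P b ∆ {e} ↔ d = e := by
  have h3 := fun h => hd (hT.subset a (mem_inner.1 he _ hab.left) h)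
  have h4 := fun h => hd (hT.subset b (mem_inner.1 he _ hab.symm.left) h)
  simp only [mem_symmDiff, mem_singleton]
  tauto

/-- Even sets within a small ball are cuts. -/
lemma IsDualPair.exists_cut_of_inner_ball (hD : G.IsDualPair H w) {f₀ : F} {R : ℕ}
    (hR : 2 * R + 1 < w) {K : Finset E} (hK : H.IsEven K) (hin : K ⊆ H.inner (H.ball f₀ R)) :
    ∃ U, G.cut U = K := by
  obtain ⟨T, P, hT⟩ := exists_ballTree H f₀ R
  obtain ⟨n, hn⟩ : ∃ n, (K \ T).card = n := ⟨_, rfl⟩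
  induction n using Nat.strong_induction_on generalizing K with
  | _ n ih =>
    by_cases hKT : K ⊆ T
    · exact ⟨∅, by rw [cut_empty, hT.acyclic K hKT hK]⟩
    obtain ⟨e, he, heT⟩ := not_subset.1 hKT
    have hein := hin he
    set Z := P (H.src e) ∆ P (H.dst e) ∆ {e} with hZ
    have hZe : H.IsEven Z := hT.isEven hein (Ends.self H e)
    obtain ⟨S, hS⟩ := hD.short Z hZe ((hT.card_fund hein (Ends.self H e)).trans_lt hR)
    have hZT : ∀ d ∉ T, d ∈ Z ↔ d = e := fun d hd => hT.mem_fund hein (Ends.self H e) hd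
    obtain ⟨U, hU⟩ := ih ((K ∆ Z) \ T).card (by
      rw [← hn]
      refine card_lt_card ((ssubset_iff_of_subset ?_).2 ⟨e, by simp [he, heT], ?_⟩)
      · intro d
        simp only [mem_sdiff, mem_symmDiff]
        rintro ⟨h1, h2⟩
        have := hZT d h2
        refine ⟨?_, h2⟩
        rcases h1 with h1 | h1
        · exact h1.1
        · exact (this.1 h1.1) ▸ he
      · have := hZT e heT
        simp only [mem_sdiff, mem_symmDiff]
        tauto) (hK.symmDiff hZe) (by
      intro d hd
      rcases mem_symmDiff.1 hd with h | h
      · exact hin h.1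
      · by_cases hdT : d ∈ T
        · exact hT.inner hdT
        · exact ((hZT d hdT).1 h.1) ▸ hein) rfl
    exact ⟨U ∆ S, by rw [cut_symmDiff, hU, hS]; exact symmDiff_symmDiff_cancel_right _ _⟩

/-- There is a face whose ball is not engulfed. -/
lemma exists_center (hS : G.IsSmallness w Small) (hD : G.IsDualPair H w) (hG : G.Conn)
    (htw : t ≤ w) (hw : 0 < w) (ht : 0 < t) (e₀ : E) :
    ∃ f₀, (∃ x, Touch G H x f₀) ∧ ¬ G.Engulfed Small t (verts G H (H.ball f₀ t)) := by
  by_contra hcon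
  push Not at hcon
  let good : Finset V → Prop := fun U => Small U ∧ (G.cut U).card < t ∧
    ∀ e ∈ G.cut U, ∀ e' ∈ G.cut U, ∀ f f', H.Inc e f → H.Inc e' f' → f' ∈ H.ball f t
  have h0 : Small ∅ := by
    rcases hS.dich ∅ (by simpa using hw) with h | h
    · exact h
    · exact absurd (by simp) (hS.not_univ h)
  obtain ⟨S, hSg, hmax⟩ := (univ.filter good).exists_max_image card
    ⟨∅, mem_filter.2 ⟨mem_univ _, h0, by simpa using ht, by simp⟩⟩
  simp only [mem_filter, mem_univ, true_and] at hSg hmax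
  obtain ⟨f, hf, hfS⟩ : ∃ f, (∃ x, Touch G H x f) ∧
      ∀ e ∈ G.cut S, ∀ f', H.Inc e f' → f' ∈ H.ball f t := by
    by_cases hne : (G.cut S).Nonempty
    · obtain ⟨e, he⟩ := hne
      exact ⟨H.src e, ⟨_, touch_src (Or.inl rfl)⟩,
        fun e' he' f' hf' => hSg.2.2 e he e' he' _ _ (Or.inl rfl) hf'⟩
    · exact ⟨H.src e₀, ⟨_, touch_src (Or.inl rfl)⟩, fun e he => absurd ⟨e, he⟩ hne⟩
  obtain ⟨U, hYU, hU1, hU2, hU3⟩ := (hcon f hf).exists_minEven hS hD htw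
    (hD.connects_verts_ball f t)
  have hends : ∀ e ∈ G.cut S, ∀ x, G.Inc e x → x ∈ U := fun e he x hx =>
    hYU (mem_verts.2 ⟨H.src e, hfS e he _ (Or.inl rfl), e, hx, Or.inl rfl⟩)
  have hsub : G.cut (S ∪ U) ⊆ G.cut U := by
    intro e he
    rcases mem_union.1 (cut_union_subset G S U he) with h | h
    · rw [mem_cut] at he
      have h1 := hends e h _ (Or.inl rfl)
      have h2 := hends e h _ (Or.inr rfl)
      exact absurd (iff_of_true (mem_union_right _ h1) (mem_union_right _ h2)) he
    · exact h
  have hcard := card_le_card hsub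
  have hgood : good (S ∪ U) := by
    refine ⟨hS.union hSg.1 hU1 subset_rfl (by omega), by omega, ?_⟩
    intro e he e' he' f f' hf hf'
    exact ball_mono hU2.le (hU3.mem_ball (hsub he) (hsub he') hf hf')
  have heq : S = S ∪ U := eq_of_subset_of_card_le subset_union_left (hmax _ hgood)
  have hUS : U ⊆ S := by rw [heq]; exact subset_union_right
  by_cases hne : (G.cut S).Nonempty
  · obtain ⟨e, he⟩ := hne
    have h1 := hends e he _ (Or.inl rfl)
    have h2 := hends e he _ (Or.inr rfl)
    rw [mem_cut] at he
    exact he (iff_of_true (hUS h1) (hUS h2))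
  · have h1 := hS.eq_empty hG hSg.1 (not_nonempty_iff_eq_empty.1 hne)
    obtain ⟨x, hx⟩ := hf
    have := hUS (hYU (mem_verts.2 ⟨f, self_mem_ball f t, hx⟩))
    simp [h1] at this

/-- There is a vertex outside all the small sides of fundamental cuts in a ball. -/
lemma IsBallTree.exists_sink (hS : G.IsSmallness w Small) (hD : G.IsDualPair H w) (hG : G.Conn)
    (x₀ : V) {f₀ : F} {R : ℕ} {T : Finset E} {P : F → Finset E}
    (hT : H.IsBallTree f₀ R T P) :
    ∃ x, ∀ e ∈ H.inner (H.ball f₀ R), ∀ a b, H.Ends e a b → ∀ S, Small S →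
      G.cut S = P a ∆ P b ∆ {e} → x ∉ S := by
  let good : E → Finset V → Prop := fun e S => e ∈ H.inner (H.ball f₀ R) ∧ e ∉ T ∧ Small S ∧
    ∃ a b, H.Ends e a b ∧ G.cut S = P a ∆ P b ∆ {e}
  have hmem : ∀ {e S}, good e S → ∀ d ∉ T, d ∈ G.cut S ↔ d = e := by
    rintro e S ⟨h1, -, -, a, b, hab, h⟩ d hd
    rw [h]
    exact hT.mem_fund h1 hab hd
  suffices ∃ x, ∀ e S, good e S → x ∉ S by
    obtain ⟨x, hx⟩ := this
    refine ⟨x, fun e he a b hab S hSS hcut => ?_⟩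
    by_cases heT : e ∈ T
    · have h1 : P a ∆ P b ∆ {e} = ∅ := by
        refine hT.acyclic _ (fun d hd => ?_) (hT.isEven he hab)
        by_contra hdT
        exact hdT ((hT.mem_fund he hab hdT).1 hd ▸ heT)
      rw [h1] at hcut
      simp [hS.eq_empty hG hSS hcut]
    · exact hx e S ⟨he, heT, hSS, a, b, hab, hcut⟩
  by_cases hex : ∃ e S, good e S
  swap
  · push Not at hex
    exact ⟨x₀, fun e S h => absurd h (hex e S)⟩
  obtain ⟨S, hSg, hmax⟩ := (univ.filter fun S => ∃ e, good e S).exists_max_image card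
    (by obtain ⟨e, S, h⟩ := hex; exact ⟨S, by simpa using ⟨e, h⟩⟩)
  simp only [mem_filter, mem_univ, true_and] at hSg hmax
  obtain ⟨e, he⟩ := hSg
  have hecut : e ∈ G.cut S := (hmem he e he.2.1).2 rfl
  obtain ⟨x, hxe, hxS⟩ : ∃ x, G.Inc e x ∧ x ∉ S := by
    rw [mem_cut] at hecut
    by_cases h : G.src e ∈ S
    · exact ⟨_, Or.inr rfl, fun h' => hecut (iff_of_true h h')⟩
    · exact ⟨_, Or.inl rfl, h⟩
  refine ⟨x, fun e' S' he' hx => ?_⟩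
  have hee : e ≠ e' := by
    rintro rfl
    obtain ⟨h1, h2, h3, a, b, hab, h4⟩ := he
    obtain ⟨-, -, h3', a', b', hab', h4'⟩ := he'
    refine hxS ?_
    rw [hS.eq_of_cut_eq hG h3 h3']
    · exact hx
    · rw [h4, h4']
      rcases hab.eq_or hab'.left with rfl | rfl
      · rcases hab.eq_or hab'.symm.left with h5 | rfl
        · subst h5
          rcases hab'.eq_or hab.symm.left with rfl | rfl <;> rfl
        · rfl
      · rcases hab.eq_or hab'.symm.left with h5 | h5
        · subst h5; rw [symmDiff_comm (P b')]
        · subst h5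
          rcases hab'.eq_or hab.left with rfl | rfl <;> rfl
  have hno : e ∉ G.cut S' := fun h => hee ((hmem he' e he.2.1).1 h)
  have hno' : e' ∉ G.cut S := fun h => hee ((hmem he e' he'.2.1).1 h).symm
  have hin : ∀ z, G.Inc e z → z ∈ S' := fun z hz => by
    rw [mem_iff_of_not_cut hz hno, ← mem_iff_of_not_cut hxe hno]; exact hx
  have hcutT : ∀ {d}, d ∈ G.cut S ∪ G.cut S' → d ≠ e → d ≠ e' → d ∈ T := by
    intro d hd h1 h2
    by_contra hdT
    rw [mem_union, hmem he d hdT, hmem he' d hdT] at hd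
    tauto
  have hempty : ∀ U, G.cut U ⊆ G.cut S ∪ G.cut S' → e ∉ G.cut U → e' ∉ G.cut U →
      G.cut U = ∅ := by
    intro U hU h1 h2
    refine hT.acyclic _ (fun d hd => hcutT (hU hd) ?_ ?_) (hD.even_cut U)
    · rintro rfl; exact h1 hd
    · rintro rfl; exact h2 hd
  by_cases hcase : G.src e' ∈ S
  · have h1 := hempty (S ∪ S') (cut_union_subset _ _ _)
      (by rw [mem_cut, not_not]
          exact iff_of_true (mem_union_right _ (hin _ (Or.inl rfl)))
            (mem_union_right _ (hin _ (Or.inr rfl))))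
      (by rw [mem_cut, not_not]
          exact iff_of_true (mem_union_left _ hcase)
            (mem_union_left _ ((mem_iff_of_not_cut (Or.inr rfl) hno').2 hcase)))
    rcases hG _ h1 with h2 | h2
    · have : x ∈ S ∪ S' := mem_union_right _ hx
      simp [h2] at this
    · exact hS.cover S S' S' he.2.2.1 he'.2.2.1 he'.2.2.1 (by
        rw [union_assoc, union_self]; exact h2)
  · have h1 := hempty (S \ S') (cut_sdiff_subset _ _ _)
      (by rw [mem_cut, not_not]
          exact iff_of_false (fun h => (mem_sdiff.1 h).2 (hin _ (Or.inl rfl)))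
            (fun h => (mem_sdiff.1 h).2 (hin _ (Or.inr rfl))))
      (by rw [mem_cut, not_not]
          exact iff_of_false (fun h => hcase (mem_sdiff.1 h).1)
            (fun h => hcase ((mem_iff_of_not_cut (Or.inr rfl) hno').1 (mem_sdiff.1 h).1)))
    have h2 := hS.eq_empty hG (hS.mono _ _ sdiff_subset he.2.2.1) h1
    have h3 : S ⊆ S' := sdiff_eq_empty_iff_subset.1 h2
    have h4 := hmax S' ⟨e', he'⟩
    have h5 := card_lt_card ((ssubset_iff_of_subset h3).2 ⟨x, hx, hxS⟩)
    omega

lemma Trail.not_mem_small (hS : G.IsSmallness w Small) (hD : G.IsDualPair H w) (hG : G.Conn)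
    {f₀ : F} {R : ℕ} {T : Finset E} {P : F → Finset E}
    (hT : H.IsBallTree f₀ R T P) {x : V}
    (hx : ∀ e ∈ H.inner (H.ball f₀ R), ∀ a b, H.Ends e a b → ∀ S, Small S →
      G.cut S = P a ∆ P b ∆ {e} → x ∉ S) {a c : F} {L : Finset E} (h : H.Trail a c L)
    (hc : c ∈ H.ball f₀ R) (hL : L ⊆ H.inner (H.ball f₀ R)) (hw : L.card + 2 * R + 1 < w) :
    ∀ S, Small S → G.cut S = L ∆ (P a ∆ P c) → x ∉ S := by
  induction h with
  | nil a =>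
    intro S hS1 hcut
    have h1 : G.cut S = ∅ := by
      rw [hcut, symmDiff_self]; simp
    simp [hS.eq_empty hG hS1 h1]
  | @cons a b c e L he heL h ih =>
    intro S hS1 hcut
    rw [card_insert_of_notMem heL] at hw
    have hein := hL (mem_insert_self e L)
    have hLin := (subset_insert e L).trans hL
    have ha := mem_inner.1 hein a he.left
    have hb := mem_inner.1 hein b he.symm.left
    have hZ := hT.card_fund hein he
    obtain ⟨S1, hS11, hS12⟩ := hS.exists_small hD (hT.isEven hein he) (by omega)
    have heven : H.IsEven (L ∆ (P b ∆ P c)) := by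
      intro y
      rw [sum_symmDiff_zmod, sum_symmDiff_zmod, h.sum, hT.sum b hb, hT.sum c hc]
      linear_combination CharTwo.add_self_eq_zero (y b) + CharTwo.add_self_eq_zero (y c) +
        CharTwo.add_self_eq_zero (y f₀)
    have hcard : (L ∆ (P b ∆ P c)).card < w := by
      have h1 := card_symmDiff_le L (P b ∆ P c)
      have h2 := card_symmDiff_le (P b) (P c)
      have h3 := hT.card_le b hb
      have h4 := hT.card_le c hc
      omega
    obtain ⟨S2, hS21, hS22⟩ := hS.exists_small hD heven hcard
    have hx1 := hx e hein a b he S1 hS11 hS12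
    have hx2 := ih hc hLin (by omega) S2 hS21 hS22
    have hins : insert e L = L ∆ {e} := by
      ext d; simp only [mem_insert, mem_symmDiff, mem_singleton]
      by_cases hde : d = e
      · subst hde; tauto
      · tauto
    have hcut' : G.cut (S1 ∆ S2) = G.cut S := by
      rw [cut_symmDiff, hS12, hS22, hcut, hins]
      ext d
      simp only [mem_symmDiff]
      by_cases h1 : d ∈ P a <;> by_cases h2 : d ∈ P b <;> by_cases h3 : d ∈ P c <;>
        by_cases h4 : d ∈ L <;> by_cases h5 : d ∈ ({e} : Finset E) <;> simp [h1, h2, h3, h4, h5]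
    have hcw : (G.cut S).card < w := by
      rw [hcut]
      have h1 := card_symmDiff_le (insert e L) (P a ∆ P c)
      have h2 := card_symmDiff_le (P a) (P c)
      have h3 := hT.card_le a ha
      have h4 := hT.card_le c hc
      rw [card_insert_of_notMem heL] at h1
      omega
    have hsm : Small (S1 ∆ S2) := hS.union hS11 hS21
      (fun z hz => by rw [mem_symmDiff] at hz; rw [mem_union]; tauto) (by rw [hcut']; exact hcw)
    rw [← hS.eq_of_cut_eq hG hsm hS1 hcut', mem_symmDiff]
    tauto

end tree
end MGraph

namespace MGraph

section frame
open scoped Classical symmDiff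

variable {V E F : Type} [Fintype V] [Fintype E] [Fintype F]
variable {G : MGraph V E} {H : MGraph F E} {w t : ℕ} {Small : Finset V → Prop}

/-- The faces reachable from `c₀` through faces outside `Φ` sharing vertices. -/
noncomputable def outside (G : MGraph V E) (H : MGraph F E) (Φ : Finset F) (c₀ : F) : Finset F :=
  univ.filter (Relation.ReflTransGen
    (fun f f' => f' ∉ Φ ∧ ∃ v, Touch G H v f ∧ Touch G H v f') c₀)

lemma self_mem_outside {Φ : Finset F} {c₀ : F} : c₀ ∈ outside G H Φ c₀ := by
  simp [outside, Relation.ReflTransGen.refl]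

lemma outside_step {Φ : Finset F} {c₀ f f' : F} (h : f ∈ outside G H Φ c₀) (hf : f' ∉ Φ) {v : V}
    (h1 : Touch G H v f) (h2 : Touch G H v f') : f' ∈ outside G H Φ c₀ := by
  simp only [outside, mem_filter, mem_univ, true_and] at h ⊢
  exact h.tail ⟨hf, v, h1, h2⟩

lemma outside_anti {Φ Ψ : Finset F} (hs : Φ ⊆ Ψ) (c₀ : F) :
    outside G H Ψ c₀ ⊆ outside G H Φ c₀ := by
  intro f hf
  simp only [outside, mem_filter, mem_univ, true_and] at hf ⊢
  induction hf with
  | refl => exact Relation.ReflTransGen.refl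
  | tail _ h ih => exact ih.tail ⟨fun hb => h.1 (hs hb), h.2⟩

lemma notMem_of_mem_outside {Φ : Finset F} {c₀ f : F} (hc : c₀ ∉ Φ) (h : f ∈ outside G H Φ c₀) :
    f ∉ Φ := by
  simp only [outside, mem_filter, mem_univ, true_and] at h
  rcases Relation.ReflTransGen.cases_tail h with rfl | ⟨_, _, h⟩
  · exact hc
  · exact h.1

lemma mem_outside_of_verts {Φ : Finset F} {c₀ f : F} {x : V}
    (hx : x ∈ verts G H (outside G H Φ c₀)) (hf : f ∉ Φ) (h : Touch G H x f) :
    f ∈ outside G H Φ c₀ := by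
  obtain ⟨f', hf', hx'⟩ := mem_verts.1 hx
  exact outside_step hf' hf hx' h

lemma IsDualPair.outside_verts (hD : G.IsDualPair H w) {Φ : Finset F} {c₀ : F} {U : Finset V}
    (h : Avoids G H (outside G H Φ c₀) U) {x y : V} (hx : x ∈ verts G H (outside G H Φ c₀))
    (hy : y ∈ verts G H (outside G H Φ c₀)) : x ∈ U ↔ y ∈ U := by
  have key : ∀ f, Relation.ReflTransGen
      (fun f f' => f' ∉ Φ ∧ ∃ v, Touch G H v f ∧ Touch G H v f') c₀ f → ∀ x, Touch G H x f →
      ∃ z, Touch G H z c₀ ∧ (x ∈ U ↔ z ∈ U) := by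
    intro f hf
    induction hf with
    | refl => exact fun x hx => ⟨x, hx, Iff.rfl⟩
    | @tail b c hb hbc ih =>
      intro x hx
      obtain ⟨hc, v, hv, hv'⟩ := hbc
      obtain ⟨z, hz, hz'⟩ := ih v hv
      refine ⟨z, hz, (hD.face_verts (h c ?_) hx hv').trans hz'⟩
      simp only [outside, mem_filter, mem_univ, true_and]
      exact hb.tail ⟨hc, v, hv, hv'⟩
  obtain ⟨f, hf, hx⟩ := mem_verts.1 hx
  obtain ⟨f', hf', hy⟩ := mem_verts.1 hy
  obtain ⟨z, hz, hxz⟩ := key f (by simpa [outside] using hf) x hx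
  obtain ⟨z', hz', hyz⟩ := key f' (by simpa [outside] using hf') y hy
  rw [hxz, hyz]
  exact hD.face_verts (h c₀ self_mem_outside) hz hz'

/-- The edges between a ball and the outside. -/
noncomputable def rim (H : MGraph F E) (Φ Ψ : Finset F) : Finset E :=
  univ.filter fun e => (∃ f ∈ Φ, H.Inc e f) ∧ ∃ f ∈ Ψ, H.Inc e f

lemma mem_rim {Φ Ψ : Finset F} {e : E} :
    e ∈ rim H Φ Ψ ↔ (∃ f ∈ Φ, H.Inc e f) ∧ ∃ f ∈ Ψ, H.Inc e f := by simp [rim]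

/-- The ends of the edges of `K`. -/
noncomputable def ends (G : MGraph V E) (K : Finset E) : Finset V :=
  univ.filter fun x => ∃ e ∈ K, G.Inc e x

lemma mem_ends {K : Finset E} {x : V} : x ∈ ends G K ↔ ∃ e ∈ K, G.Inc e x := by simp [ends]

lemma IsDualPair.mem_ends_rim (hD : G.IsDualPair H w) {Φ : Finset F} {c₀ : F} {x : V}
    (hc : c₀ ∉ Φ) (h1 : x ∈ verts G H Φ) (h2 : x ∈ verts G H (outside G H Φ c₀)) :
    x ∈ ends G (rim H Φ (outside G H Φ c₀)) := by
  obtain ⟨f, hf, e, he, he'⟩ := mem_verts.1 h1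
  obtain ⟨f', hf', d, hd, hd'⟩ := mem_verts.1 h2
  obtain ⟨a, ha, ha'⟩ := hD.star_conn x Φ ⟨e, f, he, he', hf⟩
    ⟨d, f', hd, hd', notMem_of_mem_outside hc hf'⟩
  refine mem_ends.2 ⟨a, ?_, ha⟩
  have key : ∀ b b', H.Ends a b b' → b ∈ Φ → b' ∉ Φ → a ∈ rim H Φ (outside G H Φ c₀) :=
    fun b b' hbb hb hb' => mem_rim.2 ⟨⟨b, hb, hbb.left⟩, b',
      mem_outside_of_verts h2 hb' ⟨a, ha, hbb.symm.left⟩, hbb.symm.left⟩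
  rw [mem_cut] at ha'
  by_cases h : H.src a ∈ Φ
  · exact key _ _ (Ends.self H a) h (fun h' => ha' (iff_of_true h h'))
  · exact key _ _ (Ends.self H a).symm (by tauto) h

lemma IsDualPair.connects_rim (hD : G.IsDualPair H w) {f₀ c₀ : F} {i : ℕ} (hi : 2 * i + 1 < w)
    (hc : c₀ ∉ H.ball f₀ i) :
    G.Connects (rim H (H.ball f₀ i) (outside G H (H.ball f₀ i) c₀))
      (ends G (rim H (H.ball f₀ i) (outside G H (H.ball f₀ i) c₀))) := by
  set B := H.ball f₀ i with hB
  set C := outside G H B c₀ with hC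
  set Q := rim H B C with hQ
  intro U hU
  have hNB : ends G Q ⊆ verts G H B := by
    intro x hx
    obtain ⟨e, he, hex⟩ := mem_ends.1 hx
    obtain ⟨⟨f, hf, hef⟩, -⟩ := mem_rim.1 he
    exact mem_verts.2 ⟨f, hf, e, hex, hef⟩
  have hNC : ends G Q ⊆ verts G H C := by
    intro x hx
    obtain ⟨e, he, hex⟩ := mem_ends.1 hx
    obtain ⟨-, f, hf, hef⟩ := mem_rim.1 he
    exact mem_verts.2 ⟨f, hf, e, hex, hef⟩
  set V' := ends G Q ∩ U with hV'
  have hsides : ∀ e ∈ G.cut V', ∀ a b, H.Ends e a b → a ∈ B → b ∈ B := by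
    intro e he a b hab ha
    by_contra hb
    obtain ⟨x, hx, hxV⟩ : ∃ x, G.Inc e x ∧ x ∈ V' := by
      rw [mem_cut] at he
      by_cases h : G.src e ∈ V'
      · exact ⟨_, Or.inl rfl, h⟩
      · exact ⟨_, Or.inr rfl, by tauto⟩
    have hbC : b ∈ C := mem_outside_of_verts (hNC (mem_inter.1 hxV).1) hb ⟨e, hx, hab.symm.left⟩
    have heQ : e ∈ Q := mem_rim.2 ⟨⟨a, ha, hab.left⟩, b, hbC, hab.symm.left⟩
    have h1 := disjoint_left.1 hU heQ
    rw [mem_cut] at h1 he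
    have h2 : G.src e ∈ ends G Q := mem_ends.2 ⟨e, heQ, Or.inl rfl⟩
    have h3 : G.dst e ∈ ends G Q := mem_ends.2 ⟨e, heQ, Or.inr rfl⟩
    simp only [hV', mem_inter] at he
    tauto
  have hz : H.IsEven (G.cut V' ∩ H.inner B) := by
    intro y
    have h1 := hD.even_cut V' fun f => if f ∈ B then y f else 0
    rw [← h1, ← sum_subset (inter_subset_left : G.cut V' ∩ H.inner B ⊆ G.cut V')]
    · refine sum_congr rfl fun e he => ?_
      have h2 := mem_inner.1 (mem_inter.1 he).2
      rw [if_pos (h2 _ (Or.inl rfl)), if_pos (h2 _ (Or.inr rfl))]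
    · intro e he he'
      have h2 : H.src e ∉ B := fun h => he' (mem_inter.2 ⟨he, mem_inner.2 (by
        rintro f (rfl | rfl)
        · exact h
        · exact hsides e he _ _ (Ends.self H e) h)⟩)
      have h3 : H.dst e ∉ B := fun h => h2 (hsides e he _ _ (Ends.self H e).symm h)
      rw [if_neg h2, if_neg h3, add_zero]
  obtain ⟨W, hW⟩ := hD.exists_cut_of_inner_ball hi hz inter_subset_right
  have hWC : Avoids G H C W := by
    intro f hf e he hcut
    rw [hW, mem_inter] at hcut
    exact notMem_of_mem_outside hc hf (mem_inner.1 hcut.2 f he)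
  have hWB : Avoids G H B (W ∆ V') := by
    intro f hf e he hcut
    rw [cut_symmDiff, hW, mem_symmDiff] at hcut
    rcases hcut with ⟨h1, h2⟩ | ⟨h1, h2⟩
    · exact h2 (mem_inter.1 h1).1
    · refine h2 (mem_inter.2 ⟨h1, mem_inner.2 fun b hb => ?_⟩)
      obtain ⟨a, ha⟩ := he.exists_ends
      rcases ha.eq_or hb with rfl | rfl
      · exact hf
      · exact hsides e h1 _ _ ha hf
  have hiff : ∀ x ∈ ends G Q, ∀ y ∈ ends G Q, (x ∈ U ↔ y ∈ U) := by
    intro x hx y hy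
    have h1 := hD.outside_verts hWC (hNC hx) (hNC hy)
    have h2 := hD.ball_verts hWB (hNB hx) (hNB hy)
    simp only [mem_symmDiff, hV', mem_inter, hx, hy, true_and] at h2
    tauto
  by_cases hx : ∃ x ∈ ends G Q, x ∈ U
  · obtain ⟨x, hx, hx'⟩ := hx
    exact Or.inl fun y hy => (hiff x hx y hy).1 hx'
  · exact Or.inr (disjoint_left.2 fun z hz hz' => hx ⟨z, hz, hz'⟩)

/-- In a connected graph with a dual and a smallness notion there are two vertex sets which are
not engulfed, joined by `t` pairwise disjoint connected layers. -/
theorem exists_frame (hS : G.IsSmallness w Small) (hD : G.IsDualPair H w) (hG : G.Conn)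
    (ht : 0 < t) (htw : 10 * t ≤ w) (e₀ : E) :
    ∃ Y₁ Y₂ : Finset V, ¬ G.Engulfed Small t Y₁ ∧ ¬ G.Engulfed Small t Y₂ ∧
      ∃ (Q : ℕ → Finset E) (N U : ℕ → Finset V),
        (∀ i < t, ∀ j < t, i ≠ j → Disjoint (Q i) (Q j)) ∧
        ∀ i < t, G.Connects (Q i) (N i) ∧ Y₂ ⊆ U i ∧ (∀ x ∈ Y₁, x ∈ U i → x ∈ N i) ∧
          ∀ e ∈ G.cut (U i), ∀ x, G.Inc e x → x ∈ U i → x ∈ N i := by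
  obtain ⟨f₀, hf₀, hcen⟩ := exists_center hS hD hG (t := t) (by omega) (by omega) ht e₀
  obtain ⟨T, P, hT⟩ := exists_ballTree H f₀ (3 * t)
  obtain ⟨x, hx⟩ := hT.exists_sink hS hD hG (G.src e₀)
  set B := H.ball f₀ (2 * t) with hB
  have hcenB : ∀ U, verts G H B ⊆ U → Small U → (G.cut U).card < t → False :=
    fun U h1 h2 h3 => hcen ⟨U, (verts_mono (ball_mono (by omega))).trans h1, h2, h3⟩
  have key : ∀ U, Small U → (G.cut U).card < t → H.MinEven (G.cut U) → x ∈ U →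
      Avoids G H B U := by
    intro U h1 h2 h3 hxU f hf e he hcut
    have hfR : f ∈ H.ball f₀ (3 * t) := ball_mono (by omega) hf
    refine (h3.trail hcut he).not_mem_small hS hD hG hT hx hfR ?_ (by omega) U h1
      (by rw [symmDiff_self]; exact (symmDiff_bot _).symm) hxU
    intro d hd
    refine mem_inner.2 fun f' hf' => ?_
    have := ball_trans hf (h3.mem_ball hcut hd he hf')
    exact ball_mono (by omega) this
  by_cases hxe : G.Engulfed Small t {x}
  swap
  · refine ⟨{x}, {x}, hxe, hxe, fun _ => ∅, fun _ => {x}, fun _ => {x}, by simp, fun i _ => ?_⟩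
    refine ⟨fun U _ => ?_, subset_rfl, fun _ h _ => h, fun _ _ _ _ h => h⟩
    by_cases h : x ∈ U <;> simp [h]
  have hxconn : G.Connects (G.inner {x}) {x} := fun U _ => by by_cases h : x ∈ U <;> simp [h]
  have hxB : x ∉ verts G H B := by
    intro hxB
    obtain ⟨U, hxU, hU1, hU2, hU3⟩ := hxe.exists_minEven hS hD (by omega) hxconn
    rw [singleton_subset_iff] at hxU
    exact hcenB U (fun y hy => (hD.ball_verts (key U hU1 hU2 hU3 hxU) hxB hy).1 hxU) hU1 hU2
  obtain ⟨c₀, hc₀⟩ : ∃ c₀, Touch G H x c₀ := by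
    by_cases hne : (G.cut {x}).Nonempty
    · obtain ⟨e, he⟩ := hne
      rw [mem_cut, mem_singleton, mem_singleton] at he
      by_cases h : G.src e = x
      · exact ⟨H.src e, e, Or.inl h, Or.inl rfl⟩
      · exact ⟨H.src e, e, Or.inr (by tauto), Or.inl rfl⟩
    · rcases hG _ (not_nonempty_iff_eq_empty.1 hne) with h | h
      · simp at h
      · have : G.src e₀ ∈ ({x} : Finset V) := by rw [h]; exact mem_univ _
        exact ⟨H.src e₀, e₀, Or.inl (mem_singleton.1 this), Or.inl rfl⟩
  have hc₀B : ∀ i, i ≤ 2 * t → c₀ ∉ H.ball f₀ i := fun i hi h =>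
    hxB (mem_verts.2 ⟨c₀, ball_mono hi h, hc₀⟩)
  set C : ℕ → Finset F := fun i => outside G H (H.ball f₀ i) c₀ with hC
  have hY2 : ¬ G.Engulfed Small t (verts G H (C (2 * t))) := by
    intro hen
    obtain ⟨U, hYU, hU1, hU2, hU3⟩ := hen.exists_minEven hS hD (by omega)
      (connects_of_iff fun U hU y hy z hz =>
        (hD.outside_verts (avoids_of_disjoint_inner hU) hy hz).1)
    have hxU : x ∈ U := hYU (mem_verts.2 ⟨c₀, self_mem_outside, hc₀⟩)
    have hav := key U hU1 hU2 hU3 hxU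
    obtain ⟨u, hu1, hu2⟩ : ∃ u ∈ verts G H (C (2 * t)), u ∈ verts G H B := by
      by_contra hno
      push Not at hno
      have hcut : G.cut (verts G H (C (2 * t))) = ∅ := by
        rw [eq_empty_iff_forall_notMem]
        have hstep : ∀ e a b, G.Inc e a → G.Inc e b → a ∈ verts G H (C (2 * t)) →
            b ∈ verts G H (C (2 * t)) := by
          intro e a b ha hb haC
          refine mem_verts.2 ⟨H.src e, mem_outside_of_verts haC (fun h => ?_)
            ⟨e, ha, Or.inl rfl⟩, e, hb, Or.inl rfl⟩
          exact hno a haC (mem_verts.2 ⟨_, h, e, ha, Or.inl rfl⟩)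
        intro e he
        rw [mem_cut] at he
        exact he ⟨hstep e _ _ (Or.inl rfl) (Or.inr rfl), hstep e _ _ (Or.inr rfl) (Or.inl rfl)⟩
      obtain ⟨z, hz⟩ := hf₀
      rcases hG _ hcut with h | h
      · have : x ∈ verts G H (C (2 * t)) := mem_verts.2 ⟨c₀, self_mem_outside, hc₀⟩
        simp [h] at this
      · exact hno z (by rw [h]; exact mem_univ z) (mem_verts.2 ⟨f₀, self_mem_ball _ _, hz⟩)
    exact hcenB U (fun y hy => (hD.ball_verts hav hu2 hy).1 (hYU hu1)) hU1 hU2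
  refine ⟨verts G H (H.ball f₀ t), verts G H (C (2 * t)), hcen, hY2,
    fun i => rim H (H.ball f₀ (t + i)) (C (t + i)),
    fun i => ends G (rim H (H.ball f₀ (t + i)) (C (t + i))),
    fun i => verts G H (C (t + i)), ?_, ?_⟩
  · have hlt : ∀ i j, i < j → j < t →
        Disjoint (rim H (H.ball f₀ (t + i)) (C (t + i)))
          (rim H (H.ball f₀ (t + j)) (C (t + j))) := by
      intro i j hij hj
      refine disjoint_left.2 fun e he he' => ?_
      obtain ⟨⟨f, hf, hef⟩, -⟩ := mem_rim.1 he
      obtain ⟨-, f', hf', hef'⟩ := mem_rim.1 he'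
      refine notMem_of_mem_outside (hc₀B (t + j) (by omega)) hf' ?_
      have : f' ∈ H.ball f₀ (t + i + 1) := by
        obtain ⟨b, hb⟩ := hef.exists_ends
        rcases hb.eq_or hef' with rfl | rfl
        · exact ball_mono (Nat.le_succ _) hf
        · exact mem_ball_succ.2 (Or.inr ⟨e, f, hf, hb.symm⟩)
      exact ball_mono (by omega) this
    intro i hi j hj hij
    rcases lt_or_gt_of_ne hij with h | h
    · exact hlt i j h hj
    · exact (hlt j i h hi).symm
  · intro i hi
    have hci := hc₀B (t + i) (by omega)
    refine ⟨hD.connects_rim (by omega) hci, verts_mono (outside_anti (ball_mono (by omega)) c₀),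
      fun y hy hyU => hD.mem_ends_rim hci (verts_mono (ball_mono (by omega)) hy) hyU, ?_⟩
    intro e he y hy hyU
    refine hD.mem_ends_rim hci ?_ hyU
    by_contra hyB
    have h1 : H.src e ∈ C (t + i) := mem_outside_of_verts hyU
      (fun h => hyB (mem_verts.2 ⟨_, h, e, hy, Or.inl rfl⟩)) ⟨e, hy, Or.inl rfl⟩
    rw [mem_cut] at he
    exact he (iff_of_true (mem_verts.2 ⟨_, h1, e, Or.inl rfl, Or.inl rfl⟩)
      (mem_verts.2 ⟨_, h1, e, Or.inr rfl, Or.inl rfl⟩))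

end frame
end MGraph

namespace MGraph

section clusters
open scoped Classical

variable {V E F : Type} [Fintype V] [Fintype E]
variable {G : MGraph V E}

lemma Connects.iff {K : Finset E} {Y : Finset V} (h : G.Connects K Y) {U : Finset V}
    (hU : Disjoint K (G.cut U)) {x y : V} (hx : x ∈ Y) (hy : y ∈ Y) : x ∈ U ↔ y ∈ U := by
  rcases h U hU with h | h
  · exact iff_of_true (h hx) (h hy)
  · exact iff_of_false (disjoint_left.1 h hx) (disjoint_left.1 h hy)

lemma Connects.mono {K K' : Finset E} {Y Y' : Finset V} (h : G.Connects K Y) (hK : K ⊆ K')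
    (hY : Y' ⊆ Y) : G.Connects K' Y' :=
  connects_of_iff fun _ hU _ hx _ hy => (h.iff (hU.mono_left hK) (hY hx) (hY hy)).1

/-- Vertex sets obtained by adding vertices adjacent to earlier ones. -/
inductive Grown (G : MGraph V E) : Finset V → Prop
  | single (r : V) : Grown G {r}
  | step {S : Finset V} {v s : V} {e : E} (h : Grown G S) (hv : v ∉ S) (hs : s ∈ S)
      (he : G.Ends e v s) : Grown G (insert v S)

lemma Conn.grown_univ (hG : G.Conn) (r : V) : G.Grown univ := by
  obtain ⟨S, hS, hmax⟩ := (univ.filter fun S => G.Grown S).exists_max_image card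
    ⟨{r}, by simpa using Grown.single r⟩
  simp only [mem_filter, mem_univ, true_and] at hS hmax
  have hne : S.Nonempty := by
    cases hS <;> simp
  by_cases hcut : (G.cut S).Nonempty
  · obtain ⟨e, he⟩ := hcut
    rw [mem_cut] at he
    have key : ∀ v s, G.Ends e v s → s ∈ S → v ∉ S → False := by
      intro v s h hs hv
      have := hmax _ (hS.step hv hs h)
      rw [card_insert_of_notMem hv] at this
      omega
    by_cases h : G.src e ∈ S
    · exact (key _ _ (Ends.self G e).symm h (fun h' => he (iff_of_true h h'))).elim
    · exact (key _ _ (Ends.self G e) (by tauto) h).elim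
  · rcases hG _ (not_nonempty_iff_eq_empty.1 hcut) with h | h
    · exact absurd h hne.ne_empty
    · rwa [h] at hS

lemma disjoint_merge {α : Type} {K : V → Finset α}
    (hK : ∀ u v, u ≠ v → Disjoint (K u) (K v)) {Z : Finset α} (hZ : ∀ u, Disjoint Z (K u))
    (a b : V) :
    ∀ u v, u ≠ v → Disjoint (Function.update (Function.update K a ∅) b (K a ∪ K b ∪ Z) u)
      (Function.update (Function.update K a ∅) b (K a ∪ K b ∪ Z) v) := by
  have key : ∀ v, v ≠ b → Disjoint (K a ∪ K b ∪ Z) (Function.update K a ∅ v) := by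
    intro v hv
    by_cases hva : v = a
    · rw [hva, Function.update_self]; exact disjoint_empty_right _
    · rw [Function.update_of_ne hva, disjoint_union_left, disjoint_union_left]
      exact ⟨⟨hK _ _ (Ne.symm hva), hK _ _ (Ne.symm hv)⟩, hZ v⟩
  intro u v huv
  by_cases hu : u = b
  · have hv : v ≠ b := fun h => huv (hu.trans h.symm)
    rw [hu, Function.update_self, Function.update_of_ne hv]
    exact key v hv
  · by_cases hv : v = b
    · rw [hv, Function.update_self, Function.update_of_ne hu]
      exact (key u hu).symm
    · rw [Function.update_of_ne hu, Function.update_of_ne hv]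
      by_cases hua : u = a
      · rw [hua, Function.update_self]; exact disjoint_empty_left _
      · by_cases hva : v = a
        · rw [hva, Function.update_self]; exact disjoint_empty_right _
        · rw [Function.update_of_ne hua, Function.update_of_ne hva]
          exact hK u v huv

/-- The state of the clustering process, with `S` the vertices still to be processed. -/
structure ClusterState (G : MGraph V E) (p : V → ℝ) (W : ℝ) (S : Finset V) (K : V → Finset E)
    (X : V → Finset V) : Prop where
  disjK : ∀ u v, u ≠ v → Disjoint (K u) (K v)
  disjX : ∀ u v, u ≠ v → Disjoint (X u) (X v)
  done : ∀ v, ∀ e ∈ K v, ∃ x, G.Inc e x ∧ x ∉ S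
  covers : ∀ v, ∃ u, v ∈ X u
  active : ∀ v ∈ S, G.Connects (K v) (insert v (X v)) ∧ ∑ x ∈ X v, p x < W
  emitted : ∀ v, v ∉ S → G.Connects (K v) (X v) ∧
    (X v = ∅ ∨ W ≤ ∑ x ∈ X v, p x ∧ ∑ x ∈ X v, p x < 2 * W)

lemma connects_empty (K : Finset E) : G.Connects K ∅ := fun _ _ => Or.inl (empty_subset _)

lemma connects_singleton (K : Finset E) (x : V) : G.Connects K {x} := fun U _ => by
  by_cases h : x ∈ U <;> simp [h]

lemma exists_clusters_aux {p : V → ℝ} {W : ℝ} (hW : 0 < W) {S : Finset V} (hS : G.Grown S) :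
    ∀ (K : V → Finset E) (X : V → Finset V), G.ClusterState p W S K X →
      ∃ r K' X', G.ClusterState p W {r} K' X' := by
  induction hS with
  | single r => exact fun K X h => ⟨r, K, X, h⟩
  | @step S v s e hS hv hs he ih =>
    intro K X h
    have hvs : v ≠ s := fun hh => hv (hh ▸ hs)
    have heK : ∀ u, Disjoint {e} (K u) := by
      intro u
      rw [disjoint_singleton_left]
      intro heu
      obtain ⟨x, hx, hxS⟩ := h.done u e heu
      rcases he.eq_or hx with rfl | rfl
      · exact hxS (mem_insert_self _ _)
      · exact hxS (mem_insert_of_mem hs)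
    have cv := h.active v (mem_insert_self v S)
    have cs := h.active s (mem_insert_of_mem hs)
    have hconn : ∀ L, K v ⊆ L → K s ⊆ L → e ∈ L →
        G.Connects L (insert s (X v ∪ X s)) := by
      intro L h1 h2 h3
      have key : ∀ U, Disjoint L (G.cut U) → ∀ x ∈ insert s (X v ∪ X s), (x ∈ U ↔ s ∈ U) := by
        intro U hU x hx
        have h4 : v ∈ U ↔ s ∈ U :=
          (mem_iff_of_not_cut he.left (disjoint_left.1 hU h3)).trans
            (mem_iff_of_not_cut he.symm.left (disjoint_left.1 hU h3)).symm
        rcases mem_insert.1 hx with rfl | hx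
        · rfl
        rcases mem_union.1 hx with hx | hx
        · exact (cv.1.iff (hU.mono_left h1) (mem_insert_of_mem hx) (mem_insert_self _ _)).trans h4
        · exact cs.1.iff (hU.mono_left h2) (mem_insert_of_mem hx) (mem_insert_self _ _)
      exact connects_of_iff fun U hU x hx y hy hxU =>
        (key U hU y hy).2 ((key U hU x hx).1 hxU)
    have hsum : ∑ x ∈ X v ∪ X s, p x = ∑ x ∈ X v, p x + ∑ x ∈ X s, p x :=
      sum_union (h.disjX v s hvs)
    have main : ∀ a b, (a = v ∧ b = s ∨ a = s ∧ b = v) →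
        (∀ z, ∃ u, z ∈ Function.update (Function.update X a ∅) b (X a ∪ X b ∪ ∅) u) ∧
        (∀ u, ∀ d ∈ Function.update (Function.update K a ∅) b (K a ∪ K b ∪ {e}) u,
          ∃ x, G.Inc d x ∧ x ∉ S) := by
      intro a b hcase
      constructor
      · intro z
        obtain ⟨u, hu⟩ := h.covers z
        by_cases hub : u = a ∨ u = b
        · refine ⟨b, ?_⟩
          rw [Function.update_self]
          rcases hub with rfl | rfl <;> simp [hu]
        · push Not at hub
          exact ⟨u, by rwa [Function.update_of_ne hub.2, Function.update_of_ne hub.1]⟩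
      · have hold : ∀ u, ∀ d ∈ K u, ∃ x, G.Inc d x ∧ x ∉ S := by
          intro u d hd
          obtain ⟨x, hx, hxS⟩ := h.done u d hd
          exact ⟨x, hx, fun hh => hxS (mem_insert_of_mem hh)⟩
        intro u d hd
        by_cases hub : u = b
        · rw [hub, Function.update_self, mem_union, mem_union, mem_singleton] at hd
          rcases hd with (hd | hd) | rfl
          · exact hold _ d hd
          · exact hold _ d hd
          · exact ⟨v, he.left, hv⟩
        · rw [Function.update_of_ne hub] at hd
          by_cases hua : u = a
          · rw [hua, Function.update_self] at hd; simp at hd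
          · rw [Function.update_of_ne hua] at hd
            exact hold u d hd
    by_cases hlt : ∑ x ∈ X v ∪ X s, p x < W
    · refine ih (Function.update (Function.update K v ∅) s (K v ∪ K s ∪ {e}))
        (Function.update (Function.update X v ∅) s (X v ∪ X s ∪ ∅))
        ⟨disjoint_merge h.disjK heK v s, disjoint_merge h.disjX (by simp) v s,
          (main v s (by simp)).2, (main v s (by simp)).1, ?_, ?_⟩
      · intro u hu
        have huv : u ≠ v := fun hh => hv (hh ▸ hu)
        by_cases hus : u = s
        · rw [hus, Function.update_self, Function.update_self, union_empty]
          exact ⟨hconn _ (by intro; simp; tauto) (by intro; simp; tauto) (by simp), hlt⟩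
        · rw [Function.update_of_ne hus, Function.update_of_ne hus, Function.update_of_ne huv,
            Function.update_of_ne huv]
          exact h.active u (mem_insert_of_mem hu)
      · intro u hu
        have hus : u ≠ s := fun hh => hu (hh ▸ hs)
        rw [Function.update_of_ne hus, Function.update_of_ne hus]
        by_cases huv : u = v
        · rw [huv, Function.update_self, Function.update_self]
          exact ⟨connects_empty _, Or.inl rfl⟩
        · rw [Function.update_of_ne huv, Function.update_of_ne huv]
          exact h.emitted u (by simp [hu, huv])
    · refine ih (Function.update (Function.update K s ∅) v (K s ∪ K v ∪ {e}))
        (Function.update (Function.update X s ∅) v (X s ∪ X v ∪ ∅))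
        ⟨disjoint_merge h.disjK heK s v, disjoint_merge h.disjX (by simp) s v,
          (main s v (by simp)).2, (main s v (by simp)).1, ?_, ?_⟩
      · intro u hu
        have huv : u ≠ v := fun hh => hv (hh ▸ hu)
        rw [Function.update_of_ne huv, Function.update_of_ne huv]
        by_cases hus : u = s
        · rw [hus, Function.update_self, Function.update_self]
          exact ⟨connects_singleton _ _, by simpa using hW⟩
        · rw [Function.update_of_ne hus, Function.update_of_ne hus]
          exact h.active u (mem_insert_of_mem hu)
      · intro u hu
        have hus : u ≠ s := fun hh => hu (hh ▸ hs)
        by_cases huv : u = v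
        · rw [huv, Function.update_self, Function.update_self, union_empty, union_comm (X s)]
          refine ⟨(hconn _ (by intro; simp; tauto) (by intro; simp; tauto) (by simp)).mono
            subset_rfl (subset_insert _ _), Or.inr ⟨not_lt.1 hlt, ?_⟩⟩
          rw [hsum]
          linarith [cv.2, cs.2]
        · rw [Function.update_of_ne huv, Function.update_of_ne huv, Function.update_of_ne hus,
            Function.update_of_ne hus]
          exact h.emitted u (by simp [hu, huv])

/-- A connected graph with vertex weights less than `W` splits into edge-disjoint connected
clusters of weight between `W` and `2 * W`, up to one leftover piece of weight less than `W`. -/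
lemma Conn.exists_clusters (hG : G.Conn) (x₀ : V) {p : V → ℝ} {W : ℝ} (hW : 0 < W)
    (hp : ∀ v, p v < W) : ∃ r K X, G.ClusterState p W {r} K X :=
  exists_clusters_aux hW (hG.grown_univ x₀) (fun _ => ∅) (fun v => {v})
    ⟨by simp, by simp, by simp, by simp, fun v _ => ⟨by simpa using connects_singleton _ _,
      by simpa using hp v⟩, fun v hv => absurd (mem_univ v) hv⟩

end clusters
end MGraph

namespace MGraph

section deletion
open scoped Classical symmDiff

variable {V E F : Type} [Fintype V] [Fintype E] [Fintype F]
variable {G : MGraph V E} {H : MGraph F E} {w : ℕ}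

/-- `K` becomes even in `H` after contracting the edges of `D`. -/
def EvenModulo (H : MGraph F E) (D K : Finset E) : Prop :=
  ∀ y : F → ZMod 2, (∀ e ∈ D, y (H.src e) = y (H.dst e)) →
    ∑ e ∈ K, (y (H.src e) + y (H.dst e)) = 0

/-- The faces `f` and `f'` are merged when the edges of `D` are deleted. -/
def Merged (H : MGraph F E) (D : Finset E) (f f' : F) : Prop :=
  ∀ y : F → ZMod 2, (∀ e ∈ D, y (H.src e) = y (H.dst e)) → y f = y f'

lemma Merged.refl (D : Finset E) (f : F) : H.Merged D f f := fun _ _ => rfl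

lemma Merged.symm {D : Finset E} {f f' : F} (h : H.Merged D f f') : H.Merged D f' f :=
  fun y hy => (h y hy).symm

lemma Merged.trans {D : Finset E} {f f' f'' : F} (h : H.Merged D f f') (h' : H.Merged D f' f'') :
    H.Merged D f f'' :=
  fun y hy => (h y hy).trans (h' y hy)

lemma merged_of_mem {D : Finset E} {e : E} (he : e ∈ D) : H.Merged D (H.src e) (H.dst e) :=
  fun _ hy => hy e he

/-- One of the two sides of `e`. -/
def side (H : MGraph F E) (e : E) (i : Bool) : F := if i then H.src e else H.dst e

/-- The edges surviving in the subgraph on `V₀` after the deletion of `D`. -/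
abbrev SubEdge (G : MGraph V E) (D : Finset E) (V₀ : Finset V) : Type :=
  {e : E // e ∉ D ∧ G.src e ∈ V₀ ∧ G.dst e ∈ V₀}

/-- The subgraph on `V₀` after the deletion of `D`. -/
def sub (G : MGraph V E) (D : Finset E) (V₀ : Finset V) :
    MGraph {v // v ∈ V₀} (SubEdge G D V₀) where
  src e := ⟨G.src e.1, e.2.2.1⟩
  dst e := ⟨G.dst e.1, e.2.2.2⟩

/-- Two edge sides are consecutive on a face after the deletion of `D`. -/
def SideRel (G : MGraph V E) (H : MGraph F E) (D : Finset E) (V₀ : Finset V)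
    (p q : SubEdge G D V₀ × Bool) : Prop :=
  H.Merged D (H.side p.1.1 p.2) (H.side q.1.1 q.2) ∧ ∃ v, G.Inc p.1.1 v ∧ G.Inc q.1.1 v

noncomputable instance (G : MGraph V E) (H : MGraph F E) (D : Finset E) (V₀ : Finset V) :
    Fintype (Quot (SideRel G H D V₀)) := Fintype.ofFinite _

/-- The dual of the subgraph on `V₀` after the deletion of `D`. -/
def subDual (G : MGraph V E) (H : MGraph F E) (D : Finset E) (V₀ : Finset V) :
    MGraph (Quot (SideRel G H D V₀)) (SubEdge G D V₀) where
  src e := Quot.mk _ (e, true)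
  dst e := Quot.mk _ (e, false)

lemma sub_inc {D : Finset E} {V₀ : Finset V} {e : SubEdge G D V₀} {x : {v // v ∈ V₀}} :
    (G.sub D V₀).Inc e x ↔ G.Inc e.1 x.1 := by
  simp [Inc, sub, Subtype.ext_iff]

lemma subDual_inc {D : Finset E} {V₀ : Finset V} {e : SubEdge G D V₀}
    {f : Quot (SideRel G H D V₀)} :
    (G.subDual H D V₀).Inc e f ↔ ∃ i, Quot.mk _ (e, i) = f := by
  constructor
  · rintro (h | h)
    · exact ⟨true, h⟩
    · exact ⟨false, h⟩
  · rintro ⟨i, h⟩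
    cases i
    · exact Or.inr h
    · exact Or.inl h

lemma inc_side (H : MGraph F E) (e : E) (i : Bool) : H.Inc e (H.side e i) := by
  cases i
  · exact Or.inr rfl
  · exact Or.inl rfl

lemma isEven_cut_of_stars (h : ∀ x, H.IsEven (G.cut {x})) (U : Finset V) :
    H.IsEven (G.cut U) := by
  induction U using Finset.induction_on with
  | empty => rw [cut_empty]; exact isEven_empty _
  | insert x U hx ih =>
    have : insert x U = U ∆ {x} := by
      ext z
      simp only [mem_insert, mem_symmDiff, mem_singleton]
      by_cases hz : z = x
      · subst hz; tauto
      · tauto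
    rw [this, cut_symmDiff]
    exact ih.symmDiff (h x)

/-- Deleting `D` and restricting to `V₀` turns a pair with even cuts and connected stars into a
dual pair, provided that short even sets modulo `D` are cuts. -/
theorem isDualPair_sub (heven : ∀ U, H.IsEven (G.cut U))
    (hstar : ∀ (x : V) (Φ : Finset F), (∃ e f, G.Inc e x ∧ H.Inc e f ∧ f ∈ Φ) →
      (∃ e f, G.Inc e x ∧ H.Inc e f ∧ f ∉ Φ) → ∃ e, G.Inc e x ∧ e ∈ H.cut Φ)
    {D : Finset E} {V₀ : Finset V} (hV₀ : G.cut V₀ ⊆ D)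
    (hshort : ∀ K, Disjoint K D → H.EvenModulo D K → K.card < w → ∃ U, G.cut U \ D = K) :
    (G.sub D V₀).IsDualPair (G.subDual H D V₀) w := by
  have hlift : ∀ e ∉ D, ∀ x ∈ V₀, G.Inc e x → e ∉ D ∧ G.src e ∈ V₀ ∧ G.dst e ∈ V₀ := by
    intro e he x hx hex
    have h1 : e ∉ G.cut V₀ := fun h => he (hV₀ h)
    have h2 := (mem_iff_of_not_cut hex h1).1 hx
    exact ⟨he, h2, (mem_iff_of_not_cut (Or.inr rfl) h1).2 h2⟩
  have hstarEven : ∀ x, (G.subDual H D V₀).IsEven ((G.sub D V₀).cut {x}) := by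
    intro x y
    let P : F → SubEdge G D V₀ × Bool → Prop := fun f p =>
      G.Inc p.1.1 x.1 ∧ H.Merged D (H.side p.1.1 p.2) f
    let h : F → ZMod 2 := fun f => if hf : ∃ p, P f p then y (Quot.mk _ hf.choose) else 0
    have hval : ∀ f p, P f p → h f = y (Quot.mk _ p) := by
      intro f p hp
      have hf : ∃ p, P f p := ⟨p, hp⟩
      have h1 : h f = y (Quot.mk _ hf.choose) := dif_pos hf
      rw [h1]
      congr 1
      exact Quot.sound ⟨hf.choose_spec.2.trans hp.2.symm, x.1, hf.choose_spec.1, hp.1⟩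
    have hmer : ∀ f f', H.Merged D f f' → h f = h f' := by
      intro f f' hff
      by_cases hf : ∃ p, P f p
      · obtain ⟨p, hp⟩ := hf
        rw [hval f p hp, hval f' p ⟨hp.1, hp.2.trans hff⟩]
      · have hf' : ¬ ∃ p, P f' p := fun ⟨p, hp⟩ => hf ⟨p, hp.1, hp.2.trans hff.symm⟩
        have h1 : h f = 0 := dif_neg hf
        have h2 : h f' = 0 := dif_neg hf'
        rw [h1, h2]
    have hbase := heven {x.1} h
    rw [← hbase]
    have hsub : ((G.sub D V₀).cut {x}).map ⟨Subtype.val, Subtype.val_injective⟩ ⊆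
        G.cut {x.1} := by
      intro e he
      obtain ⟨e', he', rfl⟩ := mem_map.1 he
      rw [mem_cut] at he' ⊢
      simpa [sub, Subtype.ext_iff] using he'
    rw [← sum_subset hsub, sum_map]
    · refine sum_congr rfl fun e he => ?_
      have hex : G.Inc e.1 x.1 := by
        rw [mem_cut] at he
        by_contra hc
        simp only [Inc, not_or] at hc
        exact he (by simp [sub, Subtype.ext_iff, hc.1, hc.2])
      rw [show h (H.src ((⟨Subtype.val, Subtype.val_injective⟩ : SubEdge G D V₀ ↪ E) e)) =
          y (Quot.mk _ (e, true)) from hval _ (e, true) ⟨hex, Merged.refl D _⟩,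
        show h (H.dst ((⟨Subtype.val, Subtype.val_injective⟩ : SubEdge G D V₀ ↪ E) e)) =
          y (Quot.mk _ (e, false)) from hval _ (e, false) ⟨hex, Merged.refl D _⟩]
      rfl
    · intro e he he'
      have heD : e ∈ D := by
        by_contra heD
        have hex : G.Inc e x.1 := by
          rw [mem_cut] at he
          by_contra hc
          simp only [Inc, not_or] at hc
          exact he (by simp [hc.1, hc.2])
        refine he' (mem_map.2 ⟨⟨e, hlift e heD x.1 x.2 hex⟩, ?_, rfl⟩)
        rw [mem_cut] at he ⊢
        simpa [sub, Subtype.ext_iff] using he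
      rw [hmer _ _ (merged_of_mem heD)]
      exact CharTwo.add_self_eq_zero _
  refine ⟨?_, ?_, ?_, ?_⟩
  · exact isEven_cut_of_stars hstarEven
  · intro x Φ h1 h2
    obtain ⟨e, f, he, hf, hfΦ⟩ := h1
    obtain ⟨e', f', he', hf', hfΦ'⟩ := h2
    obtain ⟨i, rfl⟩ := subDual_inc.1 hf
    obtain ⟨i', rfl⟩ := subDual_inc.1 hf'
    rw [sub_inc] at he he'
    let Ψ : Finset F := univ.filter fun f => ∃ p : SubEdge G D V₀ × Bool,
      G.Inc p.1.1 x.1 ∧ H.Merged D (H.side p.1.1 p.2) f ∧ Quot.mk _ p ∈ Φ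
    have hΨ : ∀ p : SubEdge G D V₀ × Bool, G.Inc p.1.1 x.1 →
        (H.side p.1.1 p.2 ∈ Ψ ↔ Quot.mk _ p ∈ Φ) := by
      intro p hp
      simp only [Ψ, mem_filter, mem_univ, true_and]
      constructor
      · rintro ⟨q, hq1, hq2, hq3⟩
        rwa [show Quot.mk (SideRel G H D V₀) p = Quot.mk _ q from
          Quot.sound ⟨hq2.symm, x.1, hp, hq1⟩]
      · exact fun h => ⟨p, hp, Merged.refl D _, h⟩
    obtain ⟨a, ha, ha'⟩ := hstar x.1 Ψ ⟨e.1, _, he, inc_side H _ i, (hΨ (e, i) he).2 hfΦ⟩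
      ⟨e'.1, _, he', inc_side H _ i', fun h => hfΦ' ((hΨ (e', i') he').1 h)⟩
    rw [mem_cut] at ha'
    have haD : a ∉ D := by
      intro haD
      refine ha' ?_
      have := merged_of_mem (H := H) haD
      simp only [Ψ, mem_filter, mem_univ, true_and]
      constructor
      · rintro ⟨p, h1, h2, h3⟩; exact ⟨p, h1, h2.trans this, h3⟩
      · rintro ⟨p, h1, h2, h3⟩; exact ⟨p, h1, h2.trans this.symm, h3⟩
    refine ⟨⟨a, hlift a haD x.1 x.2 ha⟩, sub_inc.2 ha, ?_⟩
    rw [mem_cut]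
    have e1 := hΨ (⟨a, hlift a haD x.1 x.2 ha⟩, true) ha
    have e2 := hΨ (⟨a, hlift a haD x.1 x.2 ha⟩, false) ha
    intro h
    exact ha' (e1.trans (h.trans e2.symm))
  · intro f U hU
    have key : ∀ p q, Relation.EqvGen (SideRel G H D V₀) p q → Quot.mk _ p = f →
        ((G.sub D V₀).src p.1 ∈ U ↔ (G.sub D V₀).src q.1 ∈ U) := by
      intro p q hpq
      induction hpq with
      | rel p q h =>
        intro hp
        obtain ⟨h1, v, hv, hv'⟩ := id h
        have hq : Quot.mk _ q = f := (Quot.sound h).symm.trans hp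
        have h2 := hU p.1 (subDual_inc.2 ⟨p.2, hp⟩)
        have h3 := hU q.1 (subDual_inc.2 ⟨q.2, hq⟩)
        have hvV : v ∈ V₀ := by
          rcases hv with rfl | rfl
          · exact p.1.2.2.1
          · exact p.1.2.2.2
        rw [← mem_iff_of_not_cut (x := ⟨v, hvV⟩) (sub_inc.2 hv) h2,
          ← mem_iff_of_not_cut (x := ⟨v, hvV⟩) (sub_inc.2 hv') h3]
      | refl p => exact fun _ => Iff.rfl
      | symm p q h ih => exact fun hq => (ih ((Quot.eqvGen_sound h).trans hq)).symm
      | trans p q r h1 _ ih1 ih2 =>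
        exact fun hp => (ih1 hp).trans (ih2 ((Quot.eqvGen_sound h1).symm.trans hp))
    intro e e' he he'
    obtain ⟨i, hi⟩ := subDual_inc.1 he
    obtain ⟨i', hi'⟩ := subDual_inc.1 he'
    exact key (e, i) (e', i') (Quot.eqvGen_exact (hi.trans hi'.symm)) hi
  · intro K hK hw
    let K' : Finset E := K.map ⟨Subtype.val, Subtype.val_injective⟩
    obtain ⟨U, hU⟩ := hshort K' (disjoint_left.2 fun e he => by
        obtain ⟨e', _, rfl⟩ := mem_map.1 he; exact e'.2.1) (by
        intro y hy
        have := hK (Quot.lift (fun p => y (H.side p.1.1 p.2)) fun p q h => h.1 y hy)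
        rw [sum_map]
        exact this) (by rwa [card_map])
    refine ⟨univ.filter fun v => v.1 ∈ U, ?_⟩
    ext e
    have h1 : e ∈ K ↔ e.1 ∈ K' := by simp [K']
    rw [h1, ← hU, mem_cut, mem_sdiff, mem_cut]
    simp [sub, e.2.1]

end deletion
end MGraph

namespace MGraph

section spaces
open scoped Classical symmDiff

variable {V E F : Type} [Fintype V] [Fintype E] [Fintype F]
variable {G : MGraph V E} {H : MGraph F E} {w : ℕ}

/-- The coboundary map over the field with two elements. -/
def delta (G : MGraph V E) : (V → ZMod 2) →ₗ[ZMod 2] (E → ZMod 2) where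
  toFun y e := y (G.src e) + y (G.dst e)
  map_add' y z := by ext e; simp only [Pi.add_apply]; ring
  map_smul' a y := by ext e; simp only [Pi.smul_apply, smul_eq_mul, RingHom.id_apply]; ring

lemma delta_apply (G : MGraph V E) (y : V → ZMod 2) (e : E) :
    G.delta y e = y (G.src e) + y (G.dst e) := rfl

/-- The boundary map over the field with two elements. -/
def boundary (G : MGraph V E) : (E → ZMod 2) →ₗ[ZMod 2] Module.Dual (ZMod 2) (V → ZMod 2) where
  toFun z :=
    { toFun := fun y => ∑ e, z e * G.delta y e
      map_add' := fun y y' => by simp [mul_add, sum_add_distrib]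
      map_smul' := fun a y => by
        simp only [map_smul, Pi.smul_apply, smul_eq_mul, RingHom.id_apply, mul_sum]
        exact sum_congr rfl fun e _ => by ring }
  map_add' z z' := by ext y; simp [add_mul, sum_add_distrib]
  map_smul' a z := by
    ext y
    simp [mul_sum, mul_assoc]

lemma boundary_apply (G : MGraph V E) (z : E → ZMod 2) (y : V → ZMod 2) :
    G.boundary z y = ∑ e, z e * G.delta y e := rfl

/-- The space of even edge sets. -/
def cycleSpace (G : MGraph V E) : Submodule (ZMod 2) (E → ZMod 2) := LinearMap.ker G.boundary

lemma mem_cycleSpace {z : E → ZMod 2} :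
    z ∈ G.cycleSpace ↔ ∀ y, ∑ e, z e * G.delta y e = 0 := by
  rw [cycleSpace, LinearMap.mem_ker]
  exact ⟨fun h y => by rw [← boundary_apply, h]; rfl, fun h => LinearMap.ext h⟩

lemma exists_sum_of_notMem {S : Submodule (ZMod 2) (E → ZMod 2)} {x : E → ZMod 2} (hx : x ∉ S) :
    ∃ c : E → ZMod 2, ∑ e, x e * c e ≠ 0 ∧ ∀ z ∈ S, ∑ e, z e * c e = 0 := by
  obtain ⟨φ, h1, h2⟩ := Submodule.exists_le_ker_of_notMem hx
  have h : ∀ z, φ z = ∑ e, z e * φ (Pi.single e 1) := fun z => by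
    rw [LinearMap.pi_apply_eq_sum_univ φ z]
    refine sum_congr rfl fun e _ => ?_
    rw [smul_eq_mul]
    congr 2
    ext i
    simp [Pi.single_apply, eq_comm]
  refine ⟨fun e => φ (Pi.single e 1), ?_, fun z hz => ?_⟩
  · rw [← h]; exact h1
  · rw [← h]; exact h2 hz

lemma mem_range_delta_of_orthogonal {c : E → ZMod 2}
    (h : ∀ z ∈ H.cycleSpace, ∑ e, z e * c e = 0) : ∃ y, H.delta y = c := by
  by_contra hc
  have hc' : c ∉ LinearMap.range H.delta := fun ⟨y, hy⟩ => hc ⟨y, hy⟩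
  obtain ⟨z, h1, h2⟩ := exists_sum_of_notMem hc'
  refine h1 ?_
  have hz : z ∈ H.cycleSpace := by
    rw [mem_cycleSpace]
    intro y
    rw [← h2 _ ⟨y, rfl⟩]
    exact sum_congr rfl fun e _ => mul_comm _ _
  rw [← h z hz]
  exact sum_congr rfl fun e _ => mul_comm _ _

lemma zmod_two_eq (a : ZMod 2) : a = 0 ∨ a = 1 := by revert a; decide

lemma EvenModulo.exists_lift {D K : Finset E} (hK : H.EvenModulo D K) :
    ∃ z ∈ H.cycleSpace, ∀ e ∉ D, z e = if e ∈ K then 1 else 0 := by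
  let T : Submodule (ZMod 2) (E → ZMod 2) :=
    { carrier := {z | ∀ e ∉ D, z e = 0}
      add_mem' := fun {a b} ha hb e he => by simp [ha e he, hb e he]
      zero_mem' := fun e _ => rfl
      smul_mem' := fun a z hz e he => by simp [hz e he] }
  let χ : E → ZMod 2 := fun e => if e ∈ K then 1 else 0
  have hχ : χ ∈ H.cycleSpace ⊔ T := by
    by_contra hc
    obtain ⟨c, h1, h2⟩ := exists_sum_of_notMem hc
    obtain ⟨y, rfl⟩ := mem_range_delta_of_orthogonal fun z hz => h2 z (Submodule.mem_sup_left hz)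
    refine h1 ?_
    have hD : ∀ e ∈ D, y (H.src e) = y (H.dst e) := by
      intro e he
      have hT : (Pi.single e 1 : E → ZMod 2) ∈ T := by
        intro e' he'
        rw [Pi.single_apply, if_neg]
        rintro rfl; exact he' he
      have := h2 _ (Submodule.mem_sup_right hT)
      simp only [Pi.single_apply, ite_mul, one_mul, zero_mul, sum_ite_eq', mem_univ, if_true,
        delta_apply] at this
      exact CharTwo.add_eq_zero.1 this
    rw [← hK y hD]
    simp [χ, ite_mul, delta_apply]
  obtain ⟨z, hz, u, hu, hzu⟩ := Submodule.mem_sup.1 hχ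
  refine ⟨z, hz, fun e he => ?_⟩
  have := congrFun hzu e
  simpa [hu e he, χ] using this

lemma delta_eq_ite (G : MGraph V E) (y : V → ZMod 2) (e : E) :
    G.delta y e = if e ∈ G.cut (univ.filter fun v => y v = 1) then 1 else 0 := by
  simp only [delta_apply, mem_cut, mem_filter, mem_univ, true_and]
  rcases zmod_two_eq (y (G.src e)) with h1 | h1 <;>
    rcases zmod_two_eq (y (G.dst e)) with h2 | h2 <;>
    simp [h1, h2, CharTwo.add_self_eq_zero]

lemma range_delta_le_cycleSpace (heven : ∀ U, H.IsEven (G.cut U)) :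
    LinearMap.range G.delta ≤ H.cycleSpace := by
  rintro _ ⟨y, rfl⟩
  rw [mem_cycleSpace]
  intro y'
  rw [← heven (univ.filter fun v => y v = 1) y']
  simp only [delta_eq_ite G y, ite_mul, one_mul, zero_mul]
  rw [← sum_filter]
  refine sum_congr ?_ fun e _ => rfl
  ext e; simp

/-- If the even sets exceed the cuts by at most `m` dimensions, then after deleting at most `m w`
edges all even sets of fewer than `w` edges are cuts. -/
theorem exists_deletion (heven : ∀ U, H.IsEven (G.cut U)) {m : ℕ}
    (hdim : Module.finrank (ZMod 2) H.cycleSpace ≤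
      Module.finrank (ZMod 2) (LinearMap.range G.delta) + m) (w : ℕ) :
    ∃ D : Finset E, D.card ≤ m * w ∧
      ∀ K, Disjoint K D → H.EvenModulo D K → K.card < w → ∃ U, G.cut U \ D = K := by
  by_contra hcon
  push Not at hcon
  have key : ∀ j ≤ m + 1, ∃ (S : Submodule (ZMod 2) (E → ZMod 2)) (D : Finset E),
      S ≤ H.cycleSpace ∧
      Module.finrank (ZMod 2) (LinearMap.range G.delta) + j ≤ Module.finrank (ZMod 2) S ∧
      D.card ≤ j * w ∧ ∀ s ∈ S, ∃ y, ∀ e ∉ D, s e = G.delta y e := by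
    intro j
    induction j with
    | zero =>
      exact fun _ => ⟨_, ∅, range_delta_le_cycleSpace heven, le_rfl, by simp,
        fun s ⟨y, hy⟩ => ⟨y, fun e _ => by rw [hy]⟩⟩
    | succ j ih =>
      intro hj
      obtain ⟨S, D, h1, h2, h3, h4⟩ := ih (by omega)
      obtain ⟨K, hKD, hK, hKw, hKU⟩ := hcon D (h3.trans (Nat.mul_le_mul_right w (by omega)))
      obtain ⟨z, hz, hzK⟩ := hK.exists_lift
      have hzS : z ∉ S := by
        intro hzS
        obtain ⟨y, hy⟩ := h4 z hzS
        refine hKU (univ.filter fun v => y v = 1) ?_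
        ext e
        by_cases heD : e ∈ D
        · simp [heD, disjoint_right.1 hKD heD]
        · have h5 := hzK e heD
          rw [hy e heD, delta_eq_ite] at h5
          simp only [mem_sdiff, heD, not_false_iff, and_true]
          by_contra hne
          by_cases heK : e ∈ K <;> simp_all
      refine ⟨S ⊔ Submodule.span (ZMod 2) {z}, D ∪ K, ?_, ?_, ?_, ?_⟩
      · exact sup_le h1 (by rwa [Submodule.span_singleton_le_iff_mem])
      · have hlt : S < S ⊔ Submodule.span (ZMod 2) {z} := by
          refine lt_of_le_of_ne le_sup_left fun heq => hzS ?_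
          rw [heq]
          exact Submodule.mem_sup_right (Submodule.mem_span_singleton_self z)
        have := Submodule.finrank_lt_finrank_of_lt hlt
        omega
      · have := card_union_le D K
        rw [add_mul, one_mul]
        omega
      · intro s hs
        obtain ⟨s', hs', u, hu, rfl⟩ := Submodule.mem_sup.1 hs
        obtain ⟨a, rfl⟩ := Submodule.mem_span_singleton.1 hu
        obtain ⟨y, hy⟩ := h4 s' hs'
        refine ⟨y, fun e he => ?_⟩
        simp only [mem_union, not_or] at he
        simp [hy e he.1, hzK e he.1, he.2]
  obtain ⟨S, D, h1, h2, -, -⟩ := key (m + 1) le_rfl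
  have := Submodule.finrank_mono h1
  omega

lemma finrank_cycleSpace (H : MGraph F E) :
    Module.finrank (ZMod 2) H.cycleSpace + Fintype.card F =
      Fintype.card E + Module.finrank (ZMod 2) (LinearMap.ker H.delta) := by
  have h1 : H.boundary = H.delta.dualMap ∘ₗ (dotProductEquiv (ZMod 2) E).toLinearMap := by
    refine LinearMap.ext fun z => LinearMap.ext fun y => ?_
    rfl
  have h2 : Module.finrank (ZMod 2) (LinearMap.range H.boundary) =
      Module.finrank (ZMod 2) (LinearMap.range H.delta) := by
    rw [h1, LinearMap.range_comp, LinearEquiv.range, Submodule.map_top,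
      LinearMap.finrank_range_dualMap_eq_finrank_range]
  have h3 := LinearMap.finrank_range_add_finrank_ker H.boundary
  have h4 := LinearMap.finrank_range_add_finrank_ker H.delta
  simp only [Module.finrank_fintype_fun_eq_card] at h3 h4
  rw [cycleSpace]
  omega

lemma finrank_range_delta (G : MGraph V E) :
    Module.finrank (ZMod 2) (LinearMap.range G.delta) +
      Module.finrank (ZMod 2) (LinearMap.ker G.delta) = Fintype.card V := by
  rw [LinearMap.finrank_range_add_finrank_ker]
  simp

end spaces
end MGraph

section embedding
open scoped Classical
open MGraph

variable {V : Type} [Fintype V] {G : SimpleGraph V}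

noncomputable instance : Fintype G.Dart :=
  Fintype.ofInjective (fun d : G.Dart => d.toProd) fun a b h => SimpleGraph.Dart.ext a b h

lemma exists_dart_edge (e : G.edgeSet) : ∃ d : G.Dart, d.edge = e.1 := by
  obtain ⟨e, he⟩ := e
  induction e using Sym2.ind with
  | _ u v => exact ⟨⟨(u, v), he⟩, rfl⟩

/-- A dart chosen on each edge. -/
noncomputable def edgeDart (e : G.edgeSet) : G.Dart := (exists_dart_edge e).choose

lemma edgeDart_edge (e : G.edgeSet) : (edgeDart e).edge = e.1 := (exists_dart_edge e).choose_spec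

lemma eq_edgeDart (d : G.Dart) : d = edgeDart ⟨d.edge, d.edge_mem⟩ ∨
    d = (edgeDart ⟨d.edge, d.edge_mem⟩).symm :=
  (SimpleGraph.dart_edge_eq_iff _ _).1 (edgeDart_edge ⟨d.edge, d.edge_mem⟩).symm

lemma sum_darts {M : Type} [AddCommMonoid M] (f : G.Dart → M) :
    ∑ d, f d = ∑ e : G.edgeSet, (f (edgeDart e) + f (edgeDart e).symm) := by
  let φ : G.edgeSet × Bool → G.Dart := fun p => if p.2 then edgeDart p.1 else (edgeDart p.1).symm
  have hφ : ∀ p, (φ p).edge = p.1.1 := by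
    rintro ⟨e, _ | _⟩
    · simp [φ, SimpleGraph.Dart.edge_symm, edgeDart_edge]
    · simp [φ, edgeDart_edge]
  have hb : Function.Bijective φ := by
    constructor
    · rintro ⟨e, i⟩ ⟨e', i'⟩ h
      have he : e = e' := Subtype.ext (by rw [← hφ (e, i), h, hφ])
      subst he
      have hne := (edgeDart e).symm_ne
      cases i <;> cases i'
      · rfl
      · exact absurd h hne
      · exact absurd h.symm hne
      · rfl
    · intro d
      rcases eq_edgeDart d with h | h
      · exact ⟨(_, true), by simp only [φ, if_true]; exact h.symm⟩
      · exact ⟨(⟨d.edge, d.edge_mem⟩, false), by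
          simp only [φ]; exact h.symm⟩
  rw [← Function.Bijective.sum_comp hb f, Fintype.sum_prod_type]
  refine sum_congr rfl fun e _ => ?_
  simp [φ]

/-- A simple graph as a multigraph. -/
noncomputable def baseGraph (G : SimpleGraph V) : MGraph V G.edgeSet where
  src e := (edgeDart e).fst
  dst e := (edgeDart e).snd

/-- The faces of a rotation system. -/
abbrev RotationSystem.Face (rs : RotationSystem G) : Type :=
  Quotient (permOrbitSetoid (rs.rot * dartRev G))

noncomputable instance (rs : RotationSystem G) : Fintype rs.Face := Fintype.ofFinite _

/-- The face containing a dart. -/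
def RotationSystem.face (rs : RotationSystem G) (d : G.Dart) : rs.Face := Quotient.mk _ d

/-- The dual multigraph of a rotation system. -/
noncomputable def RotationSystem.dual (rs : RotationSystem G) : MGraph rs.Face G.edgeSet where
  src e := rs.face (edgeDart e)
  dst e := rs.face (edgeDart e).symm

variable (rs : RotationSystem G)

lemma RotationSystem.face_rot (d : G.Dart) : rs.face (rs.rot d) = rs.face d.symm :=
  (Quotient.sound (s := permOrbitSetoid (rs.rot * dartRev G)) (by
    change Equiv.Perm.SameCycle _ _ _
    refine ⟨1, ?_⟩
    rw [zpow_one, Equiv.Perm.mul_apply]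
    change rs.rot d.symm.symm = _
    rw [SimpleGraph.Dart.symm_symm])).symm

lemma RotationSystem.rot_induction {P : G.Dart → Prop} {d d' : G.Dart} (hdd : d.fst = d'.fst)
    (hd : P d) (h : ∀ a : G.Dart, a.fst = d.fst → P a → P (rs.rot a)) : P d' := by
  obtain ⟨i, -, rfl⟩ := (rs.vertex_cycle d d' hdd).exists_pow_eq'
  have key : ∀ i : ℕ, ((rs.rot ^ i) d).fst = d.fst ∧ P ((rs.rot ^ i) d) := by
    intro i
    induction i with
    | zero => exact ⟨rfl, hd⟩
    | succ i ih =>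
      rw [pow_succ', Equiv.Perm.mul_apply]
      exact ⟨(rs.tail_fixed _).trans ih.1, h _ ih.1 ih.2⟩
  exact (key i).2

lemma RotationSystem.isEven_cut (U : Finset V) : rs.dual.IsEven ((baseGraph G).cut U) := by
  intro y
  let f : G.Dart → ZMod 2 := fun d => if d.fst ∈ U then y (rs.face d) else 0
  let f' : G.Dart → ZMod 2 := fun d => if d.fst ∈ U then y (rs.face d.symm) else 0
  have h1 : ∑ d, f' d = ∑ d, f d := by
    rw [← Equiv.sum_comp rs.rot f]
    refine sum_congr rfl fun d _ => ?_
    simp only [f, f', rs.face_rot]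
    rw [show (rs.rot d).fst = d.fst from rs.tail_fixed d]
  have h2 : ∑ d, (f d + f' d) = 0 := by
    rw [sum_add_distrib, h1]; exact CharTwo.add_self_eq_zero _
  rw [← h2, sum_darts, MGraph.cut, sum_filter]
  refine sum_congr rfl fun e _ => ?_
  simp only [f, f', SimpleGraph.Dart.symm_symm, baseGraph, RotationSystem.dual]
  generalize y (rs.face (edgeDart e)) = a
  generalize y (rs.face (edgeDart e).symm) = b
  rw [show (edgeDart e).symm.fst = (edgeDart e).snd from rfl]
  by_cases h3 : (edgeDart e).fst ∈ U <;> by_cases h4 : (edgeDart e).snd ∈ U <;>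
    simp only [h3, h4, if_true, if_false, not_true, not_false_iff, add_zero, zero_add, iff_true,
      iff_false] <;> revert a b <;> decide

lemma RotationSystem.exists_dart_of_inc {e : G.edgeSet} {x : V} {f : rs.Face}
    (he : (baseGraph G).Inc e x) (hf : rs.dual.Inc e f) :
    ∃ d : G.Dart, d.edge = e.1 ∧ d.fst = x ∧ (f = rs.face d ∨ f = rs.face d.symm) := by
  rcases he with h | h
  · refine ⟨edgeDart e, edgeDart_edge e, h, ?_⟩
    rcases hf with h' | h'
    · exact Or.inl h'.symm
    · exact Or.inr h'.symm
  · refine ⟨(edgeDart e).symm, by rw [SimpleGraph.Dart.edge_symm, edgeDart_edge], h, ?_⟩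
    rw [SimpleGraph.Dart.symm_symm]
    rcases hf with h' | h'
    · exact Or.inr h'.symm
    · exact Or.inl h'.symm

lemma RotationSystem.face_mem_iff {d : G.Dart} {Φ : Finset rs.Face}
    (h : ⟨d.edge, d.edge_mem⟩ ∉ rs.dual.cut Φ) : rs.face d ∈ Φ ↔ rs.face d.symm ∈ Φ := by
  rw [mem_cut, not_not] at h
  rcases eq_edgeDart d with h' | h'
  · rw [h']; exact h
  · rw [h', SimpleGraph.Dart.symm_symm]; exact h.symm

lemma baseGraph_inc_of_dart (d : G.Dart) :
    (baseGraph G).Inc ⟨d.edge, d.edge_mem⟩ d.fst := by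
  rcases eq_edgeDart d with h | h
  · exact Or.inl (congrArg (fun d : G.Dart => d.fst) h).symm
  · exact Or.inr (congrArg (fun d : G.Dart => d.fst) h).symm

lemma RotationSystem.star_conn (x : V) (Φ : Finset rs.Face)
    (h1 : ∃ e f, (baseGraph G).Inc e x ∧ rs.dual.Inc e f ∧ f ∈ Φ)
    (h2 : ∃ e f, (baseGraph G).Inc e x ∧ rs.dual.Inc e f ∧ f ∉ Φ) :
    ∃ e, (baseGraph G).Inc e x ∧ e ∈ rs.dual.cut Φ := by
  by_contra hcon
  push Not at hcon
  have hiff : ∀ d : G.Dart, d.fst = x → (rs.face d ∈ Φ ↔ rs.face d.symm ∈ Φ) := by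
    rintro d rfl
    exact rs.face_mem_iff (hcon _ (baseGraph_inc_of_dart d))
  obtain ⟨e, f, he, hf, hfΦ⟩ := h1
  obtain ⟨e', f', he', hf', hfΦ'⟩ := h2
  obtain ⟨d, -, hd, hdf⟩ := rs.exists_dart_of_inc he hf
  obtain ⟨d', -, hd', hdf'⟩ := rs.exists_dart_of_inc he' hf'
  have hdΦ : rs.face d ∈ Φ := by
    rcases hdf with rfl | rfl
    · exact hfΦ
    · exact (hiff d hd).2 hfΦ
  have hdΦ' : rs.face d' ∉ Φ := by
    rcases hdf' with rfl | rfl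
    · exact hfΦ'
    · exact fun h => hfΦ' ((hiff d' hd').1 h)
  refine hdΦ' (rs.rot_induction (P := fun d => rs.face d ∈ Φ) (hd.trans hd'.symm) hdΦ ?_)
  intro a ha h
  rw [rs.face_rot]
  exact (hiff a (ha.trans hd)).1 h

lemma delta_eq_zero_apply {V E : Type} [Fintype V] [Fintype E] {M : MGraph V E} {y : V → ZMod 2}
    (h : M.delta y = 0) (e : E) :
    y (M.src e) = y (M.dst e) := by
  have := congrFun h e
  rw [delta_apply] at this
  exact CharTwo.add_eq_zero.1 this

lemma finrank_ker_delta_baseGraph :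
    Module.finrank (ZMod 2) (LinearMap.ker (baseGraph G).delta) ≤
      Nat.card G.ConnectedComponent := by
  let φ : LinearMap.ker (baseGraph G).delta →ₗ[ZMod 2] (G.ConnectedComponent → ZMod 2) :=
    { toFun := fun y C => y.1 (Quot.out C)
      map_add' := fun _ _ => rfl
      map_smul' := fun _ _ => rfl }
  have hφ : Function.Injective φ := by
    rw [← LinearMap.ker_eq_bot, LinearMap.ker_eq_bot']
    intro y hy
    have hadj : ∀ d : G.Dart, y.1 d.fst = y.1 d.snd := by
      intro d
      have := delta_eq_zero_apply (LinearMap.mem_ker.1 y.2) ⟨d.edge, d.edge_mem⟩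
      rcases eq_edgeDart d with h | h
      · rw [h]; exact this
      · rw [h]; exact this.symm
    have hwalk : ∀ u v, G.Walk u v → y.1 u = y.1 v := by
      intro u v p
      induction p with
      | nil => rfl
      | @cons u u' v h p ih => exact (hadj ⟨(u, u'), h⟩).trans ih
    refine Subtype.ext (funext fun v => ?_)
    obtain ⟨p⟩ : G.Reachable (Quot.out (G.connectedComponentMk v)) v :=
      SimpleGraph.ConnectedComponent.exact (Quot.out_eq _)
    rw [← hwalk _ _ p]
    exact congrFun hy _
  have := LinearMap.finrank_le_finrank_of_injective hφ
  rwa [Module.finrank_fintype_fun_eq_card, ← Nat.card_eq_fintype_card] at this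

lemma RotationSystem.finrank_ker_delta_dual :
    Module.finrank (ZMod 2) (LinearMap.ker rs.dual.delta) ≤ Nat.card G.ConnectedComponent := by
  let φ : LinearMap.ker rs.dual.delta →ₗ[ZMod 2] (G.ConnectedComponent → ZMod 2) :=
    { toFun := fun y C => if h : ∃ d : G.Dart, G.connectedComponentMk d.fst = C then
        y.1 (rs.face h.choose) else 0
      map_add' := fun y z => by
        ext C
        by_cases h : ∃ d : G.Dart, G.connectedComponentMk d.fst = C <;> simp [h]
      map_smul' := fun a y => by
        ext C
        by_cases h : ∃ d : G.Dart, G.connectedComponentMk d.fst = C <;> simp [h] }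
  have hφ : Function.Injective φ := by
    rw [← LinearMap.ker_eq_bot, LinearMap.ker_eq_bot']
    intro y hy
    have hsymm : ∀ d : G.Dart, y.1 (rs.face d) = y.1 (rs.face d.symm) := by
      intro d
      have := delta_eq_zero_apply (LinearMap.mem_ker.1 y.2) ⟨d.edge, d.edge_mem⟩
      rcases eq_edgeDart d with h | h
      · rw [h]; exact this
      · rw [h, SimpleGraph.Dart.symm_symm]; exact this.symm
    have hvert : ∀ d d' : G.Dart, d.fst = d'.fst → y.1 (rs.face d) = y.1 (rs.face d') := by
      intro d d' h
      refine rs.rot_induction (P := fun a => y.1 (rs.face d) = y.1 (rs.face a)) h rfl ?_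
      intro a _ ha
      rw [rs.face_rot, ha, hsymm]
    have hwalk : ∀ u v, G.Walk u v → ∀ d d' : G.Dart, d.fst = u → d'.fst = v →
        y.1 (rs.face d) = y.1 (rs.face d') := by
      intro u v p
      induction p with
      | nil => exact fun d d' h h' => hvert d d' (h.trans h'.symm)
      | @cons u u' v h p ih =>
        intro d d' hd hd'
        rw [hvert d ⟨(u, u'), h⟩ hd, hsymm]
        exact ih _ d' rfl hd'
    refine Subtype.ext (funext fun f => ?_)
    obtain ⟨d, rfl⟩ := Quotient.exists_rep f
    have hex : ∃ d' : G.Dart, G.connectedComponentMk d'.fst = G.connectedComponentMk d.fst :=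
      ⟨d, rfl⟩
    have h1 : y.1 (rs.face hex.choose) = 0 := by
      have := congrFun hy (G.connectedComponentMk d.fst)
      simpa only [φ, LinearMap.coe_mk, AddHom.coe_mk, dif_pos hex, Pi.zero_apply] using this
    obtain ⟨p⟩ := SimpleGraph.ConnectedComponent.exact hex.choose_spec
    rw [hwalk _ _ p hex.choose d rfl rfl] at h1
    exact h1
  have := LinearMap.finrank_le_finrank_of_injective hφ
  rwa [Module.finrank_fintype_fun_eq_card, ← Nat.card_eq_fintype_card] at this

/-- A graph of genus at most `g` has a dual with even cuts and connected stars, whose even sets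
exceed the cuts by at most `2 g` dimensions. -/
theorem genusLE.exists_dual {g : ℕ} (hg : genusLE G g) :
    ∃ (F : Type) (_ : Fintype F) (H : MGraph F G.edgeSet),
      (∀ U, H.IsEven ((baseGraph G).cut U)) ∧
      (∀ (x : V) (Φ : Finset F), (∃ e f, (baseGraph G).Inc e x ∧ H.Inc e f ∧ f ∈ Φ) →
        (∃ e f, (baseGraph G).Inc e x ∧ H.Inc e f ∧ f ∉ Φ) →
        ∃ e, (baseGraph G).Inc e x ∧ e ∈ H.cut Φ) ∧
      Module.finrank (ZMod 2) H.cycleSpace ≤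
        Module.finrank (ZMod 2) (LinearMap.range (baseGraph G).delta) + 2 * g := by
  obtain ⟨rs, hrs⟩ := hg
  refine ⟨rs.Face, inferInstance, rs.dual, rs.isEven_cut, rs.star_conn, ?_⟩
  have h1 := finrank_cycleSpace rs.dual
  have h2 := finrank_range_delta (baseGraph G)
  have h3 := finrank_ker_delta_baseGraph (G := G)
  have h4 := rs.finrank_ker_delta_dual
  have h5 : rs.numFaces = Fintype.card rs.Face := Nat.card_eq_fintype_card
  have h6 : G.edgeSet.ncard = Fintype.card G.edgeSet := by
    rw [← Nat.card_coe_set_eq, Nat.card_eq_fintype_card]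
  rw [h5, h6, Nat.card_eq_fintype_card (α := V)] at hrs
  omega

end embedding

namespace MGraph

section linking
open scoped Classical

variable {V E F ι : Type} [Fintype V] [Fintype E] [Fintype F]
variable {G : MGraph V E} {H : MGraph F E} {w t : ℕ} {Small : Finset V → Prop}

lemma card_filter_le_one {κ : Type} {S : Finset κ} {L : κ → Finset E}
    (hL : ∀ i ∈ S, ∀ j ∈ S, i ≠ j → Disjoint (L i) (L j)) (e : E) :
    (S.filter fun i => e ∈ L i).card ≤ 1 := by
  rw [card_le_one]
  intro i hi j hj
  rw [mem_filter] at hi hj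
  by_contra hij
  exact disjoint_left.1 (hL i hi.1 j hj.1 hij) hi.2 hj.2

/-- A vertex linked to `Y₁` and to `Y₂` is linked to a set `N` meeting every exit of a set
`U ⊇ Y₂` and containing `Y₁ ∩ U`. -/
lemma exists_mem_of_links {a : V} {K K₁ K₂ : Finset E} {Y₁ Y₂ N U : Finset V}
    (h₁ : ∀ W : Finset V, a ∈ W → Disjoint K₁ (G.cut W) → ∃ r ∈ Y₁, r ∈ W)
    (h₂ : ∀ W : Finset V, a ∈ W → Disjoint K₂ (G.cut W) → ∃ r ∈ Y₂, r ∈ W)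
    (hK₁ : K₁ ⊆ K) (hK₂ : K₂ ⊆ K) (hY₂ : Y₂ ⊆ U) (hY₁ : ∀ x ∈ Y₁, x ∈ U → x ∈ N)
    (hN : ∀ e ∈ G.cut U, ∀ x, G.Inc e x → x ∈ U → x ∈ N) {W : Finset V} (ha : a ∈ W)
    (hW : Disjoint K (G.cut W)) : ∃ x ∈ N, x ∈ W := by
  have hexit : ∀ e, e ∈ K → e ∈ G.cut (W ∩ U) ∨ e ∈ G.cut (W \ U) → ∃ x ∈ N, x ∈ W := by
    intro e he h
    have h1 := disjoint_left.1 hW he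
    simp only [mem_cut, mem_inter, mem_sdiff, not_not] at h h1
    have h2 : e ∈ G.cut U := by rw [mem_cut]; tauto
    have h3 : G.src e ∈ W := by tauto
    by_cases h4 : G.src e ∈ U
    · exact ⟨_, hN e h2 _ (Or.inl rfl) h4, h3⟩
    · have h5 : G.dst e ∈ U := by rw [mem_cut] at h2; tauto
      exact ⟨_, hN e h2 _ (Or.inr rfl) h5, h1.1 h3⟩
  by_cases haU : a ∈ U
  · by_cases hd : Disjoint K₁ (G.cut (W ∩ U))
    · obtain ⟨r, hr, hrW⟩ := h₁ _ (mem_inter.2 ⟨ha, haU⟩) hd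
      rw [mem_inter] at hrW
      exact ⟨r, hY₁ r hr hrW.2, hrW.1⟩
    · obtain ⟨e, he, he'⟩ := not_disjoint_iff.1 hd
      exact hexit e (hK₁ he) (Or.inl he')
  · by_cases hd : Disjoint K₂ (G.cut (W \ U))
    · obtain ⟨r, hr, hrW⟩ := h₂ _ (mem_sdiff.2 ⟨ha, haU⟩) hd
      exact absurd (hY₂ hr) (mem_sdiff.1 hrW).2
    · obtain ⟨e, he, he'⟩ := not_disjoint_iff.1 hd
      exact hexit e (hK₂ he) (Or.inr he')

lemma IsSmallness.exists_links_of_not_engulfed (hS : G.IsSmallness w Small) (htw : t ≤ w)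
    {Y : Finset V} (hY : ¬ G.Engulfed Small t Y) {A : Finset ι} {pos : ι → V} {k : ℕ}
    (hA : A.card ≤ t)
    (h : ∀ U, Small U → (tokens pos A U).card ≤ (G.cut U).card + k) :
    ∃ A' ⊆ A, A.card ≤ A'.card + k ∧
      ∃ L : ι → Finset E, (∀ i ∈ A', ∀ j ∈ A', i ≠ j → Disjoint (L i) (L j)) ∧
      ∀ i ∈ A', ∀ U : Finset V, pos i ∈ U → Disjoint (L i) (G.cut U) → ∃ r ∈ Y, r ∈ U := by
  refine exists_disjoint_links G Y A pos k fun U hU => ?_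
  by_cases hc : (G.cut U).card < t
  · rcases hS.dich U (by omega) with h1 | h1
    · exact h U h1
    · refine absurd ⟨Uᶜ, fun y hy => ?_, h1, by rwa [cut_compl]⟩ hY
      exact mem_compl.2 (disjoint_right.1 hU hy)
  · have : (tokens pos A U).card ≤ A.card := card_filter_le _ _
    omega

/-- Pairs whose ends are well linked to the large side can mostly be routed with congestion 3. -/
lemma exists_routing_of_tokens (hS : G.IsSmallness w Small) (hD : G.IsDualPair H w) (hG : G.Conn)
    (ht : 0 < t) (htw : 10 * t ≤ w) (e₀ : E) {J : Finset ι} {pos : ι × Bool → V} {k : ℕ}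
    (hJ : 2 * J.card ≤ t)
    (h : ∀ U, Small U → (tokens pos (J ×ˢ univ) U).card ≤ (G.cut U).card + k) :
    ∃ S ⊆ J, J.card ≤ S.card + 2 * k ∧ ∃ K : ι → Finset E,
      (∀ d ∈ S, G.Connects (K d) {pos (d, true), pos (d, false)}) ∧
      ∀ e, (S.filter fun d => e ∈ K d).card ≤ 3 := by
  obtain ⟨Y₁, Y₂, hY₁, hY₂, Q, N, U, hQ, hQN⟩ := exists_frame hS hD hG ht htw e₀
  have hcard : (J ×ˢ (univ : Finset Bool)).card ≤ t := by
    rw [card_product, card_univ, Fintype.card_bool]; omega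
  obtain ⟨A₁, hA₁, hA₁c, L₁, hL₁, hL₁Y⟩ :=
    hS.exists_links_of_not_engulfed (by omega) hY₁ hcard h
  obtain ⟨A₂, hA₂, hA₂c, L₂, hL₂, hL₂Y⟩ :=
    hS.exists_links_of_not_engulfed (by omega) hY₂ hcard h
  let S : Finset ι := J.filter fun d => ∀ b, (d, b) ∈ A₁ ∧ (d, b) ∈ A₂
  have hSJ : S ⊆ J := filter_subset _ _
  have hSc : J.card ≤ S.card + 2 * k := by
    have h1 : J \ S ⊆ (((J ×ˢ univ) \ A₁) ∪ ((J ×ˢ univ) \ A₂)).image Prod.fst := by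
      intro d hd
      simp only [S, mem_sdiff, mem_filter, not_and, not_forall] at hd
      obtain ⟨b, hb⟩ := hd.2 hd.1
      refine mem_image.2 ⟨(d, b), ?_, rfl⟩
      simp only [mem_union, mem_sdiff, mem_product, mem_univ, hd.1, true_and, and_true]
      tauto
    have h2 := (card_le_card h1).trans (card_image_le.trans (card_union_le _ _))
    rw [card_sdiff_of_subset hSJ, card_sdiff_of_subset hA₁, card_sdiff_of_subset hA₂] at h2
    omega
  obtain ⟨f, hf, hft⟩ : ∃ f : ι → ℕ, (∀ d ∈ S, ∀ d' ∈ S, d ≠ d' → f d ≠ f d') ∧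
      ∀ d ∈ S, f d < t := by
    refine ⟨fun d => if hd : d ∈ S then (S.equivFin ⟨d, hd⟩).1 else 0, ?_, ?_⟩
    · intro d hd d' hd' hne heq
      simp only [hd, hd', dif_pos] at heq
      have := S.equivFin.injective (Fin.ext heq)
      exact hne (congrArg Subtype.val this)
    · intro d hd
      simp only [hd, dif_pos]
      have := (S.equivFin ⟨d, hd⟩).2
      have := card_le_card hSJ
      omega
  have hS' : ∀ d ∈ S, ∀ b, (d, b) ∈ A₁ ∧ (d, b) ∈ A₂ := fun d hd => (mem_filter.1 hd).2
  let K : ι → Finset E := fun d => (L₁ (d, true) ∪ L₁ (d, false)) ∪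
    (L₂ (d, true) ∪ L₂ (d, false)) ∪ Q (f d)
  refine ⟨S, hSJ, hSc, K, ?_, ?_⟩
  · intro d hd
    obtain ⟨hN, hY₂U, hY₁N, hcut⟩ := hQN (f d) (hft d hd)
    have hreach : ∀ b (W : Finset V), pos (d, b) ∈ W → Disjoint (K d) (G.cut W) →
        ∃ x ∈ N (f d), x ∈ W := by
      intro b W hb hW
      refine exists_mem_of_links (hL₁Y _ (hS' d hd b).1) (hL₂Y _ (hS' d hd b).2) ?_ ?_ hY₂U hY₁N
        hcut hb hW
      · intro e he
        cases b <;> simp [K, he]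
      · intro e he
        cases b <;> simp [K, he]
    have hiff : ∀ b b' (W : Finset V), Disjoint (K d) (G.cut W) → pos (d, b) ∈ W →
        pos (d, b') ∈ W := by
      intro b b' W hW hb
      by_contra hb'
      obtain ⟨x, hx, hxW⟩ := hreach b W hb hW
      obtain ⟨y, hy, hyW⟩ := hreach b' Wᶜ (mem_compl.2 hb') (by rwa [cut_compl])
      have hQW : Disjoint (Q (f d)) (G.cut W) := hW.mono_left subset_union_right
      exact mem_compl.1 hyW ((hN.iff hQW hx hy).1 hxW)
    refine connects_of_iff fun W hW x hx y hy hxW => ?_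
    simp only [mem_insert, mem_singleton] at hx hy
    rcases hx with rfl | rfl <;> rcases hy with rfl | rfl <;> exact hiff _ _ W hW hxW
  · intro e
    have hlink : ∀ (A : Finset (ι × Bool)) (L : ι × Bool → Finset E),
        (∀ i ∈ A, ∀ j ∈ A, i ≠ j → Disjoint (L i) (L j)) → (∀ d ∈ S, ∀ b, (d, b) ∈ A) →
        (S.filter fun d => e ∈ L (d, true) ∪ L (d, false)).card ≤ 1 := by
      intro A L hL hA
      refine card_filter_le_one (L := fun d => L (d, true) ∪ L (d, false)) ?_ e
      intro d hd d' hd' hne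
      have hb : ∀ b b', Disjoint (L (d, b)) (L (d', b')) := fun b b' =>
        hL _ (hA d hd b) _ (hA d' hd' b') fun h => hne (congrArg Prod.fst h)
      simp only [disjoint_union_left, disjoint_union_right, hb, and_self]
    have h1 := hlink A₁ L₁ hL₁ fun d hd b => (hS' d hd b).1
    have h2 := hlink A₂ L₂ hL₂ fun d hd b => (hS' d hd b).2
    have h3 : (S.filter fun d => e ∈ Q (f d)).card ≤ 1 :=
      card_filter_le_one (L := fun d => Q (f d))
        (fun d hd d' hd' hne => hQ _ (hft d hd) _ (hft d' hd') (hf d hd d' hd' hne)) e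
    have h4 : (S.filter fun d => e ∈ K d) ⊆
        ((S.filter fun d => e ∈ L₁ (d, true) ∪ L₁ (d, false)) ∪
        (S.filter fun d => e ∈ L₂ (d, true) ∪ L₂ (d, false))) ∪
        (S.filter fun d => e ∈ Q (f d)) := by
      intro d
      simp only [K, mem_filter, mem_union]
      tauto
    have h5 := (card_le_card h4).trans (card_union_le _ _)
    have h6 := card_union_le (S.filter fun d => e ∈ L₁ (d, true) ∪ L₁ (d, false))
      (S.filter fun d => e ∈ L₂ (d, true) ∪ L₂ (d, false))
    omega

end linking
end MGraph

namespace MGraph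

section selection
open scoped Classical

variable {V E F ι κ : Type} [Fintype V] [Fintype E] [Fintype F] [Fintype ι]
variable {G : MGraph V E} {H : MGraph F E} {w t : ℕ}

/-- The weight of a vertex: the total weight of the pairs having it as an end. -/
noncomputable def wt (pos : ι × Bool → V) (q : ι → ℝ) (v : V) : ℝ :=
  ∑ x : ι × Bool, if pos x = v then q x.1 else 0

lemma sum_wt (pos : ι × Bool → V) (q : ι → ℝ) (U : Finset V) :
    ∑ v ∈ U, wt pos q v = ∑ x : ι × Bool, if pos x ∈ U then q x.1 else 0 := by
  unfold wt
  rw [sum_comm]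
  refine sum_congr rfl fun x _ => ?_
  rw [sum_ite_eq]

lemma sum_wt_univ (pos : ι × Bool → V) (q : ι → ℝ) :
    ∑ v, wt pos q v = 2 * ∑ d, q d := by
  rw [sum_wt, Fintype.sum_prod_type, mul_sum]
  refine sum_congr rfl fun d _ => ?_
  simp [two_mul]

lemma wt_nonneg {pos : ι × Bool → V} {q : ι → ℝ} (hq : ∀ d, 0 ≤ q d) (v : V) :
    0 ≤ wt pos q v :=
  sum_nonneg fun x _ => by split_ifs; exacts [hq _, le_rfl]

lemma wt_pos {pos : ι × Bool → V} (hpos : Function.Injective pos) (q : ι → ℝ) (x : ι × Bool) :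
    wt pos q (pos x) = q x.1 := by
  unfold wt
  simp [hpos.eq_iff]

lemma wt_le_one {pos : ι × Bool → V} (hpos : Function.Injective pos) {q : ι → ℝ}
    (hq : ∀ d, q d ≤ 1) (v : V) : wt pos q v ≤ 1 := by
  by_cases hv : ∃ x, pos x = v
  · obtain ⟨x, rfl⟩ := hv
    rw [wt_pos hpos]; exact hq _
  · have : wt pos q v = 0 := sum_eq_zero fun x _ => if_neg fun h => hv ⟨x, h⟩
    rw [this]; exact zero_le_one

/-- The number of tokens, in disjoint connected clusters of weight at least `64`, that lie in a set
`U` is at most `9/8` of the size of its cut. -/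
lemma card_tokens_le {A : Finset κ} {K : κ → Finset E} {X : κ → Finset V} {pos : κ → V}
    {p : V → ℝ} (hp : ∀ v, 0 ≤ p v)
    (hK : ∀ i ∈ A, ∀ j ∈ A, i ≠ j → Disjoint (K i) (K j))
    (hX : ∀ i ∈ A, ∀ j ∈ A, i ≠ j → Disjoint (X i) (X j))
    (hKX : ∀ i ∈ A, G.Connects (K i) (X i)) (hpos : ∀ i ∈ A, pos i ∈ X i)
    (hw : ∀ i ∈ A, 64 ≤ ∑ v ∈ X i, p v) {U : Finset V}
    (hU : ∑ v ∈ U, p v ≤ 8 * (G.cut U).card) :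
    8 * (tokens pos A U).card ≤ 9 * (G.cut U).card := by
  let T₁ := A.filter fun i => ¬ Disjoint (K i) (G.cut U)
  let T₂ := A.filter fun i => X i ⊆ U
  have h1 : T₁.card ≤ (G.cut U).card := by
    have hd : (T₁ : Set κ).PairwiseDisjoint fun i => K i ∩ G.cut U := fun i hi j hj hij =>
      (hK i (mem_filter.1 hi).1 j (mem_filter.1 hj).1 hij).mono inter_subset_left inter_subset_left
    calc T₁.card = ∑ _i ∈ T₁, 1 := by simp
      _ ≤ ∑ i ∈ T₁, (K i ∩ G.cut U).card := sum_le_sum fun i hi => by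
          rw [Nat.one_le_iff_ne_zero, Ne, card_eq_zero, ← disjoint_iff_inter_eq_empty]
          exact (mem_filter.1 hi).2
      _ = (T₁.biUnion fun i => K i ∩ G.cut U).card := (card_biUnion hd).symm
      _ ≤ (G.cut U).card := card_le_card (biUnion_subset.2 fun i _ => inter_subset_right)
  have h2 : (64 : ℝ) * T₂.card ≤ 8 * (G.cut U).card := by
    have hd : (T₂ : Set κ).PairwiseDisjoint X := fun i hi j hj hij =>
      hX i (mem_filter.1 hi).1 j (mem_filter.1 hj).1 hij
    calc (64 : ℝ) * T₂.card = ∑ _i ∈ T₂, (64 : ℝ) := by simp [mul_comm]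
      _ ≤ ∑ i ∈ T₂, ∑ v ∈ X i, p v := sum_le_sum fun i hi => hw i (mem_filter.1 hi).1
      _ = ∑ v ∈ T₂.biUnion X, p v := (sum_biUnion hd).symm
      _ ≤ ∑ v ∈ U, p v := sum_le_sum_of_subset_of_nonneg
          (biUnion_subset.2 fun i hi => (mem_filter.1 hi).2) fun v _ _ => hp v
      _ ≤ _ := hU
  have h2' : 8 * T₂.card ≤ (G.cut U).card := by
    have : (8 : ℝ) * T₂.card ≤ (G.cut U).card := by linarith
    exact_mod_cast this
  have h3 : tokens pos A U ⊆ T₁ ∪ T₂ := by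
    intro i hi
    rw [tokens, mem_filter] at hi
    rw [mem_union, mem_filter, mem_filter]
    by_cases hd : Disjoint (K i) (G.cut U)
    · refine Or.inr ⟨hi.1, ?_⟩
      rcases hKX i hi.1 U hd with h | h
      · exact h
      · exact absurd hi.2 (disjoint_left.1 h (hpos i hi.1))
    · exact Or.inl ⟨hi.1, hd⟩
  have := (card_le_card h3).trans (card_union_le _ _)
  omega

/-- From weighted pairs of clusters of weight at most `b` each, one can select many pairs using
disjoint sets of clusters. -/
lemma exists_disjoint_pairs {B : Type} (cl : ι × Bool → B) (q : ι → ℝ) (good : Finset ι)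
    (hq : ∀ d, 0 ≤ q d) {b : ℝ} (hb0 : 0 ≤ b)
    (hb : ∀ c : B, ∑ x : ι × Bool, (if cl x = c then q x.1 else 0) ≤ b) :
    ∃ I ⊆ good, (∀ d ∈ I, ∀ d' ∈ I, d ≠ d' → ∀ i i', cl (d, i) ≠ cl (d', i')) ∧
      ∑ d ∈ good, q d ≤ 2 * b * I.card := by
  let ok : Finset ι → Prop := fun I =>
    ∀ d ∈ I, ∀ d' ∈ I, d ≠ d' → ∀ i i', cl (d, i) ≠ cl (d', i')
  obtain ⟨I, hI, hmax⟩ := (good.powerset.filter ok).exists_max_image card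
    ⟨∅, by simp [ok]⟩
  rw [mem_filter, mem_powerset] at hI
  refine ⟨I, hI.1, hI.2, ?_⟩
  let C : Finset B := (I ×ˢ (univ : Finset Bool)).image cl
  have hC : (C.card : ℝ) ≤ 2 * I.card := by
    have : C.card ≤ I.card * 2 := card_image_le.trans (by rw [card_product]; simp)
    have : (C.card : ℝ) ≤ ((I.card * 2 : ℕ) : ℝ) := by exact_mod_cast this
    push_cast at this
    linarith
  have hhit : ∀ d ∈ good, ∃ i, cl (d, i) ∈ C := by
    intro d hd
    by_contra hcon
    push Not at hcon
    have hdI : d ∉ I := fun h =>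
      hcon true (mem_image_of_mem _ (mem_product.2 ⟨h, mem_univ _⟩))
    have hC' : ∀ d' ∈ I, ∀ i i', cl (d, i) ≠ cl (d', i') := fun d' hd' i i' h =>
      hcon i (h ▸ mem_image_of_mem _ (mem_product.2 ⟨hd', mem_univ _⟩))
    have := hmax (insert d I) (mem_filter.2 ⟨mem_powerset.2 (insert_subset hd hI.1), by
      intro a ha a' ha' hne i i'
      rw [mem_insert] at ha ha'
      rcases ha with rfl | ha <;> rcases ha' with rfl | ha'
      · exact absurd rfl hne
      · exact hC' a' ha' i i'
      · exact (hC' a ha i' i).symm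
      · exact hI.2 a ha a' ha' hne i i'⟩)
    rw [card_insert_of_notMem hdI] at this
    omega
  calc ∑ d ∈ good, q d ≤ ∑ d ∈ good, ∑ i : Bool, if cl (d, i) ∈ C then q d else 0 := by
        refine sum_le_sum fun d hd => ?_
        obtain ⟨i, hi⟩ := hhit d hd
        refine le_trans ?_ (single_le_sum (f := fun i => if cl (d, i) ∈ C then q d else 0)
          (fun j _ => by split_ifs; exacts [hq d, le_rfl]) (mem_univ i))
        simp [hi]
    _ ≤ ∑ d, ∑ i : Bool, if cl (d, i) ∈ C then q d else 0 :=
        sum_le_sum_of_subset_of_nonneg (subset_univ _) fun d _ _ =>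
          sum_nonneg fun i _ => by split_ifs; exacts [hq d, le_rfl]
    _ = ∑ x : ι × Bool, if cl x ∈ C then q x.1 else 0 := by rw [Fintype.sum_prod_type]
    _ = ∑ c ∈ C, ∑ x : ι × Bool, if cl x = c then q x.1 else 0 := by
        rw [sum_comm]
        exact sum_congr rfl fun x _ => by rw [sum_ite_eq]
    _ ≤ ∑ c ∈ C, b := sum_le_sum fun c _ => hb c
    _ = C.card * b := by simp
    _ ≤ 2 * I.card * b := mul_le_mul_of_nonneg_right hC hb0
    _ = 2 * b * I.card := by ring

/-- Edge-linked weighted pairs in a connected graph with a dual can be routed with congestion 3. -/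
theorem exists_routing_of_linked (hD : G.IsDualPair H w) (hG : G.Conn) (ht : 2 ≤ t)
    (htw : 10 * t ≤ w) {pos : ι × Bool → V} (hpos : Function.Injective pos) {q : ι → ℝ}
    (hq : ∀ d, 0 ≤ q d) (hq1 : ∀ d, q d ≤ 1) {P : ℝ} (htP : 3000 * (t : ℝ) ≤ P)
    (hP : 23 / 25 * P ≤ ∑ v, wt pos q v)
    (hcut : ∀ U : Finset V, ∑ v ∈ U, wt pos q v ≤ P / 8 →
      ∑ v ∈ U, wt pos q v ≤ 8 * (G.cut U).card)
    (hdich : ∀ U : Finset V, (G.cut U).card < w →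
      ∑ v ∈ U, wt pos q v ≤ P / 8 ∨ ∑ v ∈ Uᶜ, wt pos q v ≤ P / 8) :
    ∃ S : Finset ι, t ≤ 6 * S.card ∧ ∃ K : ι → Finset E,
      (∀ d ∈ S, G.Connects (K d) {pos (d, true), pos (d, false)}) ∧
      ∀ e, (S.filter fun d => e ∈ K d).card ≤ 3 := by
  set p : V → ℝ := wt pos q with hp
  have hp0 : ∀ v, 0 ≤ p v := wt_nonneg hq
  have hp1 : ∀ v, p v ≤ 1 := wt_le_one hpos hq1
  have htR : (2 : ℝ) ≤ t := by exact_mod_cast ht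
  have hS : G.IsSmallness w fun U => ∑ v ∈ U, p v ≤ P / 8 := by
    refine ⟨fun U W hUW hW => (sum_le_sum_of_subset_of_nonneg hUW fun v _ _ => hp0 v).trans hW,
      hdich, fun U W Z hU hW hZ hcov => ?_⟩
    have h1 : ∑ v ∈ U ∪ W ∪ Z, p v ≤ ∑ v ∈ U, p v + ∑ v ∈ W, p v + ∑ v ∈ Z, p v := by
      have h2 := sum_union_inter (s₁ := U ∪ W) (s₂ := Z) (f := p)
      have h3 := sum_union_inter (s₁ := U) (s₂ := W) (f := p)
      have h4 : 0 ≤ ∑ v ∈ (U ∪ W) ∩ Z, p v := sum_nonneg fun v _ => hp0 v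
      have h5 : 0 ≤ ∑ v ∈ U ∩ W, p v := sum_nonneg fun v _ => hp0 v
      linarith
    rw [hcov] at h1
    linarith
  obtain ⟨x₀⟩ : Nonempty V := by
    by_contra hV
    rw [not_nonempty_iff] at hV
    simp only [univ_eq_empty, sum_empty] at hP
    linarith
  obtain ⟨e₀⟩ : Nonempty E := by
    by_contra hE
    rw [not_nonempty_iff] at hE
    have h0 : ∀ v, p v = 0 := by
      intro v
      have h1 := hcut {v} (by rw [sum_singleton]; linarith [hp1 v])
      rw [sum_singleton, card_eq_zero.2 (Finset.eq_empty_of_isEmpty _)] at h1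
      have := hp0 v
      push_cast at h1
      linarith
    simp only [h0, sum_const_zero] at hP
    linarith
  obtain ⟨r, K, X, hC⟩ := hG.exists_clusters x₀ (W := 64) (p := p) (by norm_num)
    (fun v => (hp1 v).trans_lt (by norm_num))
  choose c hc using hC.covers
  have hcX : ∀ x v, x ∈ X v ↔ c x = v := by
    intro x v
    constructor
    · intro h
      by_contra hne
      exact disjoint_left.1 (hC.disjX _ _ hne) (hc x) h
    · rintro rfl; exact hc x
  have hroot : ∑ x ∈ X r, p x < 64 := (hC.active r (mem_singleton_self r)).2
  have hclus : ∀ x, c x ≠ r → G.Connects (K (c x)) (X (c x)) ∧ 64 ≤ ∑ v ∈ X (c x), p v := by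
    intro x hx
    obtain ⟨h1, h2⟩ := hC.emitted (c x) (by simpa using hx)
    refine ⟨h1, ?_⟩
    rcases h2 with h2 | h2
    · have := hc x; rw [h2] at this; exact absurd this (notMem_empty _)
    · exact h2.1
  have hupper : ∀ v, ∑ x ∈ X v, p x ≤ 128 := by
    intro v
    by_cases hv : v = r
    · subst hv; linarith
    · rcases (hC.emitted v (by simpa using hv)).2 with h | h
      · rw [h]; simp
      · linarith [h.2]
  have hmass : ∀ v, ∑ x : ι × Bool, (if c (pos x) = v then q x.1 else 0) = ∑ x ∈ X v, p x := by
    intro v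
    rw [hp, sum_wt]
    refine sum_congr rfl fun x _ => ?_
    simp only [hcX]
  let good : Finset ι := univ.filter fun d => ∀ b, c (pos (d, b)) ≠ r
  obtain ⟨I, hIg, hI, hIw⟩ := exists_disjoint_pairs (fun x => c (pos x)) q good hq
    (b := 128) (by norm_num) fun v => (hmass v).trans_le (hupper v)
  have hgood : ∑ d, q d - 64 ≤ ∑ d ∈ good, q d := by
    have h1 : ∑ d ∈ univ.filter (fun d => ¬ ∀ b, c (pos (d, b)) ≠ r), q d ≤ ∑ x ∈ X r, p x := by
      rw [← hmass r, Fintype.sum_prod_type, sum_filter]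
      refine sum_le_sum fun d _ => ?_
      by_cases h : ∀ b, c (pos (d, b)) ≠ r
      · rw [if_neg (not_not.2 h)]
        exact sum_nonneg fun i _ => by split_ifs; exacts [hq d, le_rfl]
      · rw [if_pos h]
        push Not at h
        obtain ⟨b, hb⟩ := h
        refine le_trans ?_ (single_le_sum (f := fun i => if c (pos (d, i)) = r then q d else 0)
          (fun j _ => by split_ifs; exacts [hq d, le_rfl]) (mem_univ b))
        simp [hb]
    have h2 := sum_filter_add_sum_filter_not univ (fun d => ∀ b, c (pos (d, b)) ≠ r) q
    linarith
  have hsum : ∑ v, p v = 2 * ∑ d, q d := sum_wt_univ pos q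
  have hIc : 2 * t ≤ I.card := by
    have : (2 * t : ℝ) ≤ I.card := by linarith
    exact_mod_cast this
  have hgd : ∀ d ∈ I, ∀ b, c (pos (d, b)) ≠ r := fun d hd => (mem_filter.1 (hIg hd)).2
  let I₁ := I.filter fun d => c (pos (d, true)) = c (pos (d, false))
  let I₂ := I.filter fun d => ¬ c (pos (d, true)) = c (pos (d, false))
  have hI12 : I₁.card + I₂.card = I.card := card_filter_add_card_filter_not _
  by_cases hI₁ : t ≤ I₁.card
  · refine ⟨I₁, by omega, fun d => K (c (pos (d, true))), ?_, ?_⟩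
    · intro d hd
      rw [mem_filter] at hd
      refine (hclus _ (hgd d hd.1 true)).1.mono subset_rfl ?_
      intro x hx
      rw [mem_insert, mem_singleton] at hx
      rcases hx with rfl | rfl
      · exact hc _
      · rw [hd.2]; exact hc _
    · intro e
      refine (card_filter_le_one (L := fun d => K (c (pos (d, true)))) ?_ e).trans (by norm_num)
      intro d hd d' hd' hne
      exact hC.disjK _ _ (hI d (mem_filter.1 hd).1 d' (mem_filter.1 hd').1 hne true true)
  · obtain ⟨J, hJ, hJc⟩ := exists_subset_card_eq (s := I₂) (n := t / 2) (by omega)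
    have hJI : ∀ d ∈ J, d ∈ I ∧ ¬ c (pos (d, true)) = c (pos (d, false)) :=
      fun d hd => mem_filter.1 (hJ hd)
    have hne : ∀ x ∈ J ×ˢ (univ : Finset Bool), ∀ y ∈ J ×ˢ (univ : Finset Bool), x ≠ y →
        c (pos x) ≠ c (pos y) := by
      rintro ⟨d, b⟩ hx ⟨d', b'⟩ hy hxy
      rw [mem_product] at hx hy
      by_cases hdd : d = d'
      · subst hdd
        have := (hJI d hx.1).2
        cases b <;> cases b'
        · exact absurd rfl hxy
        · exact fun h => this h.symm
        · exact this
        · exact absurd rfl hxy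
      · exact hI d (hJI d hx.1).1 d' (hJI d' hy.1).1 hdd b b'
    obtain ⟨S, -, hSc, L, hL, hLc⟩ := exists_routing_of_tokens hS hD hG (by omega) htw e₀ (J := J)
      (pos := pos) (k := 2 * (t / 2) / 9) (by omega) (by
        intro U hU
        have h1 := card_tokens_le (A := J ×ˢ (univ : Finset Bool)) (K := fun x => K (c (pos x)))
          (X := fun x => X (c (pos x))) (pos := pos) hp0
          (fun x hx y hy hxy => hC.disjK _ _ (hne x hx y hy hxy))
          (fun x hx y hy hxy => hC.disjX _ _ (hne x hx y hy hxy))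
          (fun x hx => (hclus _ (hgd _ (hJI x.1 (mem_product.1 hx).1).1 x.2)).1)
          (fun x _ => hc _)
          (fun x hx => (hclus _ (hgd _ (hJI x.1 (mem_product.1 hx).1).1 x.2)).2) (hcut U hU)
        have h2 : (tokens pos (J ×ˢ univ) U).card ≤ (J ×ˢ (univ : Finset Bool)).card :=
          card_filter_le _ _
        rw [card_product, card_univ, Fintype.card_bool] at h2
        omega)
    exact ⟨S, by omega, L, hL, hLc⟩

end selection
end MGraph

namespace MGraph

section reduction
open scoped Classical

variable {V E F ι : Type} [Fintype V] [Fintype E] [Fintype F] [Fintype ι]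
variable {G : MGraph V E} {H : MGraph F E} {w t : ℕ}

lemma sum_wt_le_of_filter {pos : ι × Bool → V} {q : ι → ℝ} (hq : ∀ d, 0 ≤ q d) (Y : Finset V) :
    ∑ d ∈ univ.filter (fun d => ¬ ∀ b, pos (d, b) ∉ Y), q d ≤ ∑ v ∈ Y, wt pos q v := by
  rw [sum_wt, Fintype.sum_prod_type, sum_filter]
  refine sum_le_sum fun d _ => ?_
  by_cases h : ∀ b, pos (d, b) ∉ Y
  · rw [if_neg (not_not.2 h)]
    exact sum_nonneg fun i _ => by split_ifs; exacts [hq d, le_rfl]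
  · rw [if_pos h]
    push Not at h
    obtain ⟨b, hb⟩ := h
    refine le_trans ?_ (single_le_sum (f := fun i => if pos (d, i) ∈ Y then q d else 0)
      (fun j _ => by split_ifs; exacts [hq d, le_rfl]) (mem_univ b))
    simp [hb]

/-- Weighted pairs that are linked up to a small additive error can be routed with congestion
3. -/
theorem exists_routing_of_nearly_linked (hD : G.IsDualPair H w) (hG : G.Conn) (ht : 2 ≤ t)
    (htw : w = 10 * t) {pos : ι × Bool → V} (hpos : Function.Injective pos) {q : ι → ℝ}
    (hq : ∀ d, 0 ≤ q d) (hq1 : ∀ d, q d ≤ 1) {P : ℝ} (htP : 3000 * (t : ℝ) ≤ P)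
    (hP : 24 / 25 * P ≤ ∑ v, wt pos q v) {a : ℝ}
    (ha : a ≤ P / 150)
    (hlink : ∀ U : Finset V, (∑ v ∈ U, wt pos q v) * ∑ v ∈ Uᶜ, wt pos q v ≤
      ((G.cut U).card + a) * P) :
    ∃ S : Finset ι, t ≤ 6 * S.card ∧ ∃ K : ι → Finset E,
      (∀ d ∈ S, G.Connects (K d) {pos (d, true), pos (d, false)}) ∧
      ∀ e, (S.filter fun d => e ∈ K d).card ≤ 3 := by
  set p : V → ℝ := wt pos q with hp
  have hp0 : ∀ v, 0 ≤ p v := wt_nonneg hq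
  have hm0 : ∀ U : Finset V, 0 ≤ ∑ v ∈ U, p v := fun U => sum_nonneg fun v _ => hp0 v
  have hmono : ∀ U W : Finset V, U ⊆ W → ∑ v ∈ U, p v ≤ ∑ v ∈ W, p v := fun U W h =>
    sum_le_sum_of_subset_of_nonneg h fun v _ _ => hp0 v
  have hcompl : ∀ U : Finset V, ∑ v ∈ U, p v + ∑ v ∈ Uᶜ, p v = ∑ v, p v := fun U =>
    sum_add_sum_compl U p
  have htR : (2 : ℝ) ≤ t := by exact_mod_cast ht
  have hPpos : 0 < P := by linarith
  obtain ⟨Y, hY, hmax⟩ := (univ.filter fun Y : Finset V =>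
      8 * ((G.cut Y).card : ℝ) ≤ ∑ v ∈ Y, p v ∧ ∑ v ∈ Y, p v ≤ P / 2).exists_max_image card
    ⟨∅, by simp; linarith⟩
  simp only [mem_filter, mem_univ, true_and] at hY hmax
  have hYs : ∑ v ∈ Y, p v ≤ P / 50 := by
    have h1 := hlink Y
    have h2 := hcompl Y
    have h3 : (∑ v ∈ Y, p v) * (23 / 50 * P) ≤ (∑ v ∈ Y, p v) * ∑ v ∈ Yᶜ, p v :=
      mul_le_mul_of_nonneg_left (by linarith [hY.2]) (hm0 Y)
    have h4 : (((G.cut Y).card : ℝ) + a) * P ≤ ((∑ v ∈ Y, p v) / 8 + P / 150) * P :=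
      mul_le_mul_of_nonneg_right (by linarith [hY.1]) hPpos.le
    have h5 : (∑ v ∈ Y, p v) * (23 / 50) * P ≤ ((∑ v ∈ Y, p v) / 8 + P / 150) * P := by
      linarith
    have h6 := le_of_mul_le_mul_right h5 hPpos
    linarith
  let q' : ι → ℝ := fun d => if ∀ b, pos (d, b) ∉ Y then q d else 0
  have hq'0 : ∀ d, 0 ≤ q' d := fun d => by
    simp only [q']; split_ifs; exacts [hq d, le_rfl]
  have hq'q : ∀ d, q' d ≤ q d := fun d => by
    simp only [q']; split_ifs; exacts [le_rfl, hq d]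
  have hp'p : ∀ v, wt pos q' v ≤ p v := fun v => sum_le_sum fun x _ => by
    split_ifs; exacts [hq'q _, le_rfl]
  have hp'Y : ∀ U : Finset V, ∑ v ∈ U, wt pos q' v ≤ ∑ v ∈ U \ Y, p v := by
    intro U
    rw [sum_wt, hp, sum_wt]
    refine sum_le_sum fun x _ => ?_
    by_cases hxU : pos x ∈ U
    · by_cases hxY : pos x ∈ Y
      · have : q' x.1 = 0 := if_neg fun h => h x.2 hxY
        simp [hxU, hxY, this]
      · simpa [hxU, hxY] using hq'q x.1
    · simp [hxU]
  have htot : ∑ v, p v - P / 25 ≤ ∑ v, wt pos q' v := by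
    have h1 : ∑ d, q' d = ∑ d ∈ univ.filter (fun d => ∀ b, pos (d, b) ∉ Y), q d := by
      rw [sum_filter]
    have h2 := sum_filter_add_sum_filter_not univ (fun d => ∀ b, pos (d, b) ∉ Y) q
    have h3 := sum_wt_le_of_filter (pos := pos) hq Y
    rw [hp] at hYs ⊢
    rw [sum_wt_univ, sum_wt_univ]
    linarith
  refine exists_routing_of_linked hD hG ht htw.ge hpos hq'0 (fun d => (hq'q d).trans (hq1 d)) htP
    (by linarith) ?_ ?_
  · intro U hU
    have h1 : ∑ v ∈ U, p v ≤ P / 2 - P / 50 := by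
      have h2 := sum_add_sum_compl U (wt pos q')
      have h3 := hcompl U
      have h4 : ∑ v ∈ Uᶜ, wt pos q' v ≤ ∑ v ∈ Uᶜ, p v := sum_le_sum fun v _ => hp'p v
      linarith
    have h2 : ∑ v ∈ U ∪ Y, p v = ∑ v ∈ U \ Y, p v + ∑ v ∈ Y, p v := by
      rw [← sdiff_union_self_eq_union, sum_union sdiff_disjoint]
    have h3 := hmono (U \ Y) U sdiff_subset
    by_cases hc : 8 * ((G.cut (U ∪ Y)).card : ℝ) ≤ ∑ v ∈ U ∪ Y, p v
    · have h4 := hmax (U ∪ Y) ⟨hc, by linarith⟩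
      have h5 : Y = U ∪ Y := eq_of_subset_of_card_le subset_union_right h4
      have h6 : U \ Y = ∅ := sdiff_eq_empty_iff_subset.2 (by rw [h5]; exact subset_union_left)
      have h7 := hp'Y U
      rw [h6, sum_empty] at h7
      have h8 : (0 : ℝ) ≤ ((G.cut U).card : ℝ) := Nat.cast_nonneg _
      linarith
    · have h4 : ((G.cut (U ∪ Y)).card : ℝ) ≤ (G.cut U).card + (G.cut Y).card := by
        exact_mod_cast (card_le_card (G.cut_union_subset U Y)).trans (card_union_le _ _)
      have h5 := hp'Y U
      have h6 := hY.1
      linarith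
  · intro U hU
    have h1 := hlink U
    have h2 := hcompl U
    have h3 : (((G.cut U).card : ℝ) + a) * P ≤ (P / 100) * P := by
      refine mul_le_mul_of_nonneg_right ?_ hPpos.le
      have : ((G.cut U).card : ℝ) ≤ 10 * t := by
        have : (G.cut U).card ≤ 10 * t := by omega
        exact_mod_cast this
      linarith
    have key : ∀ A B : ℝ, 0 ≤ A → A * B ≤ P / 100 * P → 12 / 25 * P ≤ B → A ≤ P / 8 := by
      intro A B hA hAB hB
      have h4 : A * (12 / 25 * P) ≤ A * B := mul_le_mul_of_nonneg_left hB hA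
      have h5 : A * (12 / 25) * P ≤ P / 100 * P := by linarith
      have := le_of_mul_le_mul_right h5 hPpos
      linarith
    rcases le_total (∑ v ∈ U, p v) (∑ v ∈ Uᶜ, p v) with h | h
    · exact Or.inl ((sum_le_sum fun v _ => hp'p v).trans
        (key _ _ (hm0 U) (h1.trans h3) (by linarith)))
    · exact Or.inr ((sum_le_sum fun v _ => hp'p v).trans
        (key _ _ (hm0 Uᶜ) (by rw [mul_comm]; exact h1.trans h3) (by linarith)))

lemma card_cut_le_sub {D : Finset E} {V₀ : Finset V} (hV₀ : G.cut V₀ ⊆ D)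
    (U : Finset {v // v ∈ V₀}) :
    G.cut (U.map ⟨Subtype.val, Subtype.val_injective⟩) \ D ⊆
      ((G.sub D V₀).cut U).map ⟨Subtype.val, Subtype.val_injective⟩ := by
  intro e he
  rw [mem_sdiff, mem_cut] at he
  have h0 : e ∉ G.cut V₀ := fun h => he.2 (hV₀ h)
  rw [mem_cut, not_not] at h0
  have hsub : ∀ v, v ∈ U.map ⟨Subtype.val, Subtype.val_injective⟩ → v ∈ V₀ := by
    intro v hv
    obtain ⟨u, -, rfl⟩ := mem_map.1 hv
    exact u.2
  have h1 : G.src e ∈ V₀ := by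
    by_contra h
    have h2 := fun h3 => h (hsub _ h3)
    have h4 := fun h3 => h (h0.2 (hsub _ h3))
    exact he.1 (iff_of_false h2 h4)
  refine mem_map.2 ⟨⟨e, he.2, h1, h0.1 h1⟩, ?_, rfl⟩
  rw [mem_cut]
  intro h
  refine he.1 ?_
  have hmem : ∀ v (hv : v ∈ V₀), v ∈ U.map ⟨Subtype.val, Subtype.val_injective⟩ ↔
      (⟨v, hv⟩ : {v // v ∈ V₀}) ∈ U := by
    intro v hv
    simp [hv]
  rw [hmem _ h1, hmem _ (h0.1 h1)]
  exact h

/-- Linked weighted pairs in a multigraph whose dual has cycle space exceeding the cuts by at most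
`2 g` dimensions can be routed with congestion 3. -/
theorem exists_routing_of_genus (heven : ∀ U, H.IsEven (G.cut U))
    (hstar : ∀ (x : V) (Φ : Finset F), (∃ e f, G.Inc e x ∧ H.Inc e f ∧ f ∈ Φ) →
      (∃ e f, G.Inc e x ∧ H.Inc e f ∧ f ∉ Φ) → ∃ e, G.Inc e x ∧ e ∈ H.cut Φ)
    {g : ℕ} (hg : 0 < g)
    (hdim : Module.finrank (ZMod 2) H.cycleSpace ≤
      Module.finrank (ZMod 2) (LinearMap.range G.delta) + 2 * g) (ht : 2 ≤ t)
    {pos : ι × Bool → V} (hpos : Function.Injective pos) {q : ι → ℝ}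
    (hq : ∀ d, 0 ≤ q d) (hq1 : ∀ d, q d ≤ 1) (htP : 3000 * (g : ℝ) * t ≤ ∑ v, wt pos q v)
    (hlink : ∀ U : Finset V, (∑ v ∈ U, wt pos q v) * ∑ v ∈ Uᶜ, wt pos q v ≤
      (G.cut U).card * ∑ v, wt pos q v) :
    ∃ S : Finset ι, t ≤ 6 * S.card ∧ ∃ K : ι → Finset E,
      (∀ d ∈ S, G.Connects (K d) {pos (d, true), pos (d, false)}) ∧
      ∀ e, (S.filter fun d => e ∈ K d).card ≤ 3 := by
  set p : V → ℝ := wt pos q with hp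
  set P : ℝ := ∑ v, p v with hPdef
  have hp0 : ∀ v, 0 ≤ p v := wt_nonneg hq
  have hm0 : ∀ U : Finset V, 0 ≤ ∑ v ∈ U, p v := fun U => sum_nonneg fun v _ => hp0 v
  have hmono : ∀ U W : Finset V, U ⊆ W → ∑ v ∈ U, p v ≤ ∑ v ∈ W, p v := fun U W h =>
    sum_le_sum_of_subset_of_nonneg h fun v _ _ => hp0 v
  have hcompl : ∀ U : Finset V, ∑ v ∈ U, p v + ∑ v ∈ Uᶜ, p v = P := fun U =>
    sum_add_sum_compl U p
  have htR : (2 : ℝ) ≤ t := by exact_mod_cast ht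
  have hgR : (1 : ℝ) ≤ g := by exact_mod_cast hg
  have htP' : 3000 * (t : ℝ) ≤ P := by nlinarith
  have hPpos : 0 < P := by linarith
  obtain ⟨D, hDc, hDK⟩ := exists_deletion heven hdim (10 * t)
  have hDR : (D.card : ℝ) ≤ P / 150 := by
    have : (D.card : ℝ) ≤ 2 * g * (10 * t) := by exact_mod_cast hDc
    linarith
  obtain ⟨V₀, hV₀, hmin⟩ := (univ.filter fun U : Finset V =>
      G.cut U ⊆ D ∧ P / 2 < ∑ v ∈ U, p v).exists_min_image card
    ⟨univ, by
      have hcu : G.cut univ = ∅ := by ext; simp [mem_cut]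
      exact mem_filter.2 ⟨mem_univ _, hcu.le.trans (empty_subset _), by linarith⟩⟩
  simp only [mem_filter, mem_univ, true_and] at hV₀ hmin
  have hthin : ∀ U, G.cut U ⊆ D → ∑ v ∈ U, p v ≤ P / 2 → ∑ v ∈ U, p v ≤ P / 75 := by
    intro U hU hUP
    have h1 := hlink U
    have h2 := hcompl U
    have h3 : ((G.cut U).card : ℝ) ≤ D.card := by exact_mod_cast card_le_card hU
    have h4 : (∑ v ∈ U, p v) * (P / 2) ≤ (∑ v ∈ U, p v) * ∑ v ∈ Uᶜ, p v :=
      mul_le_mul_of_nonneg_left (by linarith) (hm0 U)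
    have h5 : ((G.cut U).card : ℝ) * P ≤ P / 150 * P :=
      mul_le_mul_of_nonneg_right (by linarith) hPpos.le
    have h6 : (∑ v ∈ U, p v) / 2 * P ≤ P / 150 * P := by linarith
    have := le_of_mul_le_mul_right h6 hPpos
    linarith
  have hV₀c : ∑ v ∈ V₀ᶜ, p v ≤ P / 75 := by
    refine hthin _ (by rw [cut_compl]; exact hV₀.1) ?_
    linarith [hcompl V₀, hV₀.2]
  have hD' := isDualPair_sub heven hstar hV₀.1 hDK
  let lift : Finset {v // v ∈ V₀} → Finset V := fun U => U.map ⟨Subtype.val, Subtype.val_injective⟩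
  have hlift : ∀ (U : Finset {v // v ∈ V₀}) v, v ∈ lift U ↔
      ∃ h : v ∈ V₀, (⟨v, h⟩ : {v // v ∈ V₀}) ∈ U := by
    intro U v
    simp [lift]
  have hliftV : ∀ U : Finset {v // v ∈ V₀}, lift U ⊆ V₀ := fun U v hv => ((hlift U v).1 hv).1
  have hcutle : ∀ U : Finset {v // v ∈ V₀},
      (G.cut (lift U)).card ≤ ((G.sub D V₀).cut U).card + D.card := by
    intro U
    have h1 := card_le_card (card_cut_le_sub hV₀.1 U)
    rw [card_map] at h1
    have h2 := card_le_card_sdiff_add_card (s := G.cut (lift U)) (t := D)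
    exact h2.trans (Nat.add_le_add_right h1 _)
  have hconn : (G.sub D V₀).Conn := by
    intro U hU
    by_contra hcon
    rw [not_or] at hcon
    have hcutD : G.cut (lift U) ⊆ D := by
      have h1 := card_cut_le_sub hV₀.1 U
      rw [hU, map_empty, subset_empty, sdiff_eq_empty_iff_subset] at h1
      exact h1
    have hne : ∃ v ∈ V₀, v ∈ lift U := by
      obtain ⟨u, hu⟩ := nonempty_iff_ne_empty.2 hcon.1
      exact ⟨u.1, u.2, (hlift U _).2 ⟨u.2, hu⟩⟩
    have hne' : ∃ v ∈ V₀, v ∉ lift U := by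
      by_contra h
      push Not at h
      exact hcon.2 (eq_univ_iff_forall.2 fun u => ((hlift U _).1 (h u.1 u.2)).2)
    have hsmall : ∀ W, G.cut W ⊆ D → W ⊆ V₀ → (∃ v ∈ V₀, v ∉ W) → ∑ v ∈ W, p v ≤ P / 75 := by
      rintro W hW hWV ⟨v, hv, hvW⟩
      refine hthin W hW (not_lt.1 fun hlt => ?_)
      have h1 := hmin W ⟨hW, hlt⟩
      exact hvW ((eq_of_subset_of_card_le hWV h1) ▸ hv)
    have h1 := hsmall _ hcutD (hliftV U) hne'
    have h2 := hsmall (V₀ \ lift U)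
      ((G.cut_sdiff_subset _ _).trans (union_subset hV₀.1 hcutD)) sdiff_subset (by
        obtain ⟨v, hv, hvU⟩ := hne
        exact ⟨v, hv, fun h => (mem_sdiff.1 h).2 hvU⟩)
    have h3 := sum_sdiff (hliftV U) (f := p)
    linarith [hV₀.2]
  let ι₀ : Type := {d : ι // ∀ b, pos (d, b) ∈ V₀}
  let pos₀ : ι₀ × Bool → {v // v ∈ V₀} := fun x => ⟨pos (x.1.1, x.2), x.1.2 x.2⟩
  let q₀ : ι₀ → ℝ := fun d => q d.1
  have hpos₀ : Function.Injective pos₀ := by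
    rintro ⟨d, b⟩ ⟨d', b'⟩ h
    have h1 := hpos (congrArg Subtype.val h)
    rw [Prod.mk.injEq] at h1
    exact Prod.ext (Subtype.ext h1.1) h1.2
  have hw₀ : ∀ U : Finset {v // v ∈ V₀}, ∑ v ∈ U, wt pos₀ q₀ v ≤ ∑ v ∈ lift U, p v := by
    intro U
    rw [sum_wt, hp, sum_wt]
    let φ : ι₀ × Bool ↪ ι × Bool := ⟨fun x => (x.1.1, x.2), fun x y h => by
      rw [Prod.mk.injEq] at h; exact Prod.ext (Subtype.ext h.1) h.2⟩
    have h1 : ∑ x ∈ univ.map φ, (if pos x ∈ lift U then q x.1 else 0) ≤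
        ∑ x, if pos x ∈ lift U then q x.1 else 0 :=
      sum_le_sum_of_subset_of_nonneg (subset_univ _) fun x _ _ => by
        split_ifs; exacts [hq _, le_rfl]
    rw [sum_map] at h1
    refine le_trans (le_of_eq (sum_congr rfl fun x _ => ?_)) h1
    have h2 : pos (φ x) ∈ lift U ↔ pos₀ x ∈ U := by
      rw [hlift]
      exact ⟨fun ⟨_, h⟩ => h, fun h => ⟨x.1.2 x.2, h⟩⟩
    by_cases h3 : pos₀ x ∈ U
    · rw [if_pos h3, if_pos (h2.2 h3)]; rfl
    · rw [if_neg h3, if_neg fun h => h3 (h2.1 h)]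
  have htot : P - P * (2 / 75) ≤ ∑ v, wt pos₀ q₀ v := by
    rw [sum_wt_univ, hPdef, hp, sum_wt_univ]
    have h1 : ∑ d, q₀ d = ∑ d ∈ univ.filter (fun d => ∀ b, pos (d, b) ∉ V₀ᶜ), q d := by
      refine (sum_subtype _ (fun d => ?_) q).symm
      simp [mem_compl]
    have h2 := sum_filter_add_sum_filter_not univ (fun d => ∀ b, pos (d, b) ∉ V₀ᶜ) q
    have h3 := sum_wt_le_of_filter (pos := pos) hq V₀ᶜ
    have h4 : P = 2 * ∑ d, q d := sum_wt_univ pos q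
    linarith
  obtain ⟨S, hS, K, hK, hKc⟩ := exists_routing_of_nearly_linked (a := D.card) hD' hconn ht rfl hpos₀
    (fun d => hq d.1) (fun d => hq1 d.1) htP' (by linarith)
    hDR (by
      intro U
      have h1 : ∑ v ∈ Uᶜ, wt pos₀ q₀ v ≤ ∑ v ∈ (lift U)ᶜ, p v := by
        refine (hw₀ Uᶜ).trans (hmono _ _ fun v hv => mem_compl.2 fun hv' => ?_)
        obtain ⟨_, h2⟩ := (hlift _ _).1 hv
        obtain ⟨_, h3⟩ := (hlift _ _).1 hv'
        exact mem_compl.1 h2 h3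
      have h2 : 0 ≤ ∑ v ∈ Uᶜ, wt pos₀ q₀ v :=
        sum_nonneg fun v _ => wt_nonneg (fun d : ι₀ => hq d.1) v
      have h3 : ((G.cut (lift U)).card : ℝ) ≤ ((G.sub D V₀).cut U).card + D.card := by
        exact_mod_cast hcutle U
      have h4 := (mul_le_mul (hw₀ U) h1 h2 (hm0 _)).trans ((hlink (lift U)).trans
        (mul_le_mul_of_nonneg_right h3 hPpos.le))
      refine le_trans (le_of_eq ?_) h4
      congr!)
  refine ⟨S.map ⟨Subtype.val, Subtype.val_injective⟩, by rwa [card_map], fun d =>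
    if h : ∀ b, pos (d, b) ∈ V₀ then (K ⟨d, h⟩).map ⟨Subtype.val, Subtype.val_injective⟩ else ∅,
    ?_, ?_⟩
  · intro d hd
    obtain ⟨d, hdS, rfl⟩ := mem_map.1 hd
    simp only [Function.Embedding.coeFn_mk, dif_pos d.2]
    refine connects_of_iff fun W hW x hx y hy hxW => ?_
    let W₀ : Finset {v // v ∈ V₀} := univ.filter fun v => v.1 ∈ W
    have hW₀ : Disjoint (K d) ((G.sub D V₀).cut W₀) := by
      refine disjoint_left.2 fun e he he' => ?_
      refine disjoint_left.1 hW (mem_map.2 ⟨e, he, rfl⟩) ?_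
      rw [mem_cut] at he' ⊢
      simpa [W₀, sub] using he'
    have hmem : ∀ z, z ∈ ({pos (d.1, true), pos (d.1, false)} : Finset V) →
        ∃ h : z ∈ V₀, (⟨z, h⟩ : {v // v ∈ V₀}) ∈
          ({pos₀ (d, true), pos₀ (d, false)} : Finset {v // v ∈ V₀}) := by
      intro z hz
      rw [mem_insert, mem_singleton] at hz
      rcases hz with rfl | rfl
      · exact ⟨d.2 true, mem_insert_self _ _⟩
      · exact ⟨d.2 false, mem_insert_of_mem (mem_singleton_self _)⟩
    obtain ⟨hx₀, hx'⟩ := hmem x hx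
    obtain ⟨hy₀, hy'⟩ := hmem y hy
    have hxy := (hK d hdS).iff hW₀ (by convert hx') (by convert hy')
    simpa [W₀] using hxy.1 (by simpa [W₀] using hxW)
  · intro e
    by_cases he : e ∉ D ∧ G.src e ∈ V₀ ∧ G.dst e ∈ V₀
    · refine le_trans (card_le_card ?_) ((card_map ⟨Subtype.val, Subtype.val_injective⟩).trans_le
        (hKc ⟨e, he⟩))
      intro d hd
      obtain ⟨h1, h2⟩ := mem_filter.1 hd
      obtain ⟨d, h3, rfl⟩ := mem_map.1 h1
      refine mem_map.2 ⟨d, (@mem_filter _ _ (_) _ _).2 ⟨h3, ?_⟩, rfl⟩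
      simp only [Function.Embedding.coeFn_mk, dif_pos d.2] at h2
      obtain ⟨e', he', rfl⟩ := mem_map.1 h2
      exact he'
    · rw [card_eq_zero.2 (filter_eq_empty_iff.2 ?_)]
      · norm_num
      · intro d hd h2
        obtain ⟨d, h3, rfl⟩ := mem_map.1 hd
        simp only [Function.Embedding.coeFn_mk, dif_pos d.2] at h2
        obtain ⟨e', he', rfl⟩ := mem_map.1 h2
        exact he e'.2

end reduction
end MGraph

section conversion
open scoped Classical
open MGraph

lemma one_le_ecount {α : Type} {l : List α} {e : α} (h : e ∈ l) : 1 ≤ ecount l e := by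
  unfold ecount
  exact List.one_le_count_iff.2 h

lemma ecount_eq_zero {α : Type} {l : List α} {e : α} (h : e ∉ l) : ecount l e = 0 := by
  unfold ecount
  exact List.count_eq_zero_of_not_mem h

lemma ecount_le_one {α : Type} {l : List α} (h : l.Nodup) (e : α) : ecount l e ≤ 1 := by
  unfold ecount
  exact List.nodup_iff_count_le_one.1 h e

variable {V : Type} [Fintype V] {G : SimpleGraph V}

lemma mem_cut_baseGraph {a b : V} (h : G.Adj a b) (U : Finset V) :
    (⟨s(a, b), h⟩ : G.edgeSet) ∈ (baseGraph G).cut U ↔ ¬ (a ∈ U ↔ b ∈ U) := by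
  rw [mem_cut]
  have h1 := edgeDart_edge (⟨s(a, b), h⟩ : G.edgeSet)
  rw [SimpleGraph.dart_edge_eq_mk'_iff'] at h1
  change ¬ ((edgeDart _).fst ∈ U ↔ (edgeDart _).snd ∈ U) ↔ _
  rcases h1 with ⟨h1, h2⟩ | ⟨h1, h2⟩
  · rw [h1, h2]
  · rw [h1, h2, @iff_comm (b ∈ U)]

lemma exists_isPath_of_connects {K : Finset G.edgeSet} {u v : V}
    (h : (baseGraph G).Connects K {u, v}) :
    ∃ Q : G.Walk u v, Q.IsPath ∧ ∀ e ∈ Q.edges, ∃ he : e ∈ G.edgeSet, ⟨e, he⟩ ∈ K := by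
  let U : Finset V := univ.filter fun z =>
    ∃ p : G.Walk u z, ∀ e ∈ p.edges, ∃ he : e ∈ G.edgeSet, (⟨e, he⟩ : G.edgeSet) ∈ K
  have hstep : ∀ a b (hab : G.Adj a b), (⟨s(a, b), hab⟩ : G.edgeSet) ∈ K → a ∈ U → b ∈ U := by
    intro a b hab hK ha
    obtain ⟨p, hp⟩ := (mem_filter.1 ha).2
    refine mem_filter.2 ⟨mem_univ _, p.concat hab, fun e he => ?_⟩
    rw [SimpleGraph.Walk.edges_concat, List.concat_eq_append, List.mem_append,
      List.mem_singleton] at he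
    rcases he with he | rfl
    · exact hp e he
    · exact ⟨hab, hK⟩
  have hdisj : Disjoint K ((baseGraph G).cut U) := by
    refine disjoint_left.2 ?_
    rintro ⟨e, he⟩ hK
    induction e using Sym2.ind with
    | _ a b =>
      have hK' : (⟨s(b, a), SimpleGraph.Adj.symm he⟩ : G.edgeSet) ∈ K := by
        convert hK using 1; exact Subtype.ext Sym2.eq_swap
      rw [mem_cut_baseGraph he, not_not]
      exact ⟨hstep a b he hK, hstep b a _ hK'⟩
  have hu : u ∈ U := mem_filter.2 ⟨mem_univ _, .nil, by simp⟩
  have hv : v ∈ U := by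
    rcases h U hdisj with h | h
    · exact h (by simp)
    · exact absurd hu (disjoint_left.1 h (by simp))
  obtain ⟨p, hp⟩ := (mem_filter.1 hv).2
  exact ⟨p.bypass, p.bypass_isPath, fun e he => hp e (p.edges_bypass_subset_edges he)⟩

/-- Edge sets connecting the pairs yield paths with the same congestion. -/
lemma hasIntegralRouting_of_connects {n c : ℕ} {s t : Fin n → V} {I : Finset (Fin n)}
    {K : Fin n → Finset G.edgeSet} (hK : ∀ d ∈ I, (baseGraph G).Connects (K d) {s d, t d})
    (hc : ∀ e, (I.filter fun d => e ∈ K d).card ≤ c) {N : ℝ} (hN : N ≤ I.card) :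
    HasIntegralRouting G s t c N := by
  choose Q hQp hQ using fun (d : Fin n) (hd : d ∈ I) => exists_isPath_of_connects (hK d hd)
  refine ⟨I, Q, hN, fun e => ?_⟩
  by_cases he : e ∈ G.edgeSet
  · refine le_trans ?_ (hc ⟨e, he⟩)
    rw [card_filter, ← sum_attach I]
    refine sum_le_sum fun d _ => ?_
    by_cases h : e ∈ (Q d.1 d.2).edges
    · obtain ⟨_, h'⟩ := hQ d.1 d.2 e h
      rw [if_pos h']
      exact ecount_le_one (hQp d.1 d.2).isTrail.edges_nodup e
    · rw [ecount_eq_zero h]; exact Nat.zero_le _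
  · rw [sum_eq_zero]
    · exact Nat.zero_le _
    · exact fun d _ => ecount_eq_zero fun h => he ((Q d.1 d.2).edges_subset_edgeSet h)

lemma exists_mem_cut_of_walk {U : Finset V} {u v : V} (p : G.Walk u v)
    (h : ¬ (u ∈ U ↔ v ∈ U)) : ∃ e ∈ (baseGraph G).cut U, e.1 ∈ p.edges := by
  induction p with
  | nil => exact absurd Iff.rfl h
  | @cons a b c hab p ih =>
    by_cases h1 : a ∈ U ↔ b ∈ U
    · obtain ⟨e, he, hep⟩ := ih (by rwa [← h1])
      exact ⟨e, he, by rw [SimpleGraph.Walk.edges_cons]; exact List.mem_cons_of_mem _ hep⟩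
    · exact ⟨⟨s(a, b), hab⟩, (mem_cut_baseGraph hab U).2 h1, by simp⟩

/-- Flow-well-linkedness bounds the size of every cut from below. -/
lemma FlowWellLinked.mul_le_card_cut {X : Finset V} {p : V → ℝ} (h : FlowWellLinked G X p)
    (hp : ∀ v, 0 ≤ p v) (hpX : ∀ v, v ∉ X → p v = 0) (U : Finset V) :
    (∑ v ∈ U, p v) * ∑ v ∈ Uᶜ, p v ≤ ((baseGraph G).cut U).card * ∑ v, p v := by
  obtain ⟨m, a, b, P, f, hf, hcap, hflow⟩ := h
  have hX : ∑ v ∈ X, p v = ∑ v, p v :=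
    sum_subset (subset_univ _) fun v _ hv => hpX v hv
  rw [hX] at hflow
  have hAX : ∀ W : Finset V, ∑ v ∈ W, p v = ∑ v ∈ W ∩ X, p v := fun W =>
    (sum_subset inter_subset_left fun v hv hv' =>
      hpX v fun hvX => hv' (mem_inter.2 ⟨hv, hvX⟩)).symm
  rcases (sum_nonneg fun v _ => hp v : 0 ≤ ∑ v, p v).eq_or_lt with h0 | h0
  · have h1 : ∑ v ∈ U, p v = 0 := sum_eq_zero fun v _ =>
      (sum_eq_zero_iff_of_nonneg fun v _ => hp v).1 h0.symm v (mem_univ v)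
    rw [h1, ← h0]; simp
  have hi : ∀ i, (∑ u ∈ U ∩ X, ∑ v ∈ Uᶜ ∩ X,
      if (a i = u ∧ b i = v) ∨ (a i = v ∧ b i = u) then f i else 0) ≤
      ∑ e ∈ (baseGraph G).cut U, (ecount (P i).edges e.1 : ℝ) * f i := by
    intro i
    have hnn : ∀ e ∈ (baseGraph G).cut U, 0 ≤ (ecount (P i).edges e.1 : ℝ) * f i := fun e _ =>
      mul_nonneg (Nat.cast_nonneg _) (hf i)
    by_cases hab : a i ∈ U ↔ b i ∈ U
    · refine le_trans (le_of_eq (sum_eq_zero fun u hu => sum_eq_zero fun v hv => if_neg ?_))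
        (sum_nonneg hnn)
      have hu' := (mem_inter.1 hu).1
      have hv' := mem_compl.1 (mem_inter.1 hv).1
      rintro (⟨rfl, rfl⟩ | ⟨rfl, rfl⟩)
      · exact hv' (hab.1 hu')
      · exact hv' (hab.2 hu')
    · obtain ⟨e, he, heP⟩ := exists_mem_cut_of_walk (P i) hab
      have h1 : f i ≤ (ecount (P i).edges e.1 : ℝ) * f i :=
        le_mul_of_one_le_left (hf i) (by exact_mod_cast one_le_ecount heP)
      refine le_trans ?_ (h1.trans (single_le_sum hnn he))
      let z : V × V := if a i ∈ U then (a i, b i) else (b i, a i)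
      rw [← sum_product']
      refine (sum_le_sum (g := fun x => if z = x then f i else 0) fun x hx => ?_).trans ?_
      · have hx' := mem_product.1 hx
        have hu' := (mem_inter.1 hx'.1).1
        have hv' := mem_compl.1 (mem_inter.1 hx'.2).1
        by_cases hz : (a i = x.1 ∧ b i = x.2) ∨ (a i = x.2 ∧ b i = x.1)
        · have : z = x := by
            rcases hz with ⟨h2, h3⟩ | ⟨h2, h3⟩
            · simp only [z]; rw [h2, h3, if_pos hu']
            · simp only [z]; rw [h2, h3, if_neg hv']
          rw [if_pos hz, if_pos this]
        · rw [if_neg hz]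
          split_ifs
          exacts [hf i, le_rfl]
      · rw [sum_ite_eq]
        split_ifs
        exacts [le_rfl, hf i]
  have key : (∑ v ∈ U, p v) * (∑ v ∈ Uᶜ, p v) / ∑ v, p v ≤ ((baseGraph G).cut U).card := by
    calc (∑ v ∈ U, p v) * (∑ v ∈ Uᶜ, p v) / ∑ v, p v
        = ∑ u ∈ U ∩ X, ∑ v ∈ Uᶜ ∩ X, p u * p v / ∑ w, p w := by
          rw [hAX U, hAX Uᶜ, sum_mul_sum, sum_div]
          exact sum_congr rfl fun u _ => (sum_div (Uᶜ ∩ X) (fun v => p u * p v) _)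
      _ = ∑ u ∈ U ∩ X, ∑ v ∈ Uᶜ ∩ X, ∑ i,
            if (a i = u ∧ b i = v) ∨ (a i = v ∧ b i = u) then f i else 0 := by
          refine sum_congr rfl fun u hu => sum_congr rfl fun v hv => ?_
          rw [← hflow u (mem_inter.1 hu).2 v (mem_inter.1 hv).2 ?_]
          · rintro rfl
            exact mem_compl.1 (mem_inter.1 hv).1 (mem_inter.1 hu).1
      _ = ∑ i, ∑ u ∈ U ∩ X, ∑ v ∈ Uᶜ ∩ X,
            if (a i = u ∧ b i = v) ∨ (a i = v ∧ b i = u) then f i else 0 := by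
          exact (sum_congr rfl fun u _ => sum_comm).trans sum_comm
      _ ≤ ∑ i, ∑ e ∈ (baseGraph G).cut U, (ecount (P i).edges e.1 : ℝ) * f i :=
          sum_le_sum fun i _ => hi i
      _ = ∑ e ∈ (baseGraph G).cut U, ∑ i, (ecount (P i).edges e.1 : ℝ) * f i := sum_comm
      _ ≤ ∑ e ∈ (baseGraph G).cut U, (1 : ℝ) := sum_le_sum fun e _ => hcap e.1
      _ = _ := by simp
  exact (div_le_iff₀ h0).1 key

namespace FracSol

variable {n : ℕ} {s t : Fin n → V}

lemma demVal_nonneg (x : FracSol G s t) (d : Fin n) : 0 ≤ x.demVal d :=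
  sum_nonneg fun i _ => by split_ifs; exacts [x.nonneg i, le_rfl]

lemma sum_demVal (x : FracSol G s t) : ∑ d, x.demVal d = x.value := by
  unfold demVal value
  rw [sum_comm]
  exact sum_congr rfl fun i _ => by simp

lemma mul_vertexMarg (x : FracSol G s t) (hst : ∀ d, s d ≠ t d) (ρ : ℝ) (v : V) :
    ρ * x.vertexMarg v =
      wt (fun y : Fin n × Bool => if y.2 then s y.1 else t y.1) (fun d => ρ * x.demVal d) v := by
  unfold vertexMarg wt
  rw [Fintype.sum_prod_type, mul_sum]
  refine sum_congr rfl fun d _ => ?_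
  rw [Fintype.sum_bool]
  by_cases h1 : s d = v
  · have h2 : t d ≠ v := fun h => hst d (h1.trans h.symm)
    simp [h1, h2]
  · by_cases h2 : t d = v <;> simp [h1, h2]

end FracSol

/-- The conclusion of the main theorem with an explicit constant. -/
lemma hasIntegralRouting_of_genusLE {g : ℕ} (hg : 0 < g) (hG : genusLE G g) {n : ℕ}
    {s t : Fin n → V} (hst : IsMatchingInstance s t) (x : FracSol G s t) {ρ : ℝ} (hρ : 0 ≤ ρ)
    (hρ1 : ρ ≤ 1) (hlink : FlowWellLinked G (terminalSet s t) fun v => ρ * x.vertexMarg v) :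
    HasIntegralRouting G s t 3 (1 / 100000 * ρ * x.value / g) := by
  have hgR : (0 : ℝ) < g := by exact_mod_cast hg
  have hv0 : 0 ≤ x.value := sum_nonneg fun i _ => x.nonneg i
  set N : ℝ := 1 / 100000 * ρ * x.value / g with hN
  have hNg : N * g = 1 / 100000 * ρ * x.value := div_mul_cancel₀ _ hgR.ne'
  have hN0 : 0 ≤ N := by positivity
  rcases hN0.eq_or_lt with h0 | h0
  · exact ⟨∅, fun d hd => absurd hd (notMem_empty d), by simp [← h0], fun e => by simp⟩
  rcases le_total N 1 with h1 | h1
  · have hval : x.value ≠ 0 := by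
      intro h
      rw [h] at hN
      simp [hN] at h0
    obtain ⟨i, -, -⟩ := exists_ne_zero_of_sum_ne_zero hval
    refine hasIntegralRouting_of_connects (I := {x.dem i}) (K := fun _ => univ) (fun d hd => ?_)
      (fun e => (card_filter_le _ _).trans (by simp)) (by simpa using h1)
    rw [mem_singleton] at hd
    subst hd
    intro U hU
    have hU' : ¬ ¬ (s (x.dem i) ∈ U ↔ t (x.dem i) ∈ U) := fun h => by
      obtain ⟨e, he, -⟩ := exists_mem_cut_of_walk (x.fpath i) h
      exact disjoint_left.1 hU (mem_univ _) he
    rw [not_not] at hU'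
    by_cases h : s (x.dem i) ∈ U
    · left
      simp [insert_subset_iff, h, hU'.1 h]
    · right
      simp [h, show t (x.dem i) ∉ U from fun h' => h (hU'.2 h')]
  · let pos : Fin n × Bool → V := fun y => if y.2 then s y.1 else t y.1
    let q : Fin n → ℝ := fun d => ρ * x.demVal d
    have hpos : Function.Injective pos := hst
    have hsne : ∀ d, s d ≠ t d := fun d h => by
      have := @hpos (d, true) (d, false) h
      simp at this
    have hq : ∀ d, 0 ≤ q d := fun d => mul_nonneg hρ (x.demVal_nonneg d)
    have hq1 : ∀ d, q d ≤ 1 := fun d => mul_le_one₀ hρ1 (x.demVal_nonneg d) (x.perDemand d)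
    have hwt : (fun v => ρ * x.vertexMarg v) = wt pos q :=
      funext fun v => x.mul_vertexMarg hsne ρ v
    rw [hwt] at hlink
    have htot : ∑ v, wt pos q v = 2 * (ρ * x.value) := by
      rw [sum_wt_univ, ← x.sum_demVal, mul_sum univ _ ρ]
    have hoff : ∀ v, v ∉ terminalSet s t → wt pos q v = 0 := by
      intro v hv
      refine sum_eq_zero fun y _ => if_neg ?_
      rintro rfl
      obtain ⟨d, _ | _⟩ := y
      · exact hv (mem_union_right _ (mem_image_of_mem t (mem_univ d)))
      · exact hv (mem_union_left _ (mem_image_of_mem s (mem_univ d)))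
    obtain ⟨F, _, H, heven, hstar, hdim⟩ := hG.exists_dual
    have hP : 200000 * N * g = ∑ v, wt pos q v := by rw [htot]; linarith
    set T : ℕ := ⌊60 * N⌋₊ with hT
    have hT1 : (T : ℝ) ≤ 60 * N := Nat.floor_le (by linarith)
    have hT2 : 60 * N < T + 1 := Nat.lt_floor_add_one _
    have hT3 : 2 ≤ T := Nat.le_floor (by push_cast; linarith)
    obtain ⟨S, hS, K, hK, hKc⟩ := exists_routing_of_genus heven hstar hg hdim hT3 hpos hq hq1
      (by
        rw [← hP]
        have := mul_le_mul_of_nonneg_left hT1 hgR.le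
        nlinarith [mul_pos h0 hgR])
      (hlink.mul_le_card_cut (wt_nonneg hq) hoff)
    refine hasIntegralRouting_of_connects (I := S) (K := K) hK (fun e => by convert hKc e) ?_
    have hS' : (T : ℝ) ≤ 6 * S.card := by exact_mod_cast hS
    linarith

end conversion

/-- **Well-linked MEDP in bounded-genus graphs (Theorem `thm:well-linked-genus`).**
There is a constant `c > 0` such that: for every graph `G` of genus `g > 0`, every
matching MEDP instance `(G,X,M)` with feasible fractional solution `x`, and every
scalar `ρ ≤ 1` such that the terminal set `X` is `π`-flow-well-linked in `G` with
`π(v) = ρ·x(v)`, at least `c·ρ·val(x)/g` of the demand pairs can be routed integrally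
with congestion `3`. -/
theorem medp_well_linked_genus :
    ∃ c : ℝ, 0 < c ∧
      ∀ (V : Type) [Fintype V] [DecidableEq V] (G : SimpleGraph V)
        (g : ℕ), 0 < g → genusLE G g →
        ∀ (n : ℕ) (s t : Fin n → V), IsMatchingInstance s t →
        ∀ (x : FracSol G s t) (ρ : ℝ), 0 ≤ ρ → ρ ≤ 1 →
        FlowWellLinked G (terminalSet s t) (fun v => ρ * x.vertexMarg v) →
        HasIntegralRouting G s t 3 (c * ρ * x.value / (g : ℝ)) := by
  refine ⟨1 / 100000, by norm_num, fun V _ inst G g hg hG n s t hst x ρ hρ hρ1 hlink => ?_⟩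
  have hinst : inst = fun a b => Classical.propDecidable (a = b) := Subsingleton.elim _ _
  subst hinst
  exact hasIntegralRouting_of_genusLE hg hG hst x hρ hρ1 hlink
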